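/- arXiv:0907.4436 — 6 statements merged into one kernel-verified Lean document; each statement's English description precedes it below -/
import Mathlib

section
/- Let K be a field with char K = 2, let α ∈ K be nonzero, and let A ∈ M_n(K). Then A is an (α,−α)-composite (equivalently, an (α,α)-composite, since −α = α) if and only if for every λ in the algebraic closure K̄ with λ ∉ {0, α}, all Jordan blocks of A for the eigenvalue λ have even size, i.e. j_{2k+1}(A,λ) = 0 for every k ≥ 0. -/
open Polynomial

/-- `matNk A lam k` = number of Jordan blocks of `A` of size `≥ k` for eigenvalue `lam`,
i.e. `dim ker (A - lam·I)^k - dim ker (A - lam·I)^(k-1)`. -/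
noncomputable def matNk {L : Type*} [Field L] {n : ℕ} (A : Matrix (Fin n) (Fin n) L)
    (lam : L) (k : ℕ) : ℕ :=
  Module.finrank L (LinearMap.ker (((A - lam • 1) ^ k).mulVecLin)) -
    Module.finrank L (LinearMap.ker (((A - lam • 1) ^ (k - 1)).mulVecLin))

/-- `matJk A lam k` = number of Jordan blocks of `A` of size exactly `k` for eigenvalue `lam`. -/
noncomputable def matJk {L : Type*} [Field L] {n : ℕ} (A : Matrix (Fin n) (Fin n) L)
    (lam : L) (k : ℕ) : ℕ :=
  matNk A lam k - matNk A lam (k + 1)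

/-- A matrix is an `(a,b)`-composite if it is `a•P + b•Q` for some idempotents `P, Q`. -/
def Matrix.IsABComposite {K : Type*} [Field K] {m : Type*} [Fintype m] [DecidableEq m]
    (a b : K) (A : Matrix m m K) : Prop :=
  ∃ P Q : Matrix m m K, P * P = P ∧ Q * Q = Q ∧ A = a • P + b • Q


open Matrix

theorem LinearMap.finrank_ker_pow_succ {L V : Type*} [Field L] [AddCommGroup V] [Module L V]
    [FiniteDimensional L V] (T : V →ₗ[L] V) (k : ℕ) :
    Module.finrank L (LinearMap.ker (T ^ (k + 1))) =
      Module.finrank L (LinearMap.ker (T ^ k)) +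
        Module.finrank L ↥(LinearMap.ker T ⊓ LinearMap.range (T ^ k)) := by
  have h := ((T ^ k).domRestrict (LinearMap.ker (T ^ (k + 1)))).finrank_range_add_finrank_ker
  have hr : LinearMap.range ((T ^ k).domRestrict (LinearMap.ker (T ^ (k + 1)))) =
      LinearMap.ker T ⊓ LinearMap.range (T ^ k) := by
    ext y
    constructor
    · rintro ⟨⟨x, hx⟩, rfl⟩
      refine ⟨?_, x, rfl⟩
      rw [LinearMap.mem_ker, pow_succ', Module.End.mul_apply] at hx
      exact hx
    · rintro ⟨hy, x, rfl⟩
      refine ⟨⟨x, ?_⟩, rfl⟩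
      rw [LinearMap.mem_ker, pow_succ', Module.End.mul_apply]
      exact hy
  have hle : LinearMap.ker (T ^ k) ≤ LinearMap.ker (T ^ (k + 1)) := fun x hx => by
    rw [LinearMap.mem_ker] at hx ⊢
    rw [pow_succ', Module.End.mul_apply, hx, map_zero]
  rw [hr, LinearMap.ker_domRestrict] at h
  change _ + Module.finrank L ((LinearMap.ker (T ^ k)).submoduleOf _) = _ at h
  rw [(Submodule.submoduleOfEquivOfLe hle).finrank_eq] at h
  omega

theorem matNk_succ {L : Type*} [Field L] {n : ℕ} (A : Matrix (Fin n) (Fin n) L) (lam : L)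
    (k : ℕ) :
    matNk A lam (k + 1) = Module.finrank L ↥(LinearMap.ker (A - lam • 1).toLin' ⊓
      LinearMap.range ((A - lam • 1).toLin' ^ k)) := by
  have h := LinearMap.finrank_ker_pow_succ (A - lam • 1).toLin' k
  rw [matNk, Nat.add_sub_cancel, ← Matrix.toLin'_apply', ← Matrix.toLin'_apply',
    Matrix.toLin'_pow, Matrix.toLin'_pow]
  omega

/-- There is no Jordan block of size exactly `k + 1` iff every vector of the kernel lying in the
range of the `k`-th power of `A - lam` lies in the range of the next power. -/
theorem matJk_succ_eq_zero_iff {L : Type*} [Field L] {n : ℕ} (A : Matrix (Fin n) (Fin n) L)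
    (lam : L) (k : ℕ) :
    matJk A lam (k + 1) = 0 ↔ ∀ v, (A - lam • 1) ^ (k + 1) *ᵥ v = 0 →
      ∃ w, (A - lam • 1) ^ k *ᵥ v = (A - lam • 1) ^ (k + 1) *ᵥ w := by
  rw [matJk, matNk_succ, matNk_succ]
  generalize A - lam • 1 = N
  have hle : LinearMap.ker N.toLin' ⊓ LinearMap.range (N.toLin' ^ (k + 1)) ≤
      LinearMap.ker N.toLin' ⊓ LinearMap.range (N.toLin' ^ k) := by
    refine inf_le_inf_left _ ?_
    rintro _ ⟨x, rfl⟩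
    exact ⟨N.toLin' x, by rw [pow_succ, Module.End.mul_apply]⟩
  rw [Nat.sub_eq_zero_iff_le]
  constructor
  · intro h v hv
    have heq := Submodule.eq_of_le_of_finrank_le hle h
    have hm : N ^ k *ᵥ v ∈ LinearMap.ker N.toLin' ⊓ LinearMap.range (N.toLin' ^ k) := by
      refine ⟨?_, v, ?_⟩
      · rw [SetLike.mem_coe, LinearMap.mem_ker, Matrix.toLin'_apply, Matrix.mulVec_mulVec,
          ← pow_succ', hv]
      · rw [← Matrix.toLin'_pow, Matrix.toLin'_apply]
    rw [← heq] at hm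
    obtain ⟨w, hw⟩ := hm.2
    rw [← Matrix.toLin'_pow, Matrix.toLin'_apply] at hw
    exact ⟨w, hw.symm⟩
  · intro h
    apply Submodule.finrank_mono
    rintro _ ⟨hy, v, rfl⟩
    refine ⟨hy, ?_⟩
    rw [← Matrix.toLin'_pow, Matrix.toLin'_apply, SetLike.mem_coe, LinearMap.mem_ker,
      Matrix.toLin'_apply, Matrix.mulVec_mulVec, ← pow_succ'] at hy
    obtain ⟨w, hw⟩ := h v hy
    exact ⟨w, by rw [← Matrix.toLin'_pow, ← Matrix.toLin'_pow, Matrix.toLin'_apply,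
      Matrix.toLin'_apply, hw]⟩

/-- In characteristic two, `A` is an `(α, -α)`-composite iff some idempotent `P` satisfies
`A P + P A = α⁻¹ A² + A`. -/
theorem Matrix.isABComposite_neg_iff {K : Type*} [Field K] [CharP K 2] {m : Type*} [Fintype m]
    [DecidableEq m] {α : K} (hα : α ≠ 0) (A : Matrix m m K) :
    Matrix.IsABComposite α (-α) A ↔
      ∃ P : Matrix m m K, P * P = P ∧ A * P + P * A = α⁻¹ • (A * A) + A := by
  have h2 (B : Matrix m m K) : B + B = 0 := by
    ext i j; exact CharTwo.add_self_eq_zero _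
  rw [CharTwo.neg_eq]
  constructor
  · rintro ⟨P, Q, hP, hQ, rfl⟩
    refine ⟨P, hP, ?_⟩
    simp only [mul_add, add_mul, smul_mul_assoc, mul_smul_comm, hP, hQ, smul_add,
      inv_smul_smul₀ hα]
    have := h2 (α • P)
    have := h2 (α • Q)
    grind
  · rintro ⟨P, hP, h⟩
    refine ⟨P, α⁻¹ • A + P, hP, ?_, ?_⟩
    · have e : (α⁻¹ • A + P) * (α⁻¹ • A + P) =
          α⁻¹ • (α⁻¹ • (A * A)) + α⁻¹ • (A * P + P * A) + P * P := by
        simp only [mul_add, add_mul, smul_mul_assoc, mul_smul_comm, smul_add]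
        abel
      rw [e, h, hP, smul_add, ← add_assoc, h2, zero_add]
    · rw [smul_add, smul_inv_smul₀ hα, add_comm, add_assoc, h2, add_zero]

theorem matJk_odd_eq_zero_of_idempotent {L : Type*} [Field L] [CharP L 2] {n : ℕ} {β lam : L}
    {A P : Matrix (Fin n) (Fin n) L} (h : A * P + P * A = β • (A * A) + A)
    (hlam : β * lam ^ 2 + lam ≠ 0) (k : ℕ) : matJk A lam (2 * k + 1) = 0 := by
  have h2 (B : Matrix (Fin n) (Fin n) L) : B + B = 0 := by
    ext i j; exact CharTwo.add_self_eq_zero _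
  rw [matJk_succ_eq_zero_iff]
  set N := A - lam • 1 with hN
  have hA : A = N + lam • 1 := by rw [hN]; abel
  clear_value N
  subst hA
  have hNP : N * P = P * N + (β • (N * N) + N + (β * lam ^ 2 + lam) • 1) := by
    have h2' := h2 (P * N)
    have h3 := h2 (lam • P)
    have h4 := h2 (β • lam • N)
    simp only [mul_add, add_mul, smul_mul_assoc, mul_smul_comm, mul_one, one_mul, smul_add] at h
    rw [add_smul, show β * lam ^ 2 = β * (lam * lam) by ring, mul_smul, mul_smul]
    grind
  have hcomm : Commute (N ^ 2) P := by
    have h3 : N * (N * P) = P * N * N +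
        (N * (β • (N * N) + N + (β * lam ^ 2 + lam) • 1) +
          N * (β • (N * N) + N + (β * lam ^ 2 + lam) • 1)) := by
      conv_lhs => rw [hNP, mul_add, ← mul_assoc, hNP]
      simp only [mul_add, add_mul, smul_mul_assoc, mul_smul_comm, mul_one, one_mul, mul_assoc]
      abel
    rw [h2, add_zero] at h3
    rw [Commute, SemiconjBy, sq, mul_assoc, h3, mul_assoc]
  intro v hv
  set c := β * lam ^ 2 + lam
  have key : c • N ^ (2 * k) = N ^ (2 * k + 1) * (P - 1 - β • N) - P * N ^ (2 * k + 1) := by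
    have h5 : P * N ^ (2 * k + 1) = N ^ (2 * k) * (P * N) := by
      rw [pow_succ, ← mul_assoc, ← mul_assoc, pow_mul, (hcomm.pow_left k).eq]
    have h6 : N * (P - 1 - β • N) - P * N = c • 1 := by
      rw [mul_sub, mul_sub, hNP, mul_one, mul_smul_comm]
      abel
    rw [h5, pow_succ, mul_assoc, ← mul_sub, h6, mul_smul_comm, mul_one]
  refine ⟨c⁻¹ • ((P - 1 - β • N) *ᵥ v), ?_⟩
  rw [Matrix.mulVec_smul, Matrix.mulVec_mulVec, ← sub_add_cancel (N ^ (2 * k + 1) * _)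
    (P * N ^ (2 * k + 1)), ← key, Matrix.add_mulVec, ← Matrix.mulVec_mulVec, hv,
    Matrix.mulVec_zero, add_zero, Matrix.smul_mulVec, inv_smul_smul₀ hlam]

theorem Polynomial.dvd_sum_aeval_mulVec_sub {L : Type*} [Field L] {n : ℕ}
    {A : Matrix (Fin n) (Fin n) L} {f : Fin n → L[X]} {h : L[X]}
    (hf : ∀ j, h ∣ ∑ i, C (A i j) * f i - X * f j) (g : L[X]) (x : Fin n → L) :
    h ∣ ∑ j, C ((aeval A g *ᵥ x) j) * f j - g * ∑ j, C (x j) * f j := by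
  have hX (x : Fin n → L) : h ∣ ∑ j, C ((A *ᵥ x) j) * f j - X * ∑ j, C (x j) * f j := by
    have e : ∑ j, C ((A *ᵥ x) j) * f j - X * ∑ j, C (x j) * f j =
        ∑ j, C (x j) * (∑ i, C (A i j) * f i - X * f j) := by
      simp only [Matrix.mulVec, dotProduct, map_sum, map_mul, mul_sub, Finset.sum_sub_distrib,
        Finset.mul_sum, Finset.sum_mul]
      rw [Finset.sum_comm]
      congr 1
      · exact Finset.sum_congr rfl fun _ _ => Finset.sum_congr rfl fun _ _ => by ring
      · exact Finset.sum_congr rfl fun _ _ => by ring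
    rw [e]
    exact Finset.dvd_sum fun j _ => (hf j).mul_left _
  induction g using Polynomial.induction_on generalizing x with
  | C a =>
    simp [Matrix.algebraMap_eq_diagonal, Matrix.mulVec_diagonal, Finset.mul_sum, mul_assoc]
  | add p q hp hq =>
    have e := dvd_add (hp x) (hq x)
    simp only [map_add, Matrix.add_mulVec, Pi.add_apply, add_mul, Finset.sum_add_distrib]
    convert e using 1
    ring
  | monomial k a ih =>
    have e := dvd_add (ih (A *ᵥ x)) ((hX x).mul_left (C a * X ^ k))
    rw [Matrix.mulVec_mulVec] at e
    rw [pow_succ, ← mul_assoc, map_mul, aeval_X]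
    convert e using 1
    ring

/-- If `L[X] ⧸ ((X - lam) ^ (k + 1) * R)`, with `R` prime to `X - lam`, is a direct summand of the
`L[X]`-module defined by `A`, then `A` has a Jordan block of size `k + 1` for `lam`. The projection
is given by lifts `f j` of the images of the basis vectors, and `v` is the generator. -/
theorem matJk_succ_ne_zero_of_summand {L : Type*} [Field L] {n : ℕ}
    {A : Matrix (Fin n) (Fin n) L} {f : Fin n → L[X]} {lam : L} {k : ℕ} {R : L[X]}
    (hR : R.eval lam ≠ 0) {v : Fin n → L}
    (hf : ∀ j, (X - C lam) ^ (k + 1) * R ∣ ∑ i, C (A i j) * f i - X * f j)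
    (hv : (X - C lam) ^ (k + 1) * R ∣ ∑ j, C (v j) * f j - 1)
    (hv0 : aeval A ((X - C lam) ^ (k + 1) * R) *ᵥ v = 0) : matJk A lam (k + 1) ≠ 0 := by
  have hN : aeval A (X - C lam) = A - lam • 1 := by
    simp [Algebra.algebraMap_eq_smul_one]
  intro h0
  rw [matJk_succ_eq_zero_iff] at h0
  obtain ⟨w, hw⟩ := h0 (aeval A R *ᵥ v) (by
    rw [← hN, ← map_pow, Matrix.mulVec_mulVec, ← map_mul, hv0])
  rw [← hN, ← map_pow, ← map_pow, Matrix.mulVec_mulVec, ← map_mul] at hw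
  have h1 := dvd_sum_aeval_mulVec_sub hf ((X - C lam) ^ k * R) v
  have h2 := dvd_sum_aeval_mulVec_sub hf ((X - C lam) ^ (k + 1)) w
  rw [hw] at h1
  have h3 := dvd_trans (dvd_mul_right _ _)
    (dvd_add (dvd_sub h2 h1) (hv.mul_left (-((X - C lam) ^ k * R))))
  have h4 : (X - C lam) ^ (k + 1) ∣ (X - C lam) ^ k * R := by
    refine (dvd_add_right (dvd_mul_right _ (-∑ j, C (w j) * f j))).1 ?_
    convert h3 using 1
    ring
  rw [pow_succ, mul_dvd_mul_iff_left (pow_ne_zero _ (X_sub_C_ne_zero lam)), dvd_iff_isRoot] at h4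
  exact hR h4

/-- The `K`-linear endomorphism of `K[X]` that is `K[X ^ 2]`-linear, fixes `1` and sends `X` to
`β X ^ 2`. -/
noncomputable def Polynomial.evenProj {K : Type*} [Field K] (β : K) : K[X] →ₗ[K] K[X] :=
  (basisMonomials K).constr K fun i => if Even i then X ^ i else C β * X ^ (i + 1)

namespace Polynomial

variable {K : Type*} [Field K] (β : K)

theorem evenProj_X_pow (i : ℕ) :
    evenProj β (X ^ i) = if Even i then X ^ i else C β * X ^ (i + 1) := by
  have e := (basisMonomials K).constr_basis K
    (fun i => if Even i then X ^ i else C β * X ^ (i + 1)) i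
  rw [coe_basisMonomials] at e
  exact (congrArg (evenProj β) (X_pow_eq_monomial i)).trans e

theorem evenProj_C_mul (a : K) (f : K[X]) : evenProj β (C a * f) = C a * evenProj β f := by
  rw [← smul_eq_C_mul, map_smul, smul_eq_C_mul]

theorem evenProj_evenProj (f : K[X]) : evenProj β (evenProj β f) = evenProj β f := by
  induction f using Polynomial.induction_on' with
  | add p q hp hq => rw [map_add, map_add, hp, hq]
  | monomial i a =>
    rw [← C_mul_X_pow_eq_monomial, evenProj_C_mul, evenProj_C_mul, evenProj_X_pow]
    split_ifs with hi
    · rw [evenProj_X_pow, if_pos hi]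
    · rw [evenProj_C_mul, evenProj_X_pow, if_pos (Nat.even_add_one.2 hi)]

theorem X_mul_evenProj_add (f : K[X]) :
    X * evenProj β f + evenProj β (X * f) = (C β * X ^ 2 + X) * f := by
  induction f using Polynomial.induction_on' with
  | add p q hp hq =>
    rw [map_add, mul_add, mul_add, map_add, mul_add, ← hp, ← hq]
    abel
  | monomial i a =>
    rw [← C_mul_X_pow_eq_monomial, mul_left_comm, ← pow_succ', evenProj_C_mul, evenProj_C_mul,
      evenProj_X_pow, evenProj_X_pow]
    by_cases hi : Even i
    · rw [if_pos hi, if_neg (by rwa [Nat.even_add_one, not_not])]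
      ring
    · rw [if_neg hi, if_pos (Nat.even_add_one.2 hi)]
      ring

theorem evenProj_X_sq_mul (f : K[X]) : evenProj β (X ^ 2 * f) = X ^ 2 * evenProj β f := by
  have h1 := X_mul_evenProj_add β f
  have h2 := X_mul_evenProj_add β (X * f)
  rw [← mul_assoc, ← sq] at h2
  linear_combination h2 - X * h1

theorem evenProj_expand_mul (g f : K[X]) :
    evenProj β (expand K 2 g * f) = expand K 2 g * evenProj β f := by
  induction g using Polynomial.induction_on generalizing f with
  | C a => rw [expand_C, evenProj_C_mul]
  | add p q hp hq => rw [map_add, add_mul, map_add, hp, hq, add_mul]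
  | monomial k a ih =>
    rw [pow_succ, ← mul_assoc, map_mul (expand K 2), expand_X, mul_assoc, ih,
      evenProj_X_sq_mul, mul_assoc]

theorem dvd_evenProj_of_dvd {h : K[X]} (hh : h ∣ evenProj β h) {f : K[X]} (hf : h ∣ f) :
    h ∣ evenProj β f := by
  obtain ⟨g, rfl⟩ := hf
  induction g using Polynomial.induction_on with
  | C a => rw [mul_comm, evenProj_C_mul]; exact hh.mul_left _
  | add p q hp hq => rw [mul_add, map_add]; exact dvd_add hp hq
  | monomial k a ih =>
    have e := X_mul_evenProj_add β (h * (C a * X ^ k))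
    rw [← eq_sub_iff_add_eq'] at e
    rw [show h * (C a * X ^ (k + 1)) = X * (h * (C a * X ^ k)) by ring, e]
    exact dvd_sub ((dvd_mul_right _ _).mul_left _) (ih.mul_left _)

theorem dvd_evenProj_X_mul_C (a : K) : X * C a ∣ evenProj β (X * C a) := by
  have e := evenProj_X_pow β 1
  rw [pow_one, if_neg (by decide)] at e
  rw [mul_comm, evenProj_C_mul, e]
  exact mul_dvd_mul_left _ ⟨C β * X, by ring⟩

theorem dvd_evenProj_X_add_C_mul_C [CharP K 2] {α : K} (hα : α ≠ 0) (a : K) :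
    (X + C α) * C a ∣ evenProj α⁻¹ ((X + C α) * C a) := by
  have e := evenProj_X_pow α⁻¹ 1
  have e0 := evenProj_X_pow α⁻¹ 0
  have hc : C α⁻¹ * C α = (1 : K[X]) := by rw [← C_mul, inv_mul_cancel₀ hα, C_1]
  rw [pow_one, if_neg (by decide)] at e
  rw [pow_zero, if_pos (by decide)] at e0
  have e1 := evenProj_C_mul α⁻¹ α 1
  rw [e0, mul_one] at e1
  rw [mul_comm, evenProj_C_mul, map_add, e, e1]
  refine mul_dvd_mul_left _ ⟨C α⁻¹ * (X + C α), ?_⟩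
  have h2 : (2 : K[X]) = 0 := CharTwo.two_eq_zero
  linear_combination (-C α) * hc - C α⁻¹ * X * C α * h2

theorem exists_expand_eq_sq [CharP K 2] (f : K[X]) : ∃ g, expand K 2 g = f ^ 2 := by
  have : Fact (Nat.Prime 2) := ⟨Nat.prime_two⟩
  exact ⟨f.map (frobenius K 2), by rw [← map_expand, map_frobenius_expand]⟩

theorem dvd_evenProj_irreducible_pow [CharP K 2] {α : K} (hα : α ≠ 0) {p : K[X]}
    (hp : Irreducible p) {e : ℕ}
    (he : p.Separable → p.eval 0 ≠ 0 → p.eval α ≠ 0 → Even e) :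
    p ^ e ∣ evenProj α⁻¹ (p ^ e) := by
  obtain ⟨g, hg⟩ := exists_expand_eq_sq (p ^ (e / 2))
  have hpe : p ^ e = expand K 2 g * p ^ (e % 2) := by
    rw [hg, ← pow_mul, ← pow_add]
    congr 1
    omega
  rw [hpe, evenProj_expand_mul]
  apply mul_dvd_mul_left
  rcases Nat.mod_two_eq_zero_or_one e with h | h
  · simp [h]
  rw [h, pow_one]
  have hroot {a : K} (ha : p.eval a = 0) : ∃ c, p = (X - C a) * C c := by
    obtain ⟨q, rfl⟩ := dvd_iff_isRoot.2 ha
    obtain ⟨c, -, rfl⟩ := Polynomial.isUnit_iff.1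
      ((hp.isUnit_or_isUnit rfl).resolve_left (not_isUnit_X_sub_C a))
    exact ⟨c, rfl⟩
  by_cases h0 : p.eval 0 = 0
  · obtain ⟨c, rfl⟩ := hroot h0
    rw [C_0, sub_zero]
    exact dvd_evenProj_X_mul_C _ c
  by_cases h1 : p.eval α = 0
  · obtain ⟨c, rfl⟩ := hroot h1
    rw [CharTwo.sub_eq_add]
    exact dvd_evenProj_X_add_C_mul_C hα c
  by_cases hs : p.Separable
  · have := he hs h0 h1
    rw [Nat.even_iff] at this
    omega
  · rw [separable_iff_derivative_ne_zero hp, not_not] at hs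
    have e1 := evenProj_expand_mul α⁻¹ (contract 2 p) 1
    rw [expand_contract 2 hs two_ne_zero, mul_one] at e1
    rw [e1]
    exact dvd_mul_right _ _

end Polynomial

/-- A `K[X]`-module carrying a `K`-linear idempotent `P` with `X P + P X = β X ^ 2 + X`. -/
def HasCompositeProj {K : Type*} [Field K] (β : K) (M : Type*) [AddCommGroup M]
    [Module K[X] M] : Prop :=
  ∃ P : M →+ M, (∀ (a : K) (m : M), P ((C a : K[X]) • m) = (C a : K[X]) • P m) ∧
    (∀ m, P (P m) = P m) ∧
    ∀ m, (X : K[X]) • P m + P ((X : K[X]) • m) = (C β * X ^ 2 + X : K[X]) • m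

namespace HasCompositeProj

variable {K : Type*} [Field K] {β : K}

theorem of_equiv {M N : Type*} [AddCommGroup M] [Module K[X] M] [AddCommGroup N]
    [Module K[X] N] (e : M ≃ₗ[K[X]] N) (h : HasCompositeProj β N) : HasCompositeProj β M := by
  obtain ⟨P, h1, h2, h3⟩ := h
  refine ⟨(e.symm.toAddEquiv.toAddMonoidHom.comp P).comp e.toAddEquiv.toAddMonoidHom,
    fun a m => ?_, fun m => ?_, fun m => e.injective ?_⟩
  · simp [h1]
  · simp [h2]
  · simpa using h3 (e m)

theorem directSum {ι : Type*} {M : ι → Type*} [∀ i, AddCommGroup (M i)]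
    [∀ i, Module K[X] (M i)] (h : ∀ i, HasCompositeProj β (M i)) :
    HasCompositeProj β (DirectSum ι M) := by
  choose P h1 h2 h3 using h
  refine ⟨DirectSum.map P, fun a m => ?_, fun m => ?_, fun m => ?_⟩
  · ext i
    simp [DirectSum.map_apply, DirectSum.smul_apply, h1]
  · ext i
    simp [DirectSum.map_apply, h2]
  · ext i
    simp [DirectSum.map_apply, DirectSum.smul_apply, DirectSum.add_apply, h3]

theorem quotient {h : K[X]} (hh : h ∣ evenProj β h) :
    HasCompositeProj β (K[X] ⧸ Submodule.span K[X] {h}) := by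
  let I : Submodule K[X] K[X] := Submodule.span K[X] {h}
  have hI : I.toAddSubgroup ≤ I.toAddSubgroup.comap (evenProj β).toAddMonoidHom := fun f hf =>
    Ideal.mem_span_singleton.2 (dvd_evenProj_of_dvd β hh (Ideal.mem_span_singleton.1 hf))
  let P : (K[X] ⧸ I) →+ (K[X] ⧸ I) :=
    QuotientAddGroup.map I.toAddSubgroup I.toAddSubgroup (evenProj β).toAddMonoidHom hI
  have hP (f : K[X]) : P (Submodule.Quotient.mk f) = Submodule.Quotient.mk (evenProj β f) := rfl
  refine ⟨P, fun a m => ?_, fun m => ?_, fun m => ?_⟩ <;>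
    obtain ⟨f, rfl⟩ := Submodule.Quotient.mk_surjective I m
  · rw [← Submodule.Quotient.mk_smul, hP, hP, smul_eq_mul, evenProj_C_mul,
      ← Submodule.Quotient.mk_smul, smul_eq_mul]
  · rw [hP, hP, evenProj_evenProj]
  · rw [hP, ← Submodule.Quotient.mk_smul, ← Submodule.Quotient.mk_smul, hP,
      ← Submodule.Quotient.mk_add, ← Submodule.Quotient.mk_smul, smul_eq_mul, smul_eq_mul,
      smul_eq_mul, X_mul_evenProj_add]

theorem exists_matrix {n : ℕ} {A : Matrix (Fin n) (Fin n) K}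
    (h : HasCompositeProj β (Module.AEval' A.toLin')) :
    ∃ P : Matrix (Fin n) (Fin n) K, P * P = P ∧ A * P + P * A = β • (A * A) + A := by
  obtain ⟨P, h1, h2, h3⟩ := h
  let o := Module.AEval'.of A.toLin'
  let Q : (Fin n → K) →ₗ[K] (Fin n → K) :=
    { toFun := fun x => o.symm (P (o x))
      map_add' := fun x y => by simp
      map_smul' := fun a x => by
        have e := h1 a (o x)
        rw [Module.AEval.C_smul, Module.AEval.C_smul] at e
        simp [e] }
  have hQ (x) : o (Q x) = P (o x) := o.apply_symm_apply _
  have hX (x) : (X : K[X]) • o x = o (A.toLin' x) := Module.AEval'.X_smul_of _ _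
  refine ⟨LinearMap.toMatrix' Q, ?_, ?_⟩
  · apply Matrix.toLin'.injective
    rw [Matrix.toLin'_mul, Matrix.toLin'_toMatrix']
    refine LinearMap.ext fun x => o.injective ?_
    rw [LinearMap.comp_apply, hQ, hQ, h2]
  · apply Matrix.toLin'.injective
    rw [map_add, map_add, map_smul, Matrix.toLin'_mul, Matrix.toLin'_mul, Matrix.toLin'_mul,
      Matrix.toLin'_toMatrix']
    refine LinearMap.ext fun x => o.injective ?_
    have e := h3 (o x)
    rw [← hQ, hX, hX, ← hQ, add_smul, mul_smul, sq, mul_smul, hX, hX, Module.AEval.C_smul] at e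
    simpa using e

end HasCompositeProj

/-- If `K[X] ⧸ (p ^ e)`, with `p` irreducible and separable, is a direct summand of the
`K[X]`-module defined by `A`, then `A` has a Jordan block of size `e` for each root of `p`. -/
theorem matJk_map_ne_zero_of_summand {K L : Type*} [Field K] [Field L] [Algebra K L] {n : ℕ}
    {A : Matrix (Fin n) (Fin n) K} {p : K[X]} (hs : p.Separable) {k : ℕ} {lam : L}
    (hlam : aeval lam p = 0)
    {m : ℕ} (hm : m = k + 1)
    (π : Module.AEval' A.toLin' →ₗ[K[X]] K[X] ⧸ Submodule.span K[X] {p ^ m})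
    (σ : (K[X] ⧸ Submodule.span K[X] {p ^ m}) →ₗ[K[X]] Module.AEval' A.toLin')
    (hπσ : ∀ x, π (σ x) = x) : matJk (A.map (algebraMap K L)) lam (k + 1) ≠ 0 := by
  subst hm
  let I : Submodule K[X] K[X] := Submodule.span K[X] {p ^ (k + 1)}
  let o := Module.AEval'.of A.toLin'
  choose f hf using fun j => Submodule.Quotient.mk_surjective I (π (o (Pi.single j 1)))
  have hπ (x : Fin n → K) : π (o x) = Submodule.Quotient.mk (p := I) (∑ j, C (x j) * f j) := by
    conv_lhs => rw [← Finset.univ_sum_single x, map_sum, map_sum]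
    rw [← Submodule.mkQ_apply, map_sum]
    refine Finset.sum_congr rfl fun j _ => ?_
    rw [Submodule.mkQ_apply, ← smul_eq_mul, Submodule.Quotient.mk_smul, hf, ← map_smul,
      Module.AEval.C_smul, ← map_smul, ← Pi.single_smul, smul_eq_mul, mul_one]
  have hmem {a b : K[X]} (h : Submodule.Quotient.mk (p := I) a = Submodule.Quotient.mk b) :
      p ^ (k + 1) ∣ a - b := Ideal.mem_span_singleton.1 ((Submodule.Quotient.eq I).1 h)
  obtain ⟨r, hr⟩ : X - C lam ∣ p.map (algebraMap K L) := by
    rw [dvd_iff_isRoot, IsRoot, eval_map_algebraMap, hlam]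
  have hr0 : r.eval lam ≠ 0 := by
    have e := hs.eval₂_derivative_ne_zero (algebraMap K L) (x := lam) hlam
    rw [← eval_map, ← derivative_map, hr] at e
    simpa [derivative_mul] using e
  have hpow : (p ^ (k + 1)).map (algebraMap K L) = (X - C lam) ^ (k + 1) * r ^ (k + 1) := by
    rw [Polynomial.map_pow, hr, mul_pow]
  set v := o.symm (σ (Submodule.Quotient.mk 1)) with hv
  have hov : o v = σ (Submodule.Quotient.mk 1) := o.apply_symm_apply _
  refine matJk_succ_ne_zero_of_summand (f := fun j => (f j).map (algebraMap K L))
    (R := r ^ (k + 1)) (v := fun j => algebraMap K L (v j)) ?_ (fun j => ?_) ?_ ?_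
  · rw [eval_pow]
    exact pow_ne_zero _ hr0
  · rw [← hpow]
    have e : p ^ (k + 1) ∣ ∑ i, C (A i j) * f i - X * f j := by
      apply hmem
      rw [← smul_eq_mul (X : K[X]), Submodule.Quotient.mk_smul, hf, ← map_smul,
        Module.AEval'.X_smul_of, hπ]
      simp
    simpa [Polynomial.map_sum] using Polynomial.map_dvd (algebraMap K L) e
  · rw [← hpow]
    have e : p ^ (k + 1) ∣ ∑ j, C (v j) * f j - 1 := by
      apply hmem
      rw [← hπ, hov, hπσ]
    simpa [Polynomial.map_sum] using Polynomial.map_dvd (algebraMap K L) e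
  · rw [← hpow]
    have e : aeval A (p ^ (k + 1)) *ᵥ v = 0 := by
      have e1 : o (aeval A.toLin' (p ^ (k + 1)) v) = 0 := by
        refine (Module.AEval.of_aeval_smul A.toLin' (p ^ (k + 1)) v).trans ?_
        change p ^ (k + 1) • o v = 0
        rw [hov, ← map_smul, ← Submodule.Quotient.mk_smul, smul_eq_mul, mul_one,
          (Submodule.Quotient.mk_eq_zero I).2 (Submodule.mem_span_singleton_self _), map_zero]
      have e2 := (o.map_eq_zero_iff).1 e1
      have e3 := aeval_algHom_apply (Matrix.toLinAlgEquiv' (R := K) (n := Fin n)).toAlgHom A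
        (p ^ (k + 1))
      have e4 : aeval A.toLin' (p ^ (k + 1)) = Matrix.toLin' (aeval A (p ^ (k + 1))) := e3
      rwa [e4, Matrix.toLin'_apply] at e2
    have e5 : aeval (A.map (algebraMap K L)) ((p ^ (k + 1)).map (algebraMap K L)) =
        (aeval A (p ^ (k + 1))).map (algebraMap K L) := by
      rw [aeval_map_algebraMap]
      exact aeval_algHom_apply (Algebra.ofId K L).mapMatrix A (p ^ (k + 1))
    rw [e5]
    have e6 := congrArg (fun x => algebraMap K L ∘ x) e
    ext i
    have e7 := congrFun e6 i
    simpa [RingHom.map_mulVec, Function.comp_def] using e7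

/-- Theorem 5 (characteristic 2, matrix version): `A` is an `(α,−α)`-composite iff all Jordan
blocks for eigenvalues outside `{0, α}` have even size. -/
theorem matrix_isABComposite_char_two_iff
    {K : Type*} [Field K] (hchar : ringChar K = 2) {n : ℕ}
    (α : K) (hα : α ≠ 0) (A : Matrix (Fin n) (Fin n) K) :
    Matrix.IsABComposite α (-α) A ↔
      ∀ lam : AlgebraicClosure K,
        lam ∉ ({0, algebraMap K (AlgebraicClosure K) α} : Set (AlgebraicClosure K)) →
        ∀ k : ℕ,
          matJk (A.map (algebraMap K (AlgebraicClosure K))) lam (2 * k + 1) = 0 := by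
  have : CharP K 2 := ringChar.of_eq hchar
  have : CharP (AlgebraicClosure K) 2 := charP_of_injective_algebraMap' K 2
  rw [Matrix.isABComposite_neg_iff hα]
  constructor
  · rintro ⟨P, -, hP⟩ lam hlam k
    simp only [Set.mem_insert_iff, Set.mem_singleton_iff, not_or] at hlam
    let φ := algebraMap K (AlgebraicClosure K)
    refine matJk_odd_eq_zero_of_idempotent (β := φ α⁻¹) (P := P.map φ) ?_ ?_ k
    · have e := congrArg (fun M => M.map φ) hP
      simpa [Matrix.map_add, Matrix.map_mul, Matrix.map_smul', φ] using e
    · intro h0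
      rw [map_inv₀] at h0
      have hφ : φ α ≠ 0 := (map_ne_zero φ).2 hα
      apply hlam.2
      have e : lam * (lam + φ α) = 0 := by
        field_simp at h0
        linear_combination h0
      rwa [mul_eq_zero, or_iff_right hlam.1, CharTwo.add_eq_zero] at e
  · intro H
    obtain ⟨ι, _, p, hp, e, ⟨E⟩⟩ := Module.equiv_directSum_of_isTorsion
      (Module.AEval.isTorsion_of_finiteDimensional K (Fin n → K) A.toLin')
    refine HasCompositeProj.exists_matrix (.of_equiv E (.directSum fun i =>
      .quotient (dvd_evenProj_irreducible_pow hα (hp i) fun hs h0 h1 => ?_)))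
    by_contra hodd
    obtain ⟨k, hk⟩ := Nat.not_even_iff_odd.1 hodd
    obtain ⟨lam, hlam⟩ := IsAlgClosed.exists_aeval_eq_zero (AlgebraicClosure K) (p i)
      (degree_pos_of_irreducible (hp i)).ne'
    classical
    have hne : lam ∉ ({0, algebraMap K (AlgebraicClosure K) α} : Set (AlgebraicClosure K)) := by
      have hroot (a : K) (ha : lam = algebraMap K (AlgebraicClosure K) a) :
          (p i).eval a = 0 := by
        rwa [ha, aeval_algebraMap_apply, coe_aeval_eq_eval, map_eq_zero] at hlam
      rintro (h | h)
      · exact h0 (hroot 0 (by rw [h, map_zero]))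
      · exact h1 (hroot α h)
    exact matJk_map_ne_zero_of_summand hs hlam hk (DirectSum.component K[X] ι _ i ∘ₗ E.toLinearMap)
      (E.symm.toLinearMap ∘ₗ
        DirectSum.lof K[X] ι (fun i => K[X] ⧸ Submodule.span K[X] {p i ^ e i}) i)
      (fun x => by simp [DirectSum.component.lof_self]) (H lam hne k)
end

section
/- Let K be a field, L a field extension of K, and α, β ∈ K nonzero. A matrix A ∈ M_n(K) is an (α,β)-composite in M_n(K) if and only if its image under the canonical embedding M_n(K) → M_n(L) is an (α,β)-composite in M_n(L). -/
section Polynomial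

open Polynomial

/-- `x` is the combination `a • p + b • q` of two idempotents `p` and `q`. -/
def IsIdempotentComb {K R : Type*} [CommRing K] [Ring R] [Algebra K R] (a b : K) (x : R) : Prop :=
  ∃ p q : R, p * p = p ∧ q * q = q ∧ x = a • p + b • q

theorem IsIdempotentComb.map {K R S : Type*} [CommRing K] [Ring R] [Algebra K R] [Ring S]
    [Algebra K S] {a b : K} {x : R} (h : IsIdempotentComb a b x) (f : R →ₐ[K] S) :
    IsIdempotentComb a b (f x) := by
  obtain ⟨p, q, hp, hq, rfl⟩ := h
  exact ⟨f p, f q, by rw [← map_mul, hp], by rw [← map_mul, hq], by simp⟩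

section Necessity

variable {F R : Type*} [Field F] [Ring R] [Algebra F R]

theorem commutator_mul_comb {a b : F} {p q : R} (hp : p * p = p) (hq : q * q = q) :
    (q * p - p * q) * (a • p + b • q) =
      (algebraMap F R (a + b) - (a • p + b • q)) * (q * p - p * q) := by
  have hp' : ∀ x, p * (p * x) = p * x := fun x => by rw [← mul_assoc, hp]
  have hq' : ∀ x, q * (q * x) = q * x := fun x => by rw [← mul_assoc, hq]
  simp only [Algebra.algebraMap_eq_smul_one, mul_add, mul_sub, sub_mul, add_mul, smul_mul_assoc,
    mul_smul_comm, mul_assoc, hp, hq, hp', hq', one_mul]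
  module

theorem left_idempotent_mul_comb {a b : F} {p q : R} (hp : p * p = p) (hq : q * q = q) :
    a • (p * (a • p + b • q)) = a • ((algebraMap F R (a + b) - (a • p + b • q)) * p) +
      (a • p + b • q) * ((a • p + b • q) - algebraMap F R b) := by
  simp only [Algebra.algebraMap_eq_smul_one, mul_add, mul_sub, sub_mul, add_mul, smul_mul_assoc,
    mul_smul_comm, hp, hq, one_mul, mul_one]
  module

theorem comb_mul_reflect {a b : F} {p q : R} (hp : p * p = p) (hq : q * q = q) :
    (a • p + b • q) * (algebraMap F R (a + b) - (a • p + b • q)) =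
      (a * b) • (p + q - p * q - q * p) := by
  simp only [Algebra.algebraMap_eq_smul_one, mul_add, mul_sub, add_mul, smul_mul_assoc,
    mul_smul_comm, hp, hq, mul_one]
  module

theorem commutator_mul_commutator {p q : R} (hp : p * p = p) (hq : q * q = q) :
    (q * p - p * q) * (q * p - p * q) =
      (p + q - p * q - q * p) * (p + q - p * q - q * p) - (p + q - p * q - q * p) := by
  have hp' : ∀ x, p * (p * x) = p * x := fun x => by rw [← mul_assoc, hp]
  have hq' : ∀ x, q * (q * x) = q * x := fun x => by rw [← mul_assoc, hq]
  simp only [mul_add, mul_sub, sub_mul, add_mul, mul_assoc, hp, hq, hp', hq']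
  abel

theorem commutator_sq_comb {a b : F} {p q : R} (hp : p * p = p) (hq : q * q = q) {l m : F}
    (hlm : l + m = a + b) :
    (a * b) ^ 2 • ((q * p - p * q) * (q * p - p * q)) =
      algebraMap F _ (l * m * (l * m - a * b)) -
        ((a • p + b • q - algebraMap F _ l) * ((a • p + b • q) *
          (algebraMap F _ (a + b) - (a • p + b • q)) + algebraMap F _ (l * m - a * b))) *
            (a • p + b • q - algebraMap F _ m) := by
  have key := comb_mul_reflect (a := a) (b := b) hp hq
  rw [commutator_mul_commutator hp hq]
  generalize p + q - p * q - q * p = u at *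
  generalize hg : a • p + b • q = g at *
  have h1 : (a * b) ^ 2 • (u * u - u) = ((a * b) • u) * ((a * b) • u) -
      (a * b) • ((a * b) • u) := by
    simp only [smul_mul_assoc, mul_smul_comm, smul_sub, smul_smul]
    ring_nf
  rw [h1, ← key, ← hlm]
  simp only [Algebra.algebraMap_eq_smul_one, mul_add, mul_sub, sub_mul, add_mul, smul_mul_assoc,
    mul_smul_comm, mul_assoc, one_mul, mul_one]
  module

variable {U : Type*} [AddCommGroup U] [Module F U]

theorem apply_pow_of_semiconj {N₀ N₁ T : Module.End F U} (h : T * N₁ = N₀ * T) (m : ℕ) (y : U) :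
    T ((N₁ ^ m) y) = (N₀ ^ m) (T y) :=
  LinearMap.congr_fun (SemiconjBy.pow_right h m) y

/-- The number of Jordan blocks of `g` of size greater than `j` for the eigenvalue `l`. -/
noncomputable def jordanCount (g : Module.End F U) (l : F) (j : ℕ) : ℕ :=
  Module.finrank F
    ((g - algebraMap F _ l).ker ⊓ ((g - algebraMap F _ l) ^ j).range : Submodule F U)

theorem jordanCount_eq_neg (g : Module.End F U) (l : F) (j : ℕ) :
    jordanCount g l j = Module.finrank F
      ((algebraMap F _ l - g).ker ⊓ ((algebraMap F _ l - g) ^ j).range : Submodule F U) := by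
  have hr : ((algebraMap F _ l - g) ^ j).range = ((g - algebraMap F _ l) ^ j).range := by
    rw [← neg_sub]
    rcases Nat.even_or_odd j with h | h
    · rw [h.neg_pow]
    · rw [h.neg_pow, LinearMap.range_neg]
  have hk : (algebraMap F _ l - g).ker = (g - algebraMap F _ l).ker := by
    rw [← neg_sub, LinearMap.ker_neg]
  rw [jordanCount, hr, hk]

variable [FiniteDimensional F U]

theorem finrank_map_add_finrank_inf_ker (S : Submodule F U) (T : Module.End F U) :
    Module.finrank F (S.map T) + Module.finrank F (S ⊓ T.ker : Submodule F U) =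
      Module.finrank F S := by
  have h := LinearMap.finrank_range_add_finrank_ker (T.domRestrict S)
  rw [LinearMap.range_domRestrict, LinearMap.ker_domRestrict] at h
  rw [← h, ← Submodule.map_comap_subtype, Submodule.finrank_map_subtype_eq]

theorem finrank_ker_inf_range_pow_succ_le {N₀ N₁ T W : Module.End F U} {w : F} (hw : w ≠ 0)
    (h₁ : T * N₁ = N₀ * T) (hT : T * T = W * N₁)
    (hW : ∀ x, N₁ x = 0 → W x = w • x) (j : ℕ) :
    Module.finrank F (N₁.ker ⊓ (N₁ ^ (j + 1)).range : Submodule F U) ≤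
      Module.finrank F (N₀.ker ⊓ (N₀ ^ j).range : Submodule F U) := by
  have h₁' : ∀ y, T (N₁ y) = N₀ (T y) := fun y => LinearMap.congr_fun h₁ y
  have hT' : ∀ y, T (T y) = W (N₁ y) := fun y => LinearMap.congr_fun hT y
  rw [← finrank_map_add_finrank_inf_ker _ T, ← finrank_map_add_finrank_inf_ker (N₀.ker ⊓ _) T,
    add_comm]
  refine add_le_add (Submodule.finrank_mono ?_) (Submodule.finrank_mono ?_)
  · rintro x ⟨⟨hx, y, rfl⟩, hTx⟩
    simp only [SetLike.mem_coe, LinearMap.mem_ker] at hx hTx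
    have hs : N₁ ((N₁ ^ j) y) = (N₁ ^ (j + 1)) y := by rw [pow_succ', Module.End.mul_apply]
    refine ⟨w⁻¹ • T ((N₁ ^ j) y), ⟨?_, ?_⟩, ?_⟩
    · simp only [SetLike.mem_coe, LinearMap.mem_ker, map_smul, ← h₁', hs, hTx, smul_zero]
    · exact ⟨w⁻¹ • T y, by rw [map_smul, apply_pow_of_semiconj h₁]⟩
    · rw [map_smul, hT', hs, hW _ hx, smul_smul, inv_mul_cancel₀ hw, one_smul]
  · rintro _ ⟨x, ⟨hx, y, rfl⟩, rfl⟩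
    simp only [SetLike.mem_coe, LinearMap.mem_ker] at hx
    refine ⟨⟨?_, ?_⟩, ?_⟩
    · simp only [SetLike.mem_coe, LinearMap.mem_ker, ← h₁', hx, map_zero]
    · refine ⟨N₀ (T y), ?_⟩
      rw [apply_pow_of_semiconj h₁, pow_succ, Module.End.mul_apply]
    · simp only [SetLike.mem_coe, LinearMap.mem_ker, hT', hx, map_zero]

theorem finrank_ker_inf_range_pow_le {N₀ N₁ T : Module.End F U} {w : F} (hw : w ≠ 0)
    (h₁ : T * N₁ = N₀ * T) (hT : ∀ x, N₁ x = 0 → T (T x) = w • x) (j : ℕ) :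
    Module.finrank F (N₁.ker ⊓ (N₁ ^ j).range : Submodule F U) ≤
      Module.finrank F (N₀.ker ⊓ (N₀ ^ j).range : Submodule F U) := by
  have h₁' : ∀ y, T (N₁ y) = N₀ (T y) := fun y => LinearMap.congr_fun h₁ y
  rw [← finrank_map_add_finrank_inf_ker _ T]
  have : (N₁.ker ⊓ (N₁ ^ j).range ⊓ T.ker : Submodule F U) = ⊥ := by
    rw [eq_bot_iff]
    rintro x ⟨⟨hx, -⟩, hTx⟩
    simp only [SetLike.mem_coe, LinearMap.mem_ker] at hx hTx
    have := hT x hx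
    rw [hTx, map_zero] at this
    exact (smul_eq_zero.1 this.symm).resolve_left hw
  rw [this, finrank_bot, add_zero]
  refine Submodule.finrank_mono ?_
  rintro _ ⟨x, ⟨hx, y, rfl⟩, rfl⟩
  simp only [SetLike.mem_coe, LinearMap.mem_ker] at hx
  refine ⟨?_, T y, (apply_pow_of_semiconj h₁ _ _).symm⟩
  simp only [SetLike.mem_coe, LinearMap.mem_ker, ← h₁', hx, map_zero]

section Comb

variable {a b : F} {p q : Module.End F U}

theorem jordanCount_succ_le (ha : a ≠ 0) (hb : b ≠ 0) (hp : p * p = p) (hq : q * q = q) {l m : F}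
    (hlm : l + m = a + b) (hne : l ≠ m) (hs : l * m * (l * m - a * b) = 0) (j : ℕ) :
    jordanCount (a • p + b • q) m (j + 1) ≤ jordanCount (a • p + b • q) l j := by
  have hsq := commutator_sq_comb (a := a) (b := b) hp hq hlm
  have hT := commutator_mul_comb (a := a) (b := b) hp hq
  have hab : (a * b) ^ 2 ≠ 0 := pow_ne_zero _ (mul_ne_zero ha hb)
  rw [hs, map_zero, zero_sub] at hsq
  rw [jordanCount_eq_neg _ l]
  generalize a • p + b • q = g at *
  generalize q * p - p * q = T at *
  have hw : -((a * b) ^ 2)⁻¹ * ((m - l) * (m * (a + b - m) + (l * m - a * b))) ≠ 0 := by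
    refine mul_ne_zero (neg_ne_zero.2 (inv_ne_zero hab)) (mul_ne_zero (sub_ne_zero.2 hne.symm) ?_)
    have : m * (a + b - m) = l * m := by rw [← hlm]; ring
    rw [this]
    rcases mul_eq_zero.1 hs with h | h
    · rw [h]; simpa using ⟨ha, hb⟩
    · rw [h, sub_eq_zero.1 h]; simpa using ⟨ha, hb⟩
  refine finrank_ker_inf_range_pow_succ_le (T := T) (W := -((a * b) ^ 2)⁻¹ •
    ((g - algebraMap F _ l) * (g * (algebraMap F _ (a + b) - g) + algebraMap F _ (l * m - a * b))))
    hw ?_ ?_ ?_ j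
  · rw [mul_sub, hT, ← hlm, ← Algebra.commutes, map_add]
    noncomm_ring
  · rw [smul_mul_assoc, neg_smul, ← smul_neg, ← hsq, smul_smul, inv_mul_cancel₀ hab, one_smul]
  · intro x hx
    have hx' : g x = m • x := by
      simpa [sub_eq_zero, Module.algebraMap_end_apply] using hx
    simp only [LinearMap.smul_apply, Module.End.mul_apply, LinearMap.add_apply, LinearMap.sub_apply,
      Module.algebraMap_end_apply, map_add, map_sub, map_smul, hx']
    module

theorem jordanCount_le_reflect (ha : a ≠ 0) (hb : b ≠ 0) (hp : p * p = p) (hq : q * q = q) {l m : F}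
    (hlm : l + m = a + b) (hs : l * m * (l * m - a * b) ≠ 0) (j : ℕ) :
    jordanCount (a • p + b • q) m j ≤ jordanCount (a • p + b • q) l j := by
  have hsq := commutator_sq_comb (a := a) (b := b) hp hq hlm
  have hT := commutator_mul_comb (a := a) (b := b) hp hq
  have hab : (a * b) ^ 2 ≠ 0 := pow_ne_zero _ (mul_ne_zero ha hb)
  rw [jordanCount_eq_neg _ l]
  generalize a • p + b • q = g at *
  generalize q * p - p * q = T at *
  refine finrank_ker_inf_range_pow_le (T := T)
    (w := ((a * b) ^ 2)⁻¹ * (l * m * (l * m - a * b))) (mul_ne_zero (inv_ne_zero hab) hs) ?_ ?_ j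
  · rw [mul_sub, hT, ← hlm, ← Algebra.commutes, map_add]
    noncomm_ring
  · intro x hx
    have := LinearMap.congr_fun hsq x
    rw [LinearMap.sub_apply, Module.End.mul_apply _ (g - _), hx, map_zero, sub_zero,
      LinearMap.smul_apply, Module.End.mul_apply, Module.algebraMap_end_apply] at this
    rw [mul_smul, ← this, smul_smul, inv_mul_cancel₀ hab, one_smul]

theorem jordanCount_even_le (hp : p * p = p) (hq : q * q = q) {l : F}
    (hl : l + l = a + b) (hs : l * l * (l * l - a * b) ≠ 0) (j : ℕ) :
    jordanCount (a • p + b • q) l (2 * j) ≤ jordanCount (a • p + b • q) l (2 * j + 1) := by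
  have key := comb_mul_reflect (a := a) (b := b) hp hq
  have hleft := left_idempotent_mul_comb (a := a) (b := b) hp hq
  have hcomm : p * (p + q - p * q - q * p) = (p + q - p * q - q * p) * p := by
    have hp' : ∀ x, p * (p * x) = p * x := fun x => by rw [← mul_assoc, hp]
    simp only [mul_add, mul_sub, sub_mul, add_mul, mul_assoc, hp, hp']
    abel
  generalize p + q - p * q - q * p = u at *
  generalize a • p + b • q = g at *
  have hl0 : l ≠ 0 := by rintro rfl; simp at hs
  have hlb : l - b ≠ 0 := by
    intro h
    have h1 : l = b := sub_eq_zero.1 h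
    have h2 : l = a := by rw [← h1] at hl; exact add_right_cancel hl
    exact hs (by rw [← h1, ← h2]; ring)
  have hsq : (g - algebraMap F _ l) ^ 2 = algebraMap F _ (l * l) - (a * b) • u := by
    rw [← key, ← hl]
    simp only [Algebra.algebraMap_eq_smul_one, pow_two, mul_sub, sub_mul,
      smul_mul_assoc, mul_smul_comm, one_mul, mul_one]
    module
  have hpow : Commute p ((g - algebraMap F _ l) ^ (2 * j)) := by
    rw [pow_mul, hsq]
    refine Commute.pow_right (Commute.sub_right (Algebra.commute_algebraMap_right _ _) ?_) _
    exact Commute.smul_right hcomm _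
  refine Submodule.finrank_mono ?_
  rintro x ⟨hx, y, rfl⟩
  refine ⟨hx, (a * (l * (l - b))⁻¹) • p y, ?_⟩
  have hpy := LinearMap.congr_fun hpow.eq y
  simp only [Module.End.mul_apply] at hpy
  set x := ((g - algebraMap F _ l) ^ (2 * j)) y with hxdef
  have hx' : g x = l • x := by
    simpa [sub_eq_zero, Module.algebraMap_end_apply] using hx
  have h := LinearMap.congr_fun hleft x
  simp only [LinearMap.smul_apply, Module.End.mul_apply, LinearMap.add_apply, LinearMap.sub_apply,
      Module.algebraMap_end_apply, map_sub, map_smul, hx', ← hl] at h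
  have h2 : (l * (l - b)) • x = a • (g (p x) - l • p x) := by
    have e1 : (l * (l - b)) • x = l • l • x - b • l • x := by module
    rw [e1, ← sub_eq_iff_eq_add'.2 h]
    module
  rw [map_smul, pow_succ', Module.End.mul_apply, ← hpy, LinearMap.sub_apply,
    Module.algebraMap_end_apply, mul_comm, mul_smul, ← h2, smul_smul,
    inv_mul_cancel₀ (mul_ne_zero hl0 hlb), one_smul]

end Comb

end Necessity

section Counting

variable {F U U' : Type*} [Field F] [AddCommGroup U] [Module F U] [AddCommGroup U'] [Module F U']

theorem jordanCount_conj (e : U ≃ₗ[F] U') {g : Module.End F U} {g' : Module.End F U'}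
    (h : ∀ x, e (g x) = g' (e x)) (l : F) (j : ℕ) : jordanCount g l j = jordanCount g' l j := by
  have hN : ∀ (m : ℕ) (x : U), ((g' - algebraMap F _ l) ^ m) (e x) =
      e (((g - algebraMap F _ l) ^ m) x) := by
    intro m
    induction m with
    | zero => simp
    | succ m ih =>
      intro x
      rw [pow_succ', pow_succ', Module.End.mul_apply, ih, Module.End.mul_apply]
      simp only [LinearMap.sub_apply, Module.algebraMap_end_apply, map_sub, map_smul, h]
  have h1 := hN 1
  rw [pow_one, pow_one] at h1
  have hmap : (g - algebraMap F _ l).ker ⊓ ((g - algebraMap F _ l) ^ j).range =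
      ((g' - algebraMap F _ l).ker ⊓ ((g' - algebraMap F _ l) ^ j).range).comap e.toLinearMap := by
    have hNj := hN j
    generalize (g - algebraMap F _ l) ^ j = N at *
    generalize (g' - algebraMap F _ l) ^ j = N' at *
    generalize g - algebraMap F _ l = M at *
    generalize g' - algebraMap F _ l = M' at *
    ext x
    simp only [Submodule.mem_comap, Submodule.mem_inf, LinearMap.mem_ker, LinearMap.mem_range,
      LinearEquiv.coe_coe, h1, e.map_eq_zero_iff]
    refine and_congr_right fun _ => ⟨?_, ?_⟩
    · rintro ⟨y, rfl⟩
      exact ⟨e y, hNj y⟩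
    · rintro ⟨y, hy⟩
      refine ⟨e.symm y, e.injective ?_⟩
      rw [← hNj, e.apply_symm_apply, hy]
  unfold jordanCount
  rw [hmap, Submodule.comap_equiv_eq_map_symm]
  exact LinearEquiv.finrank_map_eq e.symm _

theorem finrank_submodule_prod [FiniteDimensional F U] [FiniteDimensional F U']
    (S : Submodule F U) (T : Submodule F U') :
    Module.finrank F (S.prod T : Submodule F (U × U')) =
      Module.finrank F S + Module.finrank F T := by
  have h : (S.subtype.prodMap T.subtype).range = S.prod T := by
    rw [LinearMap.range_prodMap, Submodule.range_subtype, Submodule.range_subtype]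
  rw [← h, LinearMap.finrank_range_of_inj, Module.finrank_prod]
  exact S.injective_subtype.prodMap T.injective_subtype

theorem jordanCount_prodMap [FiniteDimensional F U] [FiniteDimensional F U']
    (g : Module.End F U) (g' : Module.End F U') (l : F) (j : ℕ) :
    jordanCount (g.prodMap g' : Module.End F (U × U')) l j =
      jordanCount g l j + jordanCount g' l j := by
  have hN : (g.prodMap g' - algebraMap F _ l : Module.End F (U × U')) =
      LinearMap.prodMap (g - algebraMap F _ l) (g' - algebraMap F _ l) := by
    ext <;> simp [Module.algebraMap_end_apply]
  have hpow : ((g.prodMap g' - algebraMap F _ l : Module.End F (U × U')) ^ j) =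
      LinearMap.prodMap ((g - algebraMap F _ l) ^ j) ((g' - algebraMap F _ l) ^ j) := by
    rw [hN]
    exact (map_pow (LinearMap.prodMapAlgHom F U U')
      (g - algebraMap F _ l, g' - algebraMap F _ l) j).symm
  unfold jordanCount
  rw [hpow, hN, LinearMap.ker_prodMap, LinearMap.range_prodMap, Submodule.prod_inf_prod,
    finrank_submodule_prod]

theorem aeval_sub_pow_apply (g : Module.End F U) (l : F) (m : ℕ) (x : U) :
    aeval g ((X - C l) ^ m) x = ((g - algebraMap F _ l) ^ m) x := by
  simp

theorem pow_dvd_of_jordanCount_ne_zero {g : Module.End F U} {d : F[X]} (hd0 : d ≠ 0)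
    (hd : aeval g d = 0) {l : F} {j : ℕ} (h : jordanCount g l j ≠ 0) : (X - C l) ^ (j + 1) ∣ d := by
  by_contra hnd
  refine h ?_
  obtain ⟨k, hk, hndk⟩ := exists_eq_pow_rootMultiplicity_mul_and_not_dvd d hd0 l
  have hvj : rootMultiplicity l d ≤ j := by
    by_contra! hlt
    exact hnd ((pow_dvd_pow _ hlt).trans (pow_rootMultiplicity_dvd d l))
  have hkl : k.eval l ≠ 0 := fun h0 => hndk (dvd_iff_isRoot.2 h0)
  suffices hbot : (g - algebraMap F _ l).ker ⊓ ((g - algebraMap F _ l) ^ j).range = ⊥ by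
    unfold jordanCount
    rw [hbot, finrank_bot]
  rw [eq_bot_iff]
  rintro x ⟨hx, y, hy⟩
  have hker : ∀ p : F[X], aeval g p x = p.eval l • x := by
    intro p
    obtain ⟨r, hr⟩ := X_sub_C_dvd_sub_C_eval (a := l) (p := p)
    have hp : p = r * (X - C l) + C (p.eval l) := by rw [mul_comm, ← hr, sub_add_cancel]
    conv_lhs => rw [hp]
    rw [map_add, aeval_C, map_mul, LinearMap.add_apply,
      Module.End.mul_apply, Module.algebraMap_end_apply]
    have : aeval g (X - C l) x = 0 := by simpa using hx
    rw [this, map_zero, zero_add]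
  have h0 : aeval g (k * (X - C l) ^ j) y = 0 := by
    obtain ⟨w, hw⟩ := Nat.exists_eq_add_of_le hvj
    have : k * (X - C l) ^ j = (X - C l) ^ w * d := by
      conv_rhs => rw [hk]
      rw [hw, pow_add]
      ring
    rw [this, map_mul, hd, mul_zero, LinearMap.zero_apply]
  rw [map_mul, Module.End.mul_apply, aeval_sub_pow_apply, hy, hker] at h0
  exact (smul_eq_zero.1 h0).resolve_left hkl

theorem jordanCount_ne_zero_of_pow_dvd [FiniteDimensional F U] {g : Module.End F U} {d : F[X]}
    (hd0 : d ≠ 0) {x : U}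
    (hx : ∀ p : F[X], aeval g p x = 0 ↔ d ∣ p) {l : F} {j : ℕ} (h : (X - C l) ^ (j + 1) ∣ d) :
    jordanCount g l j ≠ 0 := by
  obtain ⟨k, rfl⟩ := h
  have hz : aeval g ((X - C l) ^ j * k) x ≠ 0 := by
    rw [Ne, hx, pow_succ]
    rintro ⟨r, hr⟩
    have h0 : (X - C l) ^ j * k ≠ 0 := by
      intro h
      rw [pow_succ', mul_assoc, h, mul_zero] at hd0
      exact hd0 rfl
    have h1 : (X - C l) * r = 1 := by
      apply mul_left_cancel₀ h0
      rw [mul_one]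
      conv_rhs => rw [hr]
      ring
    exact not_isUnit_X_sub_C l (IsUnit.of_mul_eq_one _ h1)
  unfold jordanCount
  rw [Ne, Submodule.finrank_eq_zero]
  intro hbot
  refine hz ((Submodule.mem_bot F).1 (hbot ▸ ⟨?_, aeval g k x, ?_⟩))
  · have := (hx ((X - C l) ^ (j + 1) * k)).2 dvd_rfl
    rw [pow_succ', mul_assoc, map_mul, Module.End.mul_apply] at this
    simpa using this
  · rw [map_mul, Module.End.mul_apply, aeval_sub_pow_apply]

theorem jordanCount_le_one [FiniteDimensional F U] {g : Module.End F U} {x : U}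
    (hx : ∀ y, ∃ p : F[X], aeval g p x = y) (l : F) (j : ℕ) : jordanCount g l j ≤ 1 := by
  refine (Submodule.finrank_mono inf_le_left).trans ?_
  have h := LinearMap.finrank_range_add_finrank_ker (g - algebraMap F _ l)
  have htop : (g - algebraMap F _ l).range ⊔ Submodule.span F {x} = ⊤ := by
    rw [eq_top_iff]
    rintro y -
    obtain ⟨p, rfl⟩ := hx y
    rw [← modByMonic_add_div p (X - C l), modByMonic_X_sub_C_eq_C_eval, add_comm, map_add,
      LinearMap.add_apply]
    refine Submodule.add_mem_sup ?_ ?_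
    · rw [map_mul, Module.End.mul_apply]
      exact ⟨aeval g (p /ₘ (X - C l)) x, by simp⟩
    · rw [aeval_C, Module.algebraMap_end_apply]
      exact Submodule.smul_mem _ _ (Submodule.mem_span_singleton_self x)
  have h2 := Submodule.finrank_add_le_finrank_add_finrank (g - algebraMap F _ l).range
    (Submodule.span F {x})
  rw [htop, finrank_top] at h2
  have h3 := (finrank_span_le_card (R := F) {x}).trans (by simp : _ ≤ 1)
  omega

end Counting

section Splitting

variable {K V : Type*} [Field K] [AddCommGroup V] [Module K V]

theorem exists_minpoly_dvd_of_aeval_apply_eq_zero [FiniteDimensional K V] (f : Module.End K V) :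
    ∃ x : V, ∀ p : K[X], aeval f p x = 0 → minpoly K f ∣ p := by
  obtain ⟨x, hx⟩ := Module.exists_ker_toSpanSingleton_eq_annihilator K[X] (Module.AEval' f)
  refine ⟨(Module.AEval'.of f).symm x, fun p hp => ?_⟩
  rw [← Ideal.mem_span_singleton, span_minpoly_eq_annihilator, ← hx, LinearMap.mem_ker,
    LinearMap.toSpanSingleton_apply]
  apply (Module.AEval'.of f).symm.injective
  rw [map_zero, ← hp]
  exact Module.AEval.of_symm_smul ..

/-- The action of `K[X] / (minpoly K f)` on the underlying space of the endomorphism `f`. -/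
noncomputable def minpolyAction (f : Module.End K V) :
    AdjoinRoot (minpoly K f) →ₐ[K] Module.End K V :=
  Ideal.Quotient.liftₐ (Ideal.span {minpoly K f}) (aeval f) fun p hp => by
    obtain ⟨r, rfl⟩ := Ideal.mem_span_singleton.1 hp
    rw [map_mul, minpoly.aeval, zero_mul]

theorem minpolyAction_mk (f : Module.End K V) (p : K[X]) :
    minpolyAction f (AdjoinRoot.mk _ p) = aeval f p := rfl

theorem minpolyAction_root (f : Module.End K V) :
    minpolyAction f (AdjoinRoot.root _) = f := by
  rw [← AdjoinRoot.mk_X, minpolyAction_mk, aeval_X]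

theorem exists_dual_nondegenerate {d : K[X]} (hd : d.Monic) :
    ∃ τ : AdjoinRoot d →ₗ[K] K, ∀ z, (∀ z', τ (z * z') = 0) → z = 0 := by
  refine ⟨lcoeff K (d.natDegree - 1) ∘ₗ AdjoinRoot.modByMonicHom hd, fun z hz => ?_⟩
  by_contra hne
  set p := AdjoinRoot.modByMonicHom hd z with hp
  have hzp : AdjoinRoot.mk d p = z := AdjoinRoot.mk_leftInverse hd z
  have hp0 : p ≠ 0 := by
    rintro h
    rw [h, map_zero] at hzp
    exact hne hzp.symm
  have hd1 : d ≠ 1 := by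
    rintro rfl
    exact hne (hzp ▸ AdjoinRoot.mk_eq_zero.2 (one_dvd p))
  have hmod : p %ₘ d = p := by rw [← AdjoinRoot.modByMonicHom_mk hd, hzp, hp]
  have hdeg : p.natDegree < d.natDegree := by
    rw [← hmod]
    exact natDegree_modByMonic_lt p hd hd1
  have := hz (AdjoinRoot.mk d (X ^ (d.natDegree - 1 - p.natDegree)))
  rw [← hzp, ← map_mul, LinearMap.comp_apply, AdjoinRoot.modByMonicHom_mk,
    (modByMonic_eq_self_iff hd).2, lcoeff_apply] at this
  · have h2 : d.natDegree - 1 = p.natDegree + (d.natDegree - 1 - p.natDegree) := by omega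
    rw [h2, Nat.add_sub_cancel_left, coeff_mul_X_pow] at this
    exact hp0 (leadingCoeff_eq_zero.1 this)
  · apply degree_lt_degree
    rw [natDegree_mul_X_pow _ hp0]
    omega

/-- Every endomorphism of a finite-dimensional space splits off a cyclic endomorphism with the same
minimal polynomial. -/
theorem exists_equiv_adjoinRoot_minpoly_prod [FiniteDimensional K V] (f : Module.End K V) :
    ∃ (W : Submodule K V) (f' : Module.End K W)
      (e : (AdjoinRoot (minpoly K f) × W) ≃ₗ[K] V), ∀ x,
      e ((LinearMap.mulLeft K (AdjoinRoot.root (minpoly K f))).prodMap f' x) = f (e x) := by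
  have hm : (minpoly K f).Monic := minpoly.monic (Algebra.IsIntegral.isIntegral f)
  obtain ⟨x, hx⟩ := exists_minpoly_dvd_of_aeval_apply_eq_zero f
  obtain ⟨τ, hτ⟩ := exists_dual_nondegenerate hm
  have : Module.Finite K (AdjoinRoot (minpoly K f)) := hm.finite_adjoinRoot
  let i : AdjoinRoot (minpoly K f) →ₗ[K] V :=
    (LinearMap.applyₗ x).comp (minpolyAction f).toLinearMap
  have hi : ∀ z, i z = minpolyAction f z x := fun z => rfl
  have hif : ∀ z, i (AdjoinRoot.root _ * z) = f (i z) := fun z => by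
    rw [hi, map_mul, minpolyAction_root, Module.End.mul_apply, hi]
  have hker : i.ker = ⊥ := by
    rw [LinearMap.ker_eq_bot']
    intro z hz
    obtain ⟨p, rfl⟩ := AdjoinRoot.mk_surjective z
    exact AdjoinRoot.mk_eq_zero.2 (hx p (by rwa [hi, minpolyAction_mk] at hz))
  obtain ⟨r, hr⟩ := i.exists_leftInverse_of_injective hker
  let Φ : V →ₗ[K] Module.Dual K (AdjoinRoot (minpoly K f)) :=
    ((minpolyAction f).toLinearMap.compr₂ (τ ∘ₗ r)).flip
  have hΦ : ∀ m z, Φ m z = τ (r (minpolyAction f z m)) := fun m z => rfl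
  have hΦi : (Φ ∘ₗ i).ker = ⊥ := by
    rw [LinearMap.ker_eq_bot']
    intro z hz
    refine hτ z fun z' => ?_
    have := LinearMap.congr_fun hz z'
    rw [LinearMap.comp_apply, hΦ, hi, ← Module.End.mul_apply, ← map_mul, ← hi,
      LinearMap.zero_apply, mul_comm] at this
    rw [← this, ← LinearMap.comp_apply r, hr, LinearMap.id_apply]
  have hbij : Function.Bijective (Φ ∘ₗ i) := by
    have hinj := LinearMap.ker_eq_bot.1 hΦi
    refine ⟨hinj, (LinearMap.injective_iff_surjective_of_finrank_eq_finrank ?_).1 hinj⟩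
    exact Subspace.dual_finrank_eq.symm
  have hinv : ∀ m ∈ Φ.ker, f m ∈ Φ.ker := by
    intro m hm'
    rw [LinearMap.mem_ker] at hm' ⊢
    ext z
    have := LinearMap.congr_fun hm' (z * AdjoinRoot.root _)
    rwa [hΦ, map_mul, minpolyAction_root] at this
  refine ⟨Φ.ker, f.restrict hinv, LinearEquiv.ofBijective (i.coprod Φ.ker.subtype) ⟨?_, ?_⟩, ?_⟩
  · rw [← LinearMap.ker_eq_bot, LinearMap.ker_eq_bot']
    rintro ⟨z, m, hm'⟩ h
    have h1 : (Φ ∘ₗ i) z = 0 := by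
      have := congrArg Φ h
      simpa [LinearMap.mem_ker.1 hm'] using this
    have h2 : z = 0 := hbij.1 (by rw [h1, map_zero])
    subst h2
    simpa using h
  · intro v
    obtain ⟨z, hz⟩ := hbij.2 (Φ v)
    refine ⟨(z, ⟨v - i z, ?_⟩), by simp⟩
    rw [LinearMap.mem_ker, map_sub, ← hz, LinearMap.comp_apply, sub_self]
  · rintro ⟨z, m⟩
    change i (AdjoinRoot.root _ * z) + f m = f (i z + m)
    rw [hif, map_add]

end Splitting

section CyclicCounting

open TensorProduct

variable {K F : Type*} [Field K] [Field F] [Algebra K F]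

theorem aeval_baseChange_mulLeft_root_apply_one (d : K[X]) (p : F[X]) :
    aeval ((LinearMap.mulLeft K (AdjoinRoot.root d)).baseChange F) p (1 ⊗ₜ[K] (1 : AdjoinRoot d)) =
      aeval (1 ⊗ₜ[K] AdjoinRoot.root d : F ⊗[K] AdjoinRoot d) p := by
  have h : (LinearMap.mulLeft K (AdjoinRoot.root d)).baseChange F =
      Algebra.lmul F (F ⊗[K] AdjoinRoot d) (1 ⊗ₜ[K] AdjoinRoot.root d) := by
    ext z
    simp
  rw [h, aeval_algHom_apply]
  exact mul_one _

theorem aeval_one_tmul_root_eq_zero_iff (d : K[X]) (p : F[X]) :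
    aeval (1 ⊗ₜ[K] AdjoinRoot.root d : F ⊗[K] AdjoinRoot d) p = 0 ↔
      d.map (algebraMap K F) ∣ p := by
  constructor
  · intro h
    let φ : F ⊗[K] AdjoinRoot d →ₐ[F] AdjoinRoot (d.map (algebraMap K F)) :=
      Algebra.TensorProduct.lift (Algebra.ofId F _)
        (AdjoinRoot.liftAlgHom d (Algebra.ofId K _) (AdjoinRoot.root _) (by
          have := AdjoinRoot.eval₂_root (d.map (algebraMap K F))
          rwa [eval₂_map] at this)) fun _ _ => Commute.all _ _
    have h2 := congrArg φ h
    rw [← aeval_algHom_apply, map_zero] at h2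
    have h3 : φ (1 ⊗ₜ[K] AdjoinRoot.root d) = AdjoinRoot.root _ := by
      rw [Algebra.TensorProduct.lift_tmul, map_one, one_mul]
      exact AdjoinRoot.liftAlgHom_root ..
    rwa [h3, AdjoinRoot.aeval_eq, AdjoinRoot.mk_eq_zero] at h2
  · rintro ⟨r, rfl⟩
    have : aeval (1 ⊗ₜ[K] AdjoinRoot.root d : F ⊗[K] AdjoinRoot d) (d.map (algebraMap K F)) =
        0 := by
      rw [aeval_map_algebraMap]
      have := aeval_algHom_apply
        (Algebra.TensorProduct.includeRight : AdjoinRoot d →ₐ[K] F ⊗[K] AdjoinRoot d)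
        (AdjoinRoot.root d) d
      rw [Algebra.TensorProduct.includeRight_apply] at this
      rw [this, AdjoinRoot.aeval_eq, AdjoinRoot.mk_self, map_zero]
    rw [map_mul, this, zero_mul]

theorem exists_aeval_one_tmul_root_eq (d : K[X]) (y : F ⊗[K] AdjoinRoot d) :
    ∃ p : F[X], aeval (1 ⊗ₜ[K] AdjoinRoot.root d : F ⊗[K] AdjoinRoot d) p = y := by
  induction y with
  | zero => exact ⟨0, map_zero _⟩
  | add y z hy hz =>
    obtain ⟨p, rfl⟩ := hy
    obtain ⟨q, rfl⟩ := hz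
    exact ⟨p + q, map_add _ _ _⟩
  | tmul c z =>
    obtain ⟨p, rfl⟩ := AdjoinRoot.mk_surjective z
    refine ⟨C c * p.map (algebraMap K F), ?_⟩
    have := aeval_algHom_apply
      (Algebra.TensorProduct.includeRight : AdjoinRoot d →ₐ[K] F ⊗[K] AdjoinRoot d)
      (AdjoinRoot.root d) p
    rw [Algebra.TensorProduct.includeRight_apply] at this
    rw [map_mul, aeval_C, aeval_map_algebraMap, this, AdjoinRoot.aeval_eq,
      Algebra.TensorProduct.includeRight_apply, Algebra.TensorProduct.algebraMap_apply]
    simp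

theorem jordanCount_mulLeft_root_le_one {d : K[X]} (hd : d.Monic) (l : F) (j : ℕ) :
    jordanCount ((LinearMap.mulLeft K (AdjoinRoot.root d)).baseChange F) l j ≤ 1 := by
  have := hd.finite_adjoinRoot
  refine jordanCount_le_one (x := 1 ⊗ₜ[K] (1 : AdjoinRoot d)) (fun y => ?_) l j
  obtain ⟨p, rfl⟩ := exists_aeval_one_tmul_root_eq d y
  exact ⟨p, aeval_baseChange_mulLeft_root_apply_one d p⟩

theorem jordanCount_mulLeft_root_ne_zero {d : K[X]} (hd : d.Monic) {l : F} {j : ℕ}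
    (h : (X - C l) ^ (j + 1) ∣ d.map (algebraMap K F)) :
    jordanCount ((LinearMap.mulLeft K (AdjoinRoot.root d)).baseChange F) l j ≠ 0 := by
  have := hd.finite_adjoinRoot
  refine jordanCount_ne_zero_of_pow_dvd (hd.map _).ne_zero (x := 1 ⊗ₜ[K] (1 : AdjoinRoot d))
    (fun p => ?_) h
  rw [aeval_baseChange_mulLeft_root_apply_one, aeval_one_tmul_root_eq_zero_iff]

theorem aeval_baseChange_minpoly {V : Type*} [AddCommGroup V] [Module K V] (f : Module.End K V) :
    aeval (f.baseChange F) ((minpoly K f).map (algebraMap K F)) = 0 := by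
  rw [aeval_map_algebraMap]
  have := aeval_algHom_apply (Module.End.baseChangeHom K F V) f (minpoly K f)
  rw [minpoly.aeval, map_zero] at this
  exact this

theorem jordanCount_baseChange_prodMap {V W : Type*} [AddCommGroup V] [Module K V]
    [AddCommGroup W] [Module K W] [FiniteDimensional K V] [FiniteDimensional K W]
    (f : Module.End K V) (g : Module.End K W) (l : F) (j : ℕ) :
    jordanCount (LinearMap.baseChange F (f.prodMap g)) l j =
      jordanCount (f.baseChange F) l j + jordanCount (g.baseChange F) l j := by
  rw [← jordanCount_prodMap]
  refine jordanCount_conj (TensorProduct.prodRight K F F V W) (fun x => ?_) l j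
  induction x with
  | zero => simp only [map_zero]
  | add x y hx hy => simp only [map_add, hx, hy]
  | tmul c x => simp

theorem jordanCount_baseChange_conj {V W : Type*} [AddCommGroup V] [Module K V]
    [AddCommGroup W] [Module K W] {f : Module.End K V} {g : Module.End K W} (e : V ≃ₗ[K] W)
    (h : ∀ x, e (f x) = g (e x)) (l : F) (j : ℕ) :
    jordanCount (f.baseChange F) l j = jordanCount (g.baseChange F) l j := by
  refine jordanCount_conj (e.baseChange K F V W) (fun x => ?_) l j
  induction x with
  | zero => simp only [map_zero]
  | add x y hx hy => simp only [map_add, hx, hy]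
  | tmul c x => simp [h]

end CyclicCounting

section Induction

variable {K F : Type*} [Field K] [Field F] [Algebra K F]

theorem IsIdempotentComb.prodMap {V W : Type*} [AddCommGroup V] [Module K V] [AddCommGroup W]
    [Module K W] {a b : K} {f : Module.End K V} {g : Module.End K W}
    (hf : IsIdempotentComb a b f) (hg : IsIdempotentComb a b g) :
    IsIdempotentComb a b (LinearMap.prodMap f g : Module.End K (V × W)) := by
  obtain ⟨p, q, hp, hq, rfl⟩ := hf
  obtain ⟨p', q', hp', hq', rfl⟩ := hg
  have : IsIdempotentComb a b ((a • p + b • q, a • p' + b • q') :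
      Module.End K V × Module.End K W) :=
    ⟨(p, p'), (q, q'), Prod.ext hp hp', Prod.ext hq hq', rfl⟩
  exact this.map (LinearMap.prodMapAlgHom K V W)

theorem isIdempotentComb_of_jordanCount_le {a b : K} {Rel : ℕ → F → ℕ → F → Prop}
    (hcyc : ∀ d : K[X], d.Monic →
      (∀ i l j m, Rel i l j m → (X - C l) ^ (i + 1) ∣ d.map (algebraMap K F) →
        (X - C m) ^ (j + 1) ∣ d.map (algebraMap K F)) →
      IsIdempotentComb a b (LinearMap.mulLeft K (AdjoinRoot.root d)))
    {V : Type*} [AddCommGroup V] [Module K V] [FiniteDimensional K V] (f : Module.End K V)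
    (hf : ∀ i l j m, Rel i l j m → jordanCount (f.baseChange F) l i ≤
      jordanCount (f.baseChange F) m j) :
    IsIdempotentComb a b f := by
  induction hn : Module.finrank K V using Nat.strong_induction_on generalizing V with
  | _ n ih =>
  subst hn
  rcases subsingleton_or_nontrivial V with hV | hV
  · exact ⟨0, 0, by simp, by simp, Subsingleton.elim _ _⟩
  have hm : (minpoly K f).Monic := minpoly.monic (Algebra.IsIntegral.isIntegral f)
  have hfin := hm.finite_adjoinRoot
  obtain ⟨W, g, e, he⟩ := exists_equiv_adjoinRoot_minpoly_prod f
  have hadd : ∀ l j, jordanCount (f.baseChange F) l j =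
      jordanCount ((LinearMap.mulLeft K (AdjoinRoot.root (minpoly K f))).baseChange F) l j +
        jordanCount (g.baseChange F) l j := fun l j => by
    rw [← jordanCount_baseChange_prodMap]
    exact (jordanCount_baseChange_conj e he l j).symm
  have hdvd : ∀ {l : F} {j : ℕ}, jordanCount (f.baseChange F) l j ≠ 0 →
      (X - C l) ^ (j + 1) ∣ (minpoly K f).map (algebraMap K F) := by
    intro l j h
    have h0 := aeval_baseChange_minpoly (F := F) f
    exact pow_dvd_of_jordanCount_ne_zero (hm.map _).ne_zero h0 h
  have hZ := hcyc _ hm fun i l j m hr hd => hdvd (j := j) <| by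
    have h1 := jordanCount_mulLeft_root_ne_zero hm hd
    have h2 := hf i l j m hr
    have h3 := hadd l i
    omega
  have hW : IsIdempotentComb a b g := by
    refine ih _ ?_ g (fun i l j m hr => ?_) rfl
    · have h1 := e.finrank_eq
      have h2 : 0 < Module.finrank K (AdjoinRoot (minpoly K f)) := by
        rw [(AdjoinRoot.powerBasis' hm).finrank, AdjoinRoot.powerBasis'_dim]
        exact minpoly.natDegree_pos (Algebra.IsIntegral.isIntegral f)
      rw [Module.finrank_prod] at h1
      omega
    · have h1 := hf i l j m hr
      have h2 := hadd l i
      have h3 := hadd m j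
      have h4 := jordanCount_mulLeft_root_le_one hm m j
      by_cases h5 : jordanCount (f.baseChange F) l i = 0
      · omega
      · have h6 := jordanCount_mulLeft_root_ne_zero hm (hdvd h5)
        omega
  have := (hZ.prodMap hW).map (e.conjAlgEquiv K).toAlgHom
  convert this
  ext x
  have := he (e.symm x)
  rw [e.apply_symm_apply] at this
  exact this.symm

end Induction

section Cyclic

variable {K : Type*} [Field K]

theorem isIdempotentComb_comm {R : Type*} [Ring R] [Algebra K R] {a b : K} {x : R} :
    IsIdempotentComb a b x ↔ IsIdempotentComb b a x :=
  ⟨fun ⟨p, q, hp, hq, h⟩ => ⟨q, p, hq, hp, h.trans (add_comm _ _)⟩,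
    fun ⟨p, q, hp, hq, h⟩ => ⟨q, p, hq, hp, h.trans (add_comm _ _)⟩⟩

theorem isIdempotentComb_of_left_idempotent {R : Type*} [Ring R] [Algebra K R] {a b : K}
    (hb : b ≠ 0) {p x : R} (hp : p * p = p)
    (h : a • (p * x) = a • ((algebraMap K R (a + b) - x) * p) + x * (x - algebraMap K R b)) :
    IsIdempotentComb a b x := by
  refine ⟨p, b⁻¹ • (x - a • p), hp, ?_, ?_⟩
  · have key : (x - a • p) * (x - a • p) = b • (x - a • p) := by
      have e1 : (x - a • p) * (x - a • p) = x * x - a • (x * p) - a • (p * x) + (a * a) • p := by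
        simp only [mul_sub, sub_mul, smul_mul_assoc, mul_smul_comm, hp]
        module
      rw [e1, h]
      simp only [Algebra.algebraMap_eq_smul_one, mul_sub, sub_mul, smul_mul_assoc, mul_smul_comm,
        one_mul, mul_one]
      module
    rw [smul_mul_smul_comm, key, smul_smul, mul_assoc, inv_mul_cancel₀ hb, mul_one]
  · rw [smul_smul, mul_inv_cancel₀ hb, one_smul]
    abel

/-- The `K`-linear map `D` on `K[X]` with `D 1 = 0` and `D (X * f) = (s - X) * D f + r * f`. -/
noncomputable def twistedDerivation (s : K) (r : K[X]) : K[X] →ₗ[K] K[X] :=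
  Matrix.entryLinearMap K K[X] (0 : Fin 2) (1 : Fin 2) ∘ₗ
    (aeval (!![C s - X, r; 0, X] : Matrix (Fin 2) (Fin 2) K[X])).toLinearMap

theorem twistedDerivation_C (s : K) (r : K[X]) (k : K) : twistedDerivation s r (C k) = 0 := by
  simp [twistedDerivation, Matrix.algebraMap_matrix_apply]

theorem aeval_upperTriangular_apply_one_one (s : K) (r f : K[X]) :
    aeval (!![C s - X, r; 0, X] : Matrix (Fin 2) (Fin 2) K[X]) f 1 0 = 0 ∧
    aeval (!![C s - X, r; 0, X] : Matrix (Fin 2) (Fin 2) K[X]) f 1 1 = f := by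
  induction f using Polynomial.induction_on with
  | C k => simp [Matrix.algebraMap_matrix_apply]
  | add f g hf hg => simp [hf, hg]
  | monomial n k h =>
    have e : C k * X ^ (n + 1) = X * (C k * X ^ n) := by ring
    rw [e, map_mul (aeval _), aeval_X, Matrix.mul_apply, Matrix.mul_apply, Fin.sum_univ_two,
      Fin.sum_univ_two, h.1, h.2]
    simp

theorem twistedDerivation_X_mul (s : K) (r f : K[X]) :
    twistedDerivation s r (X * f) = (C s - X) * twistedDerivation s r f + r * f := by
  have h := (aeval_upperTriangular_apply_one_one s r f).2
  simp only [twistedDerivation, LinearMap.comp_apply, AlgHom.toLinearMap_apply,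
    Matrix.entryLinearMap_apply]
  rw [map_mul, aeval_X, Matrix.mul_apply, Fin.sum_univ_two, h]
  simp

theorem twistedDerivation_C_mul (s : K) (r : K[X]) (k : K) (f : K[X]) :
    twistedDerivation s r (C k * f) = C k * twistedDerivation s r f := by
  rw [← smul_eq_C_mul, map_smul, smul_eq_C_mul]

theorem dvd_twistedDerivation (s : K) (r f : K[X]) : r ∣ twistedDerivation s r f := by
  induction f using Polynomial.induction_on with
  | C k => simp [twistedDerivation_C]
  | add f g hf hg => rw [map_add]; exact dvd_add hf hg
  | monomial n k h =>
    have e : C k * X ^ (n + 1) = X * (C k * X ^ n) := by ring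
    rw [e, twistedDerivation_X_mul]
    exact dvd_add (h.mul_left _) (dvd_mul_right _ _)

theorem twistedDerivation_norm_mul (s : K) (r f : K[X]) :
    twistedDerivation s r (X * (C s - X) * f) = X * (C s - X) * twistedDerivation s r f := by
  have h : twistedDerivation s r ((C s - X) * f) = X * twistedDerivation s r f - r * f := by
    rw [sub_mul, map_sub, twistedDerivation_X_mul, twistedDerivation_C_mul]
    ring
  rw [mul_assoc, twistedDerivation_X_mul, h]
  ring

theorem twistedDerivation_comp_mul (s : K) (r h f : K[X]) :
    twistedDerivation s r (h.comp (X * (C s - X)) * f) =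
      h.comp (X * (C s - X)) * twistedDerivation s r f := by
  induction h using Polynomial.induction_on generalizing f with
  | C k => simp [twistedDerivation_C_mul]
  | add g h hg hh => rw [add_comp, add_mul, map_add, hg, hh, add_mul]
  | monomial n k h =>
    have e : C k * X ^ (n + 1) = (C k * X ^ n) * X := by ring
    rw [e, mul_comp, X_comp, mul_assoc, h, twistedDerivation_norm_mul]
    ring

theorem twistedDerivation_idem {s e v : K} {r : K[X]}
    (hr : r = X + C v - C e * (X * (C s - X))) (f : K[X]) :
    twistedDerivation s r (twistedDerivation s r f) = twistedDerivation s r f := by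
  induction f using Polynomial.induction_on with
  | C k => simp [twistedDerivation_C]
  | add f g hf hg => simp only [map_add, hf, hg]
  | monomial n k h =>
    have e1 : C k * X ^ (n + 1) = X * (C k * X ^ n) := by ring
    rw [e1]
    generalize C k * X ^ n = f at h
    have e2 : twistedDerivation s r (r * f) = (C s - X) * twistedDerivation s r f + r * f +
        C v * twistedDerivation s r f - C e * (X * (C s - X) * twistedDerivation s r f) := by
      have e3 : r * f = X * f + C v * f - C e * (X * (C s - X) * f) := by rw [hr]; ring
      conv_lhs => rw [e3]
      rw [map_sub, map_add, twistedDerivation_X_mul, twistedDerivation_C_mul,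
        twistedDerivation_C_mul, twistedDerivation_norm_mul]
    rw [twistedDerivation_X_mul, map_add, e2, sub_mul, map_sub, twistedDerivation_X_mul,
      twistedDerivation_C_mul, h]
    linear_combination (-twistedDerivation s r f) * hr

theorem exists_idempotent_adjoinRoot {s e v : K} {r h ε d : K[X]} (hd : d.Monic)
    (hr : r = X + C v - C e * (X * (C s - X))) (hdε : d = h.comp (X * (C s - X)) * ε)
    (hε : ε ∣ r) :
    ∃ E : Module.End K (AdjoinRoot d), E * E = E ∧
      E * LinearMap.mulLeft K (AdjoinRoot.root d) =
        (algebraMap K _ s - LinearMap.mulLeft K (AdjoinRoot.root d)) * E +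
          LinearMap.mulLeft K (AdjoinRoot.mk d r) := by
  let E : Module.End K (AdjoinRoot d) :=
    (AdjoinRoot.mkₐ d).toLinearMap ∘ₗ twistedDerivation s r ∘ₗ AdjoinRoot.modByMonicHom hd
  have hE : ∀ f, E (AdjoinRoot.mk d f) = AdjoinRoot.mk d (twistedDerivation s r f) := by
    intro f
    change AdjoinRoot.mk d (twistedDerivation s r (AdjoinRoot.modByMonicHom hd _)) = _
    rw [AdjoinRoot.modByMonicHom_mk]
    conv_rhs => rw [← modByMonic_add_div f d, map_add, map_add]
    rw [left_eq_add, AdjoinRoot.mk_eq_zero]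
    conv_rhs => rw [hdε, mul_assoc, twistedDerivation_comp_mul]
    conv_lhs => rw [hdε]
    exact mul_dvd_mul_left _ (hε.trans (dvd_twistedDerivation s r _))
  refine ⟨E, LinearMap.ext fun z => ?_, LinearMap.ext fun z => ?_⟩
  · obtain ⟨f, rfl⟩ := AdjoinRoot.mk_surjective z
    rw [Module.End.mul_apply, hE, hE, twistedDerivation_idem hr]
  · obtain ⟨f, rfl⟩ := AdjoinRoot.mk_surjective z
    have : twistedDerivation s r (X * f) =
      s • twistedDerivation s r f - X * twistedDerivation s r f + r * f := by
      rw [twistedDerivation_X_mul, smul_eq_C_mul]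
      ring
    simp only [Module.End.mul_apply, LinearMap.add_apply, LinearMap.sub_apply,
      LinearMap.mulLeft_apply, Module.algebraMap_end_apply, hE, ← map_mul, ← AdjoinRoot.mk_X, this,
      map_add, map_sub, AdjoinRoot.smul_mk]

theorem isIdempotentComb_root_of_dvd_X_mul {a b : K} (ha : a ≠ 0) (hb : b ≠ 0) {h ε d : K[X]}
    (hd : d.Monic) (hdε : d = h.comp (X * (C (a + b) - X)) * ε) (hε : ε ∣ X * (X - C b)) :
    IsIdempotentComb a b (LinearMap.mulLeft K (AdjoinRoot.root d)) := by
  have hC : C a * C a⁻¹ = 1 := by rw [← C_mul, mul_inv_cancel₀ ha, C_1]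
  obtain ⟨E, hE, hEr⟩ := exists_idempotent_adjoinRoot (s := a + b) (e := a⁻¹) (v := 0)
    (r := C a⁻¹ * (X * (X - C b))) hd (by
      simp only [C_add, C_0]; linear_combination X * hC) hdε (hε.mul_left _)
  refine isIdempotentComb_of_left_idempotent hb hE ?_
  rw [hEr, smul_add]
  congr 1
  refine LinearMap.ext fun z => ?_
  obtain ⟨f, rfl⟩ := AdjoinRoot.mk_surjective z
  simp only [Module.End.mul_apply, LinearMap.sub_apply, LinearMap.smul_apply,
    LinearMap.mulLeft_apply, Module.algebraMap_end_apply, ← map_mul, ← AdjoinRoot.mk_X, ← map_sub,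
    AdjoinRoot.smul_mk, smul_eq_C_mul]
  congr 1
  linear_combination (X * (X - C b) * f) * hC

theorem isIdempotentComb_root_of_dvd_X_sub_C_mul {a b : K} (ha : a ≠ 0) (hb : b ≠ 0)
    {h ε d : K[X]} (hd : d.Monic) (hdε : d = h.comp (X * (C (a + b) - X)) * ε)
    (hε : ε ∣ (X - C (a + b)) * (X - C a)) :
    IsIdempotentComb a b (LinearMap.mulLeft K (AdjoinRoot.root d)) := by
  have hC : C a * C a⁻¹ = 1 := by rw [← C_mul, mul_inv_cancel₀ ha, C_1]
  obtain ⟨E, hE, hEr⟩ := exists_idempotent_adjoinRoot (s := a + b) (e := -a⁻¹) (v := -(a + b))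
    (r := - C a⁻¹ * ((X - C (a + b)) * (X - C a))) hd (by
      simp only [C_add, C_neg]; linear_combination (X - C a - C b) * hC) hdε (hε.mul_left _)
  refine isIdempotentComb_of_left_idempotent (p := 1 - E) hb ?_ ?_
  · rw [sub_mul, one_mul, mul_sub, mul_one, hE, sub_self, sub_zero]
  · have hR : a • LinearMap.mulLeft K (AdjoinRoot.mk d (-C a⁻¹ * ((X - C (a + b)) * (X - C a)))) =
        -((LinearMap.mulLeft K (AdjoinRoot.root d) - algebraMap K _ (a + b)) *
          (LinearMap.mulLeft K (AdjoinRoot.root d) - algebraMap K _ a)) := by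
      refine LinearMap.ext fun z => ?_
      obtain ⟨f, rfl⟩ := AdjoinRoot.mk_surjective z
      simp only [Module.End.mul_apply, LinearMap.sub_apply, LinearMap.smul_apply,
        LinearMap.neg_apply, LinearMap.mulLeft_apply, Module.algebraMap_end_apply, ← map_mul,
        ← AdjoinRoot.mk_X, ← map_sub, ← map_neg (AdjoinRoot.mk d), AdjoinRoot.smul_mk,
        smul_eq_C_mul]
      congr 1
      linear_combination (-(X - C (a + b)) * (X - C a) * f) * hC
    rw [sub_mul, hEr, smul_sub, smul_add, hR]
    simp only [Algebra.algebraMap_eq_smul_one, mul_sub, sub_mul, smul_mul_assoc, mul_smul_comm,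
      one_mul, mul_one]
    module

end Cyclic

section NormDecomposition

variable {K F : Type*} [Field K] [Field F] [Algebra K F]

theorem exists_eq_comp_add_X_mul_comp (s : K) (d : K[X]) :
    ∃ d₀ d₁ : K[X], d = d₀.comp (X * (C s - X)) + X * d₁.comp (X * (C s - X)) := by
  induction d using Polynomial.induction_on with
  | C k => exact ⟨C k, 0, by simp⟩
  | add f g hf hg =>
    obtain ⟨f₀, f₁, hf⟩ := hf
    obtain ⟨g₀, g₁, hg⟩ := hg
    refine ⟨f₀ + g₀, f₁ + g₁, ?_⟩
    rw [add_comp, add_comp]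
    linear_combination hf + hg
  | monomial n k h =>
    obtain ⟨f₀, f₁, hf⟩ := h
    refine ⟨-X * f₁, f₀ + C s * f₁, ?_⟩
    simp only [add_comp, mul_comp, neg_comp, X_comp, C_comp]
    linear_combination X * hf

theorem exists_eq_comp_mul (s : K) {d : K[X]} (hd : d ≠ 0) :
    ∃ h e₀ e₁ : K[X], h ≠ 0 ∧ IsCoprime e₀ e₁ ∧
      d = h.comp (X * (C s - X)) * (e₀.comp (X * (C s - X)) + X * e₁.comp (X * (C s - X))) := by
  classical
  obtain ⟨d₀, d₁, rfl⟩ := exists_eq_comp_add_X_mul_comp s d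
  obtain ⟨e₀, he₀⟩ := EuclideanDomain.gcd_dvd_left d₀ d₁
  obtain ⟨e₁, he₁⟩ := EuclideanDomain.gcd_dvd_right d₀ d₁
  have hgcd := EuclideanDomain.gcd_eq_gcd_ab d₀ d₁
  generalize EuclideanDomain.gcd d₀ d₁ = g at *
  generalize EuclideanDomain.gcdA d₀ d₁ = u at *
  generalize EuclideanDomain.gcdB d₀ d₁ = v at *
  have hg : g ≠ 0 := by
    rintro rfl
    simp [he₀, he₁] at hd
  refine ⟨g, e₀, e₁, hg, ⟨u, v, mul_left_cancel₀ hg ?_⟩, ?_⟩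
  · linear_combination (-u) * he₀ - v * he₁ - hgcd
  · rw [he₀, he₁, mul_comp, mul_comp]
    ring

theorem not_mul_dvd_comp_add_X_mul_comp {e₀ e₁ : F[X]} (he : IsCoprime e₀ e₁) (l m : F) :
    ¬ (X - C l) * (X - C m) ∣
      e₀.comp (X * (C (l + m) - X)) + X * e₁.comp (X * (C (l + m) - X)) := by
  intro h
  have hc : X * (C (l + m) - X) - C (l * m) = -((X - C l) * (X - C m)) := by
    rw [C_add, C_mul]
    ring
  have hdvd : ∀ p : F[X], (X - C l) * (X - C m) ∣
      p.comp (X * (C (l + m) - X)) - C (p.eval (l * m)) := by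
    intro p
    obtain ⟨r, hr⟩ := X_sub_C_dvd_sub_C_eval (a := l * m) (p := p)
    have := congrArg (fun q => q.comp (X * (C (l + m) - X))) hr
    simp only [sub_comp, mul_comp, X_comp, C_comp, hc] at this
    rw [this]
    exact (dvd_neg.2 dvd_rfl).mul_right _
  have h2 : (X - C l) * (X - C m) ∣ C (e₁.eval (l * m)) * X + C (e₀.eval (l * m)) := by
    have := dvd_sub h (dvd_add (hdvd e₀) ((hdvd e₁).mul_left X))
    convert this using 1
    ring
  have h3 := eq_zero_of_dvd_of_degree_lt h2 (by
    rw [degree_mul, degree_X_sub_C, degree_X_sub_C]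
    exact degree_linear_le.trans_lt (by norm_num))
  have h4 : e₁.eval (l * m) = 0 := by simpa using congrArg (coeff · 1) h3
  have h5 : e₀.eval (l * m) = 0 := by simpa using congrArg (coeff · 0) h3
  obtain ⟨u, v, huv⟩ := he
  simpa [h4, h5] using congrArg (eval (l * m)) huv

theorem exists_comp_eq_pow_mul {h : F[X]} (hh : h ≠ 0) (l m : F) :
    ∃ (k : ℕ) (u : F[X]), h.comp (X * (C (l + m) - X)) = ((X - C l) * (X - C m)) ^ k * u ∧
      u.eval l ≠ 0 ∧ u.eval m ≠ 0 := by
  obtain ⟨r, hr, hnd⟩ := exists_eq_pow_rootMultiplicity_mul_and_not_dvd h hh (l * m)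
  have hr0 : r.eval (l * m) ≠ 0 := fun h0 => hnd (dvd_iff_isRoot.2 h0)
  generalize rootMultiplicity (l * m) h = k at hr
  have hc : X * (C (l + m) - X) - C (l * m) = -1 * ((X - C l) * (X - C m)) := by
    rw [C_add, C_mul]
    ring
  refine ⟨k, (-1) ^ k * r.comp (X * (C (l + m) - X)), ?_, ?_, ?_⟩
  · rw [hr, mul_comp, pow_comp, sub_comp, X_comp, C_comp, hc, mul_pow]
    ring
  · simpa [eval_comp] using hr0
  · simpa [eval_comp, mul_comm m l] using hr0

theorem pow_add_dvd_pow_mul_iff {l : F} {w : F[X]} (hw : w.eval l ≠ 0) (k i : ℕ) (p : F[X]) :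
    (X - C l) ^ (k + i) ∣ (X - C l) ^ k * w * p ↔ (X - C l) ^ i ∣ p := by
  rw [pow_add, mul_assoc, mul_dvd_mul_iff_left (pow_ne_zero _ (X_sub_C_ne_zero l))]
  refine ⟨fun h => ?_, fun h => h.mul_left _⟩
  refine IsCoprime.dvd_of_dvd_mul_left (IsCoprime.pow_left ?_) h
  exact ((irreducible_X_sub_C l).coprime_iff_not_dvd).2 fun h' => hw (dvd_iff_isRoot.1 h')

theorem dvd_of_roots_subset {K F : Type*} [Field K] [Field F] [Algebra K F] [IsAlgClosed F]
    {p : K[X]} (hp : p ≠ 0)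
    (hsimple : ∀ l : F, ¬ (X - C l) ^ 2 ∣ p.map (algebraMap K F)) {q : K[X]} (hq : q ≠ 0)
    (hroots : ∀ l : F, (p.map (algebraMap K F)).IsRoot l → (q.map (algebraMap K F)).IsRoot l) :
    p ∣ q := by
  classical
  have hp0 : p.map (algebraMap K F) ≠ 0 :=
    (Polynomial.map_ne_zero_iff (algebraMap K F).injective).2 hp
  have hq0 : q.map (algebraMap K F) ≠ 0 :=
    (Polynomial.map_ne_zero_iff (algebraMap K F).injective).2 hq
  rw [← map_dvd_map' (algebraMap K F)]
  refine (IsAlgClosed.splits _).dvd_of_roots_le_roots hp0 ?_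
  refine (Multiset.le_iff_subset (Multiset.nodup_iff_count_le_one.2 fun l => ?_)).2 fun l hl => ?_
  · rw [count_roots]
    by_contra! hlt
    exact hsimple l ((pow_dvd_pow _ hlt).trans (pow_rootMultiplicity_dvd _ l))
  · rw [mem_roots hq0]
    exact hroots l ((mem_roots hp0).1 hl)

end NormDecomposition

section Closed

variable {K F : Type*} [Field K] [Field F] [Algebra K F]

/-- The pairs `(l, i)`, `(m, j)` such that the number of Jordan blocks of size greater than `i` at
`l` of an `(a, b)`-composite is at most the number of blocks of size greater than `j` at `m`. -/
def JordanRel (a b : F) (i : ℕ) (l : F) (j : ℕ) (m : F) : Prop :=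
  l + m = a + b ∧
    (l ≠ m ∧ l * m * (l * m - a * b) = 0 ∧ i = j + 1 ∨
      l * m * (l * m - a * b) ≠ 0 ∧ i = j ∨
      l = m ∧ l * m * (l * m - a * b) ≠ 0 ∧ Even i ∧ j = i + 1)

theorem simple_of_jordanRel_closed {a b : F} {d h e₀ e₁ : F[X]} (hh : h ≠ 0)
    (he : IsCoprime e₀ e₁) (hd : d = h.comp (X * (C (a + b) - X)) *
      (e₀.comp (X * (C (a + b) - X)) + X * e₁.comp (X * (C (a + b) - X))))
    (hcl : ∀ i l j m, JordanRel a b i l j m → (X - C l) ^ (i + 1) ∣ d → (X - C m) ^ (j + 1) ∣ d)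
    {l m : F} (hlm : l + m = a + b)
    (hl : X - C l ∣ e₀.comp (X * (C (a + b) - X)) + X * e₁.comp (X * (C (a + b) - X))) :
    l * m * (l * m - a * b) = 0 ∧
      ¬ (X - C l) ^ 2 ∣ e₀.comp (X * (C (a + b) - X)) + X * e₁.comp (X * (C (a + b) - X)) ∧
      (l ≠ m → ¬ X - C m ∣ e₀.comp (X * (C (a + b) - X)) + X * e₁.comp (X * (C (a + b) - X))) := by
  have hnd := not_mul_dvd_comp_add_X_mul_comp he l m
  obtain ⟨k, u, hu, hul, hum⟩ := exists_comp_eq_pow_mul hh l m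
  rw [hlm] at hnd hu
  rw [hu] at hd
  generalize e₀.comp (X * (C (a + b) - X)) + X * e₁.comp (X * (C (a + b) - X)) = ε at *
  by_cases hne : l = m
  · subst hne
    rw [← pow_two] at hnd
    refine ⟨?_, hnd, fun h' => absurd rfl h'⟩
    by_contra hs
    have hdl : ∀ i, (X - C l) ^ (2 * k + i) ∣ d ↔ (X - C l) ^ i ∣ ε := fun i => by
      rw [hd, ← pow_two, ← pow_mul]
      exact pow_add_dvd_pow_mul_iff hul _ _ _
    have := hcl (2 * k) l (2 * k + 1) l ⟨hlm, .inr (.inr ⟨rfl, hs, even_two_mul k, rfl⟩)⟩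
      ((hdl 1).2 (by rwa [pow_one]))
    exact hnd ((hdl 2).1 this)
  · have hml : m - l ≠ 0 := sub_ne_zero.2 (Ne.symm hne)
    have hlm' : l - m ≠ 0 := sub_ne_zero.2 hne
    have hdl : ∀ i, (X - C l) ^ (k + i) ∣ d ↔ (X - C l) ^ i ∣ ε := fun i => by
      rw [hd, mul_pow, mul_assoc _ _ u]
      exact pow_add_dvd_pow_mul_iff (by simp [hlm', hul]) _ _ _
    have hdm : ∀ i, (X - C m) ^ (k + i) ∣ d ↔ (X - C m) ^ i ∣ ε := fun i => by
      rw [hd, mul_comm (X - C l), mul_pow, mul_assoc _ _ u]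
      exact pow_add_dvd_pow_mul_iff (by simp [hml, hum]) _ _ _
    have hm : ¬ X - C m ∣ ε := fun hm =>
      hnd ((pairwise_coprime_X_sub_C Function.injective_id hne).mul_dvd hl hm)
    have hs : l * m * (l * m - a * b) = 0 := by
      by_contra hs
      have := hcl k l k m ⟨hlm, .inr (.inl ⟨hs, rfl⟩)⟩ ((hdl 1).2 (by rwa [pow_one]))
      exact hm (by simpa using (hdm 1).1 this)
    refine ⟨hs, fun h2 => hm ?_, fun _ => hm⟩
    have := hcl (k + 1) l k m ⟨hlm, .inl ⟨hne, hs, rfl⟩⟩ ((hdl 2).2 h2)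
    simpa using (hdm 1).1 this

theorem exists_dvd_of_jordanRel_closed [IsAlgClosed F] {a b : K} {d : K[X]} (hd : d ≠ 0)
    (hcl : ∀ i l j m, JordanRel (algebraMap K F a) (algebraMap K F b) i l j m →
      (X - C l) ^ (i + 1) ∣ d.map (algebraMap K F) →
      (X - C m) ^ (j + 1) ∣ d.map (algebraMap K F)) :
    ∃ (h ε : K[X]) (y z : K), d = h.comp (X * (C (a + b) - X)) * ε ∧ (y = 0 ∨ y = a + b) ∧
      (z = a ∨ z = b) ∧ ε ∣ (X - C y) * (X - C z) := by
  classical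
  obtain ⟨h, e₀, e₁, hh, he, hdε⟩ := exists_eq_comp_mul (a + b) hd
  have hε0 : e₀.comp (X * (C (a + b) - X)) + X * e₁.comp (X * (C (a + b) - X)) ≠ 0 := by
    intro h0
    rw [h0, mul_zero] at hdε
    exact hd hdε
  have hsimple := fun l : F => simple_of_jordanRel_closed (l := l)
    (m := algebraMap K F a + algebraMap K F b - l)
    ((Polynomial.map_ne_zero_iff (algebraMap K F).injective).2 hh) ((isCoprime_map _).2 he)
    (by simpa [Polynomial.map_comp] using congrArg (Polynomial.map (algebraMap K F)) hdε) hcl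
    (by ring)
  have hmap : (e₀.map (algebraMap K F)).comp
        (X * (C (algebraMap K F a + algebraMap K F b) - X)) + X * (e₁.map (algebraMap K F)).comp
        (X * (C (algebraMap K F a + algebraMap K F b) - X)) =
      (e₀.comp (X * (C (a + b) - X)) + X * e₁.comp (X * (C (a + b) - X))).map (algebraMap K F) := by
    simp [Polynomial.map_comp]
  rw [hmap] at hsimple
  generalize e₀.comp (X * (C (a + b) - X)) + X * e₁.comp (X * (C (a + b) - X)) = ε at *
  have hroot : ∀ k : K, (ε.map (algebraMap K F)).IsRoot (algebraMap K F k) ↔ ε.IsRoot k :=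
    fun k => isRoot_map_iff (algebraMap K F).injective
  have hpair : ∀ k k' : K, k + k' = a + b → k ≠ k' → ε.IsRoot k → ¬ ε.IsRoot k' := by
    intro k k' hk hne h1 h2
    have e : algebraMap K F a + algebraMap K F b - algebraMap K F k = algebraMap K F k' := by
      rw [← map_add, ← hk, map_add, add_sub_cancel_left]
    refine (hsimple (algebraMap K F k) (dvd_iff_isRoot.2 ((hroot k).2 h1))).2.2 ?_ ?_
    · rw [e]
      exact (algebraMap K F).injective.ne hne
    · rw [e]
      exact dvd_iff_isRoot.2 ((hroot k').2 h2)
  refine ⟨h, ε, if ε.IsRoot 0 then 0 else a + b, if ε.IsRoot a then a else b, hdε,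
    by split_ifs <;> simp, by split_ifs <;> simp, ?_⟩
  refine dvd_of_roots_subset (F := F) hε0 (fun l h2 => ?_)
    (mul_ne_zero (X_sub_C_ne_zero _) (X_sub_C_ne_zero _)) fun l hl => ?_
  · exact (hsimple l ((dvd_pow_self _ two_ne_zero).trans h2)).2.1 h2
  · have h1 := (hsimple l (dvd_iff_isRoot.2 hl)).1
    have h2 : l = algebraMap K F 0 ∨ l = algebraMap K F (a + b) ∨ l = algebraMap K F a ∨
        l = algebraMap K F b := by
      have e : l * (algebraMap K F a + algebraMap K F b - l) *
          (l * (algebraMap K F a + algebraMap K F b - l) - algebraMap K F a * algebraMap K F b) =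
          (l - 0) * (l - (algebraMap K F a + algebraMap K F b)) * (l - algebraMap K F a) *
            (l - algebraMap K F b) := by ring
      rw [e, mul_eq_zero, mul_eq_zero, mul_eq_zero, sub_eq_zero, sub_eq_zero, sub_eq_zero,
        sub_eq_zero] at h1
      rw [map_zero, map_add]
      tauto
    have h3 : ∀ k : K, ((X - C (if ε.IsRoot 0 then 0 else a + b)) *
        (X - C (if ε.IsRoot a then a else b))).IsRoot k →
        (((X - C (if ε.IsRoot 0 then 0 else a + b)) *
        (X - C (if ε.IsRoot a then a else b))).map (algebraMap K F)).IsRoot (algebraMap K F k) :=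
      fun k => IsRoot.map
    rcases h2 with rfl | rfl | rfl | rfl <;> refine h3 _ ?_ <;> rw [hroot] at hl <;>
      rw [root_mul, root_X_sub_C, root_X_sub_C]
    · rw [if_pos hl]
      exact .inl rfl
    · left
      split_ifs with h0
      · by_contra hne
        exact hpair 0 (a + b) (zero_add _) hne h0 hl
      · rfl
    · rw [if_pos hl]
      exact .inr rfl
    · right
      split_ifs with h0
      · by_contra hne
        exact hpair a b rfl hne h0 hl
      · rfl

end Closed

section Descent

variable {K F : Type*} [Field K] [Field F] [Algebra K F]

theorem isIdempotentComb_root_of_jordanRel_closed [IsAlgClosed F] {a b : K} (ha : a ≠ 0)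
    (hb : b ≠ 0) {d : K[X]} (hd : d.Monic)
    (hcl : ∀ i l j m, JordanRel (algebraMap K F a) (algebraMap K F b) i l j m →
      (X - C l) ^ (i + 1) ∣ d.map (algebraMap K F) →
      (X - C m) ^ (j + 1) ∣ d.map (algebraMap K F)) :
    IsIdempotentComb a b (LinearMap.mulLeft K (AdjoinRoot.root d)) := by
  obtain ⟨h, ε, y, z, hdε, hy, hz, hε⟩ := exists_dvd_of_jordanRel_closed hd.ne_zero hcl
  have hdε' : d = h.comp (X * (C (b + a) - X)) * ε := by rwa [add_comm b a]
  rcases hy with hy | hy <;> rcases hz with hz | hz <;> rw [hy, hz] at hε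
  · rw [C_0, sub_zero] at hε
    exact isIdempotentComb_comm.1 (isIdempotentComb_root_of_dvd_X_mul hb ha hd hdε' hε)
  · rw [C_0, sub_zero] at hε
    exact isIdempotentComb_root_of_dvd_X_mul ha hb hd hdε hε
  · exact isIdempotentComb_root_of_dvd_X_sub_C_mul ha hb hd hdε hε
  · rw [add_comm a b] at hε
    exact isIdempotentComb_comm.1 (isIdempotentComb_root_of_dvd_X_sub_C_mul hb ha hd hdε' hε)

theorem IsIdempotentComb.jordanCount_le {U : Type*} [AddCommGroup U] [Module F U]
    [FiniteDimensional F U] {a b : F} (ha : a ≠ 0) (hb : b ≠ 0) {g : Module.End F U}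
    (hg : IsIdempotentComb a b g) {i : ℕ} {l : F} {j : ℕ} {m : F} (h : JordanRel a b i l j m) :
    jordanCount g l i ≤ jordanCount g m j := by
  obtain ⟨p, q, hp, hq, rfl⟩ := hg
  obtain ⟨hlm, ⟨hne, hs, rfl⟩ | ⟨hs, rfl⟩ | ⟨rfl, hs, ⟨k, rfl⟩, rfl⟩⟩ := h
  · exact jordanCount_succ_le ha hb hp hq (by rwa [add_comm]) hne.symm (by rwa [mul_comm m]) j
  · exact jordanCount_le_reflect ha hb hp hq (by rwa [add_comm]) (by rwa [mul_comm m]) i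
  · rw [← two_mul]
    exact jordanCount_even_le hp hq hlm hs k

theorem IsIdempotentComb.of_baseChange [IsAlgClosed F] {V : Type*} [AddCommGroup V] [Module K V]
    [FiniteDimensional K V] {a b : K} (ha : a ≠ 0) (hb : b ≠ 0) {f : Module.End K V}
    (hf : IsIdempotentComb (algebraMap K F a) (algebraMap K F b) (f.baseChange F)) :
    IsIdempotentComb a b f :=
  isIdempotentComb_of_jordanCount_le (fun _ => isIdempotentComb_root_of_jordanRel_closed ha hb) f
    fun _ _ _ _ => hf.jordanCount_le ((_root_.map_ne_zero _).2 ha)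
      ((_root_.map_ne_zero _).2 hb)

theorem Matrix.isABComposite_iff_isIdempotentComb {n : Type*} [Fintype n] [DecidableEq n] {a b : K}
    {A : Matrix n n K} : A.IsABComposite a b ↔ IsIdempotentComb a b A := Iff.rfl

theorem Matrix.IsABComposite.map_algebraMap {n : Type*} [Fintype n] [DecidableEq n] {a b : K}
    {A : Matrix n n K} (h : A.IsABComposite a b) :
    (A.map (algebraMap K F)).IsABComposite (algebraMap K F a) (algebraMap K F b) := by
  obtain ⟨P, Q, hP, hQ, rfl⟩ := h
  refine ⟨P.map (algebraMap K F), Q.map (algebraMap K F), ?_, ?_, ?_⟩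
  · rw [← Matrix.map_mul, hP]
  · rw [← Matrix.map_mul, hQ]
  · ext
    simp only [Matrix.map_apply, Matrix.add_apply, Matrix.smul_apply, smul_eq_mul, map_add,
      map_mul]

theorem Matrix.IsABComposite.of_map_algebraMap [IsAlgClosed F] {n : Type*} [Fintype n]
    [DecidableEq n] {a b : K} (ha : a ≠ 0) (hb : b ≠ 0) {A : Matrix n n K}
    (h : (A.map (algebraMap K F)).IsABComposite (algebraMap K F a) (algebraMap K F b)) :
    A.IsABComposite a b := by
  have hA : IsIdempotentComb a b (Matrix.toLinAlgEquiv' A) := by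
    refine .of_baseChange (F := F) ha hb ?_
    have hm := (Matrix.isABComposite_iff_isIdempotentComb.1 h).map
      (S := Module.End F (TensorProduct K F (n → K)))
      (Matrix.toLinAlgEquiv (Algebra.TensorProduct.basis F (Pi.basisFun K n))).toAlgHom
    convert hm using 1
    apply (LinearMap.toMatrix (Algebra.TensorProduct.basis F (Pi.basisFun K n))
      (Algebra.TensorProduct.basis F (Pi.basisFun K n))).injective
    rw [LinearMap.toMatrix_baseChange]
    exact (congrArg (fun M : Matrix n n K => M.map (algebraMap K F))
      (LinearMap.toMatrix'_toLin' A)).trans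
      (LinearMap.toMatrix_toLin (Algebra.TensorProduct.basis F (Pi.basisFun K n))
      (Algebra.TensorProduct.basis F (Pi.basisFun K n)) (A.map (algebraMap K F))).symm
  have := hA.map (Matrix.toLinAlgEquiv' (R := K) (n := n)).symm.toAlgHom
  simpa [Matrix.isABComposite_iff_isIdempotentComb] using this

end Descent

end Polynomial

/-- Being an `(α,β)`-composite is invariant under extension of scalars. -/
theorem matrix_isABComposite_iff_map
    {K L : Type*} [Field K] [Field L] [Algebra K L] {n : ℕ}
    (α β : K) (hα : α ≠ 0) (hβ : β ≠ 0) (A : Matrix (Fin n) (Fin n) K) :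
    Matrix.IsABComposite α β A ↔
      Matrix.IsABComposite (algebraMap K L α) (algebraMap K L β)
        (A.map (algebraMap K L)) := by
  refine ⟨fun h => h.map_algebraMap, fun h => ?_⟩
  refine .of_map_algebraMap (F := AlgebraicClosure L) hα hβ ?_
  have := h.map_algebraMap (F := AlgebraicClosure L)
  rw [← IsScalarTower.algebraMap_apply, ← IsScalarTower.algebraMap_apply, Matrix.map_map] at this
  rw [IsScalarTower.algebraMap_eq K L (AlgebraicClosure L)]
  exact this
end

section
/- Let K be a field, A ∈ M_n(K), and t ∈ K. The following are equivalent: (i) every elementary factor of A is a polynomial in X(X−t), i.e. of the form Q(X(X−t)) for some Q ∈ K[X]; (ii) for every λ in the algebraic closure K̄ of K: if λ ≠ t−λ then j_k(A,λ) = j_k(A,t−λ) for all k ≥ 1, while if λ = t−λ then j_{2k+1}(A,λ) = 0 for all k ≥ 0. -/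
open Polynomial

/-- The companion matrix of a monic polynomial of degree `d` (paper's convention:
`1`'s on the subdiagonal, last column built from the coefficients). -/
def companionMatrix {K : Type*} [Field K] (d : ℕ) (P : K[X]) :
    Matrix (Fin d) (Fin d) K :=
  Matrix.of fun i j =>
    if (i : ℕ) = (j : ℕ) + 1 then 1 else if (j : ℕ) = d - 1 then -P.coeff i else 0

/-- Similarity of square matrices. -/
def Matrix.Similar {K : Type*} [Field K] {m : Type*} [Fintype m] [DecidableEq m]
    (A B : Matrix m m K) : Prop :=
  ∃ S : Matrix m m K, IsUnit S ∧ A = S * B * S⁻¹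

/-- `A` admits elementary factors (invariant factors) all satisfying `pred`:
there are monic nonconstant polynomials `P 0 ∣ P 1 ∣ … ∣ P (N-1)` such that `A` is similar to
the block-diagonal matrix with diagonal blocks the companion matrices `C(P i)`,
and each `P i` satisfies `pred`. -/
def Matrix.ElemFactorsSatisfy {K : Type*} [Field K] {n : ℕ} (A : Matrix (Fin n) (Fin n) K)
    (pred : K[X] → Prop) : Prop :=
  ∃ (N : ℕ) (d : Fin N → ℕ) (P : Fin N → K[X]) (e : ((i : Fin N) × Fin (d i)) ≃ Fin n),
    (∀ i, (P i).Monic) ∧ (∀ i, 0 < (P i).natDegree) ∧ (∀ i, (P i).natDegree = d i) ∧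
    (∀ i j : Fin N, i ≤ j → P i ∣ P j) ∧
    Matrix.Similar A
      (Matrix.reindex e e (Matrix.blockDiagonal' fun i => companionMatrix (d i) (P i))) ∧
    ∀ i, pred (P i)

/-- The quotient of a principal ideal domain by a nonzero ideal is self-injective. -/
theorem Module.Baer.quotient_of_ne_bot {R : Type*} [CommRing R] [IsDomain R]
    [IsPrincipalIdealRing R] {J : Ideal R} (hJ : J ≠ ⊥) : Module.Baer (R ⧸ J) (R ⧸ J) := by
  classical
  intro I g
  have : IsPrincipalIdealRing (R ⧸ J) :=
    IsPrincipalIdealRing.of_surjective (Ideal.Quotient.mk J) Ideal.Quotient.mk_surjective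
  obtain ⟨p, rfl⟩ := IsPrincipalIdealRing.principal J
  obtain ⟨a, rfl⟩ := IsPrincipalIdealRing.principal I
  obtain ⟨d, ha⟩ := Ideal.Quotient.mk_surjective a
  have hp : p ≠ 0 := by rintro rfl; simp at hJ
  let := IsBezout.toGCDDomain R
  obtain ⟨e, he⟩ := gcd_dvd_right d p
  obtain ⟨d', hd'⟩ := gcd_dvd_left d p
  have he0 : e ≠ 0 := by rintro rfl; simp [hp] at he
  have haI : a ∈ Submodule.span (R ⧸ Submodule.span R {p}) {a} :=
    Submodule.mem_span_singleton_self a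
  obtain ⟨f, hf⟩ := Ideal.Quotient.mk_surjective (g ⟨a, haI⟩)
  have hea : Ideal.Quotient.mk (Submodule.span R {p}) e * a = 0 := by
    rw [← ha, ← map_mul, Ideal.Quotient.eq_zero_iff_mem]
    exact Ideal.mem_span_singleton.2 ⟨d', by rw [hd']; nth_rw 2 [he]; ring⟩
  have heg : Ideal.Quotient.mk (Submodule.span R {p}) (e * f) = 0 := by
    rw [map_mul, hf, ← smul_eq_mul, ← map_smul]
    convert map_zero g
    exact Subtype.ext hea
  rw [Ideal.Quotient.eq_zero_iff_mem] at heg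
  obtain ⟨q, hq⟩ := Ideal.mem_span_singleton.1 heg
  obtain ⟨u, v, huv⟩ := exists_gcd_eq_mul_add_mul d p
  have hf' : f = d * (u * q) + p * (v * q) := by
    apply mul_left_cancel₀ he0
    rw [hq]
    nth_rw 1 [he]
    rw [huv]; ring
  refine ⟨LinearMap.toSpanSingleton _ _ (Ideal.Quotient.mk _ (u * q)), fun x hx => ?_⟩
  obtain ⟨s, rfl⟩ := Submodule.mem_span_singleton.1 hx
  have : (⟨s • a, hx⟩ : Submodule.span (R ⧸ Submodule.span R {p}) {a}) = s • ⟨a, haI⟩ := rfl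
  rw [this, g.map_smul, ← hf, hf', map_add, map_mul _ p,
    Ideal.Quotient.eq_zero_iff_mem.2 (Ideal.mem_span_singleton_self p)]
  simp [← ha, mul_assoc]

/-- In a finitely generated module with nonzero annihilator `J` over a principal ideal domain `R`,
some submodule isomorphic to `R ⧸ J` is a direct summand. -/
theorem Module.exists_equiv_prod_quotient_annihilator {R : Type*} [CommRing R] [IsDomain R]
    [IsPrincipalIdealRing R] (M : Type*) [AddCommGroup M] [Module R M] [Module.Finite R M]
    (hM : Module.annihilator R M ≠ ⊥) :
    ∃ N : Submodule R M, Nonempty (((R ⧸ Module.annihilator R M) × N) ≃ₗ[R] M) := by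
  obtain ⟨x, hx⟩ := Module.exists_ker_toSpanSingleton_eq_annihilator R M
  have ht := Module.isTorsionBySet_annihilator R M
  let := ht.module
  have : IsScalarTower R (R ⧸ Module.annihilator R M) M := ht.isScalarTower
  have hinj : Function.Injective (LinearMap.toSpanSingleton (R ⧸ Module.annihilator R M) M x) := by
    rw [← LinearMap.ker_eq_bot, LinearMap.ker_eq_bot']
    intro s hs
    obtain ⟨r, rfl⟩ := Ideal.Quotient.mk_surjective s
    rw [Ideal.Quotient.eq_zero_iff_mem, ← hx]
    exact hs
  obtain ⟨h, hh⟩ := (Module.Baer.quotient_of_ne_bot hM).extension_property _ hinj LinearMap.id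
  let h' := h.restrictScalars R
  let i := (LinearMap.toSpanSingleton (R ⧸ Module.annihilator R M) M x).restrictScalars R
  have hi : h' ∘ₗ i = LinearMap.id := LinearMap.ext fun s => LinearMap.congr_fun hh s
  exact ⟨LinearMap.ker h', ⟨LinearEquiv.prodComm R _ _ ≪≫ₗ lequivProdOfRightSplitExact
    (Submodule.injective_subtype _) (by simp) hi⟩⟩

section CompQuadratic

variable {L : Type*} [Field L]

/-- The multiplicities of the roots of `P` are symmetric under `x ↦ t - x`, and even at the fixed
points. -/
def Polynomial.RootsSymmetric (t : L) (P : L[X]) : Prop :=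
  ∀ x, P.rootMultiplicity x = P.rootMultiplicity (t - x) ∧
    (x = t - x → Even (P.rootMultiplicity x))

namespace Polynomial

theorem RootsSymmetric.mul {t : L} {P Q : L[X]} (hP : P.RootsSymmetric t)
    (hQ : Q.RootsSymmetric t) : (P * Q).RootsSymmetric t := by
  by_cases h : P * Q = 0
  · intro x; simp [h]
  intro x
  rw [rootMultiplicity_mul h, rootMultiplicity_mul h]
  exact ⟨by rw [(hP x).1, (hQ x).1], fun hx => ((hP x).2 hx).add ((hQ x).2 hx)⟩

theorem RootsSymmetric.of_mul {t : L} {P Q : L[X]} (h : P * Q ≠ 0)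
    (hPQ : (P * Q).RootsSymmetric t) (hP : P.RootsSymmetric t) : Q.RootsSymmetric t := by
  intro x
  have := hPQ x
  rw [rootMultiplicity_mul h, rootMultiplicity_mul h, ← (hP x).1] at this
  refine ⟨by lia, fun hx => ?_⟩
  have h1 := this.2 hx
  have h2 := (hP x).2 hx
  grind

theorem rootsSymmetric_C (t c : L) : (C c).RootsSymmetric t := by
  intro x; simp

theorem rootsSymmetric_X_sub_C_mul (t a : L) :
    ((X - C a) * (X - C (t - a))).RootsSymmetric t := by
  classical
  intro x
  have h : (X - C a) * (X - C (t - a)) ≠ 0 := mul_ne_zero (X_sub_C_ne_zero _) (X_sub_C_ne_zero _)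
  rw [rootMultiplicity_mul h, rootMultiplicity_mul h]
  simp only [rootMultiplicity_X_sub_C]
  refine ⟨?_, fun hx => ?_⟩
  · grind
  · split_ifs <;> grind

theorem comp_rootsSymmetric [IsAlgClosed L] (t : L) (q : L[X]) :
    (q.comp (X * (X - C t))).RootsSymmetric t := by
  have h := IsAlgClosed.splits q
  rw [h.eq_prod_roots, mul_comp, C_comp]
  refine (rootsSymmetric_C t _).mul ?_
  induction q.roots using Multiset.induction with
  | empty => simpa using rootsSymmetric_C t 1
  | cons b s ih =>
    simp only [Multiset.map_cons, Multiset.prod_cons, mul_comp]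
    refine RootsSymmetric.mul ?_ ih
    obtain ⟨a, ha⟩ := IsAlgClosed.exists_root (X * (X - C t) - C b : L[X]) (by
      rw [show (X * (X - C t) - C b : L[X]) = C 1 * X ^ 2 + C (-t) * X + C (-b) by simp; ring,
        degree_quadratic one_ne_zero]; decide)
    have hb : b = a * (a - t) := by simp [IsRoot] at ha; linear_combination -ha
    convert rootsSymmetric_X_sub_C_mul t a using 1
    rw [hb]; simp; ring

theorem RootsSymmetric.exists_comp [IsAlgClosed L] {t : L} (P : L[X]) (hP : P.RootsSymmetric t) :
    ∃ q : L[X], P = q.comp (X * (X - C t)) := by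
  induction hn : P.natDegree using Nat.strong_induction_on generalizing P with
  | _ n ih =>
  by_cases h0 : P.degree = 0
  · exact ⟨C (P.coeff 0), by rw [C_comp]; exact eq_C_of_degree_eq_zero h0⟩
  by_cases hP0 : P = 0
  · exact ⟨0, by simp [hP0]⟩
  obtain ⟨a, ha⟩ := IsAlgClosed.exists_root P h0
  have h1 : 0 < P.rootMultiplicity a := (rootMultiplicity_pos hP0).2 ha
  have hdvd : (X - C a) * (X - C (t - a)) ∣ P := by
    by_cases hat : a = t - a
    · rw [← hat, ← sq]
      refine (le_rootMultiplicity_iff hP0).1 ?_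
      have := (hP a).2 hat
      grind
    · refine (isCoprime_X_sub_C_of_isUnit_sub ?_).mul_dvd (dvd_iff_isRoot.2 ha)
        (dvd_iff_isRoot.2 ((rootMultiplicity_pos hP0).1 ((hP a).1 ▸ h1)))
      exact (sub_ne_zero.2 hat).isUnit
  obtain ⟨Q, rfl⟩ := hdvd
  have hQ0 := right_ne_zero_of_mul hP0
  obtain ⟨q, hq⟩ := ih Q.natDegree (by
    rw [← hn, natDegree_mul (left_ne_zero_of_mul hP0) hQ0,
      natDegree_mul (X_sub_C_ne_zero _) (X_sub_C_ne_zero _)]; simp) Q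
    (RootsSymmetric.of_mul hP0 hP (rootsSymmetric_X_sub_C_mul t a)) rfl
  refine ⟨(X - C (a * (a - t))) * q, ?_⟩
  rw [mul_comp, ← hq]
  congr 1
  simp; ring

theorem exists_comp_of_map {K : Type*} [Field K] (f : K →+* L) {g : K[X]} (hg : g.Monic)
    (hg0 : 0 < g.natDegree) (P : K[X]) (q : L[X]) (h : P.map f = q.comp (g.map f)) :
    ∃ q' : K[X], P = q'.comp g := by
  induction hn : P.natDegree using Nat.strong_induction_on generalizing P q with
  | _ n ih =>
  have hgf : (g.map f).Monic := hg.map f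
  have hdeg : (C (q.coeff 0)).degree < (g.map f).degree := by
    rw [degree_map]
    exact degree_C_le.trans_lt (natDegree_pos_iff_degree_pos.1 hg0)
  have hq : C (q.coeff 0) + g.map f * q.divX.comp (g.map f) = P.map f := by
    rw [h]
    conv_rhs => rw [← divX_mul_X_add q]
    simp; ring
  obtain ⟨h1, h2⟩ := div_modByMonic_unique _ _ hgf ⟨hq, hdeg⟩
  rw [← map_divByMonic f hg] at h1
  rw [← map_modByMonic f hg] at h2
  have h2' : P %ₘ g = C ((P %ₘ g).coeff 0) := by
    apply map_injective f f.injective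
    rw [map_C, ← coeff_map, h2]; simp
  by_cases hd : P /ₘ g = 0
  · refine ⟨C ((P %ₘ g).coeff 0), ?_⟩
    rw [C_comp, ← h2']
    conv_lhs => rw [← modByMonic_add_div P g, hd, mul_zero, add_zero]
  · obtain ⟨q', hq'⟩ := ih (P /ₘ g).natDegree (by
      have : ¬ P.degree < g.degree := fun h => hd ((divByMonic_eq_zero_iff hg).2 h)
      have : g.natDegree ≤ P.natDegree := natDegree_le_natDegree (not_lt.1 this)
      rw [natDegree_divByMonic _ hg]; lia) _ q.divX h1 rfl
    refine ⟨X * q' + C ((P %ₘ g).coeff 0), ?_⟩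
    simp only [add_comp, mul_comp, X_comp, C_comp]
    rw [← hq', ← h2', add_comm, modByMonic_add_div]

end Polynomial

end CompQuadratic

open Module in
/-- The invariant factor decomposition of a finite-dimensional `K[X]`-module, with the invariant
factors listed in decreasing order of divisibility. -/
theorem Polynomial.exists_invariantFactors_antitone {K : Type*} [Field K] (n : ℕ) (M : Type*)
    [AddCommGroup M] [Module K M] [Module K[X] M] [IsScalarTower K K[X] M] [FiniteDimensional K M]
    (hn : finrank K M = n) :
    ∃ (N : ℕ) (P : Fin N → K[X]), (∀ i, (P i).Monic) ∧ (∀ i, 0 < (P i).natDegree) ∧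
      (∀ i j, i ≤ j → P j ∣ P i) ∧ Nonempty ((∀ i, K[X] ⧸ Ideal.span {P i}) ≃ₗ[K[X]] M) := by
  classical
  induction n using Nat.strong_induction_on generalizing M with
  | _ n ih =>
  rcases subsingleton_or_nontrivial M with hM | hM
  · exact ⟨0, Fin.elim0, fun i => i.elim0, fun i => i.elim0, fun i => i.elim0,
      ⟨LinearEquiv.ofSubsingleton _ _⟩⟩
  have : Module.Finite K[X] M := Module.Finite.of_restrictScalars_finite K K[X] M
  have hann : annihilator K[X] M ≠ ⊥ := by
    intro h
    have hinj : Function.Injective (Algebra.lsmul K K M (A := K[X])) := by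
      rw [injective_iff_map_eq_zero]
      intro p hp
      have : p ∈ annihilator K[X] M := mem_annihilator.2 fun m => LinearMap.congr_fun hp m
      simpa [h] using this
    have := Module.Finite.of_injective (Algebra.lsmul K K M (A := K[X])).toLinearMap hinj
    exact Polynomial.not_finite this
  obtain ⟨q, hq⟩ := IsPrincipalIdealRing.principal (annihilator K[X] M)
  have hq0 : q ≠ 0 := by rintro rfl; exact hann (by simp [hq])
  set P₀ := normalize q with hP₀
  have hP₀m : P₀.Monic := monic_normalize hq0
  have hP₀s : annihilator K[X] M = Ideal.span {P₀} := by
    rw [hq]; exact Ideal.span_singleton_eq_span_singleton.2 (normalize_associated q).symm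
  have hP₀d : 0 < P₀.natDegree := by
    rw [Nat.pos_iff_ne_zero]
    intro h
    rw [hP₀m.natDegree_eq_zero] at h
    rw [h, Ideal.span_singleton_one, annihilator_eq_top_iff] at hP₀s
    exact not_subsingleton M hP₀s
  obtain ⟨S, ⟨e⟩⟩ := exists_equiv_prod_quotient_annihilator M hann
  rw [hP₀s] at e
  have := hP₀m.finite_quotient
  have hS : FiniteDimensional K S :=
    inferInstanceAs (FiniteDimensional K (S.restrictScalars K))
  have hlt : finrank K S < n := by
    have := (e.restrictScalars K).finrank_eq
    rw [finrank_prod, finrank_quotient_span_eq_natDegree] at this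
    lia
  obtain ⟨N, P, hm, hd, hP, ⟨f⟩⟩ := ih _ hlt S rfl
  have hdvd : ∀ i, P i ∣ P₀ := by
    intro i
    have h1 : P₀ • f (Pi.single i 1) = 0 := by
      ext
      simpa using mem_annihilator.1
        (hP₀s ▸ Ideal.mem_span_singleton_self P₀ : P₀ ∈ annihilator K[X] M) _
    rw [← map_smul, f.map_eq_zero_iff] at h1
    have h2 : P₀ • (1 : K[X] ⧸ Ideal.span {P i}) = 0 := by
      simpa using congrFun h1 i
    have h3 : Ideal.Quotient.mk (Ideal.span {P i}) (P₀ * 1) = 0 := h2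
    rw [mul_one] at h3
    exact Ideal.mem_span_singleton.1 (Ideal.Quotient.eq_zero_iff_mem.1 h3)
  refine ⟨N + 1, Fin.cons P₀ P, Fin.cases hP₀m hm, Fin.cases hP₀d hd, ?_, ⟨?_⟩⟩
  · intro i j hij
    induction j using Fin.cases with
    | zero => rw [Fin.le_zero_iff.1 hij]
    | succ j =>
      induction i using Fin.cases with
      | zero => exact hdvd j
      | succ i => exact hP i j (Fin.succ_le_succ_iff.1 hij)
  · exact (Fin.consLinearEquiv K[X]
      (fun i => K[X] ⧸ Ideal.span {(Fin.cons P₀ P : Fin (N + 1) → K[X]) i})).symm ≪≫ₗ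
      ((LinearEquiv.refl _ _).prodCongr f ≪≫ₗ e)

open Module in
/-- The rational canonical form of an endomorphism of a finite-dimensional vector space. -/
theorem Module.End.exists_invariantFactors {K V : Type*} [Field K] [AddCommGroup V] [Module K V]
    [FiniteDimensional K V] (f : Module.End K V) :
    ∃ (N : ℕ) (P : Fin N → K[X]), (∀ i, (P i).Monic) ∧ (∀ i, 0 < (P i).natDegree) ∧
      (∀ i j, i ≤ j → P i ∣ P j) ∧
      ∃ e : (∀ i, AdjoinRoot (P i)) ≃ₗ[K] V,
        ∀ v, e (fun i => AdjoinRoot.root (P i) * v i) = f (e v) := by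
  have : FiniteDimensional K (AEval' f) := Module.Finite.equiv (AEval'.of f)
  obtain ⟨N, P, hm, hd, hP, ⟨e⟩⟩ := exists_invariantFactors_antitone (K := K) _ (AEval' f) rfl
  let e' : (∀ i, AdjoinRoot (P i)) ≃ₗ[K] (∀ i, AdjoinRoot (P (Fin.rev i))) :=
    LinearEquiv.piCongrLeft' K (fun i => AdjoinRoot (P i)) Fin.revPerm
  let e'' : (∀ i, AdjoinRoot (P i)) ≃ₗ[K] AEval' f := e.restrictScalars K
  refine ⟨N, fun i => P (Fin.rev i), fun i => hm _, fun i => hd _,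
    fun i j hij => hP _ _ (Fin.rev_le_rev.2 hij), e'.symm ≪≫ₗ e'' ≪≫ₗ (AEval'.of f).symm,
    fun v => ?_⟩
  obtain ⟨w, rfl⟩ := e'.surjective v
  have h1 : e'.symm (fun i => AdjoinRoot.root (P (Fin.rev i)) * e' w i) =
      fun i => AdjoinRoot.root (P i) * w i := by
    rw [LinearEquiv.symm_apply_eq]; rfl
  have h2 : e'' (fun i => AdjoinRoot.root (P i) * w i) = (X : K[X]) • e'' w :=
    e.map_smul (X : K[X]) w
  simp only [LinearEquiv.trans_apply, h1, LinearEquiv.symm_apply_apply, h2]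
  exact AEval'.of_symm_X_smul f _

section RationalCanonicalForm

open scoped Matrix

variable {K : Type*} [Field K] {N : ℕ} (P : Fin N → K[X])

/-- Multiplication by `X` on `∏ i, K[X] / (P i)`. -/
noncomputable def AdjoinRoot.piRootMul : Module.End K (∀ i, AdjoinRoot (P i)) :=
  LinearMap.mulLeft K (fun i => AdjoinRoot.root (P i))

variable {P}

/-- The basis of `∏ i, K[X] / (P i)` consisting of the powers of `X` in each factor. -/
noncomputable def AdjoinRoot.piBasis (hP : ∀ i, (P i).Monic) :
    Module.Basis ((i : Fin N) × Fin (P i).natDegree) K (∀ i, AdjoinRoot (P i)) :=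
  Pi.basis fun i => AdjoinRoot.powerBasisAux' (hP i)

theorem AdjoinRoot.powerBasisAux'_repr_root_mul {P : K[X]} (hP : P.Monic)
    (a b : Fin P.natDegree) :
    (powerBasisAux' hP).repr (root P * powerBasisAux' hP b) a =
      companionMatrix P.natDegree P a b := by
  have hb : powerBasisAux' hP b = root P ^ (b : ℕ) := (powerBasis' hP).basis_eq_pow b
  rw [hb, ← pow_succ', powerBasisAux'_repr_apply_to_fun, ← mk_X, ← map_pow, modByMonicHom_mk]
  have ha := a.2
  have hb := b.2
  simp only [companionMatrix, Matrix.of_apply]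
  by_cases h : (b : ℕ) + 1 < P.natDegree
  · rw [(modByMonic_eq_self_iff hP).2 (by
      rw [degree_X_pow, degree_eq_natDegree hP.ne_zero]; exact_mod_cast h), coeff_X_pow]
    simp [show ¬ (b : ℕ) = P.natDegree - 1 by lia]
  · have h' : (b : ℕ) + 1 = P.natDegree := by lia
    have : X ^ P.natDegree %ₘ P = X ^ P.natDegree - P := by
      refine (div_modByMonic_unique 1 _ hP ⟨by ring, ?_⟩).2
      have := degree_sub_lt_left (p := X ^ P.natDegree) (q := P)
        (by rw [degree_X_pow, degree_eq_natDegree hP.ne_zero]) (by simp) (by simp [hP.leadingCoeff])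
      rwa [degree_X_pow, ← degree_eq_natDegree hP.ne_zero] at this
    rw [h', this, coeff_sub, coeff_X_pow]
    simp [show ¬ (a : ℕ) = P.natDegree by lia, show (b : ℕ) = P.natDegree - 1 by lia]

theorem AdjoinRoot.toMatrix_piRootMul (hP : ∀ i, (P i).Monic) :
    LinearMap.toMatrix (piBasis hP) (piBasis hP) (piRootMul P) =
      Matrix.blockDiagonal' fun i => companionMatrix (P i).natDegree (P i) := by
  ext ⟨i, a⟩ ⟨j, b⟩
  rw [LinearMap.toMatrix_apply, piBasis, Pi.basis_repr, Pi.basis_apply, piRootMul,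
    LinearMap.mulLeft_apply, Pi.mul_apply]
  by_cases h : i = j
  · subst h
    rw [Pi.single_eq_same, Matrix.blockDiagonal'_apply_eq, powerBasisAux'_repr_root_mul]
  · rw [Pi.single_eq_of_ne h, Matrix.blockDiagonal'_apply_ne _ _ _ h]
    simp

/-- A matrix which represents multiplication by `X` on a product of quotients of `K[X]` is similar
to the block diagonal matrix of the corresponding companion matrices. -/
theorem Matrix.similar_blockDiagonal_companionMatrix_of_equiv {n : ℕ}
    {A : Matrix (Fin n) (Fin n) K} (hP : ∀ i, (P i).Monic)
    (f : (∀ i, AdjoinRoot (P i)) ≃ₗ[K] (Fin n → K))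
    (hf : ∀ v, f (AdjoinRoot.piRootMul P v) = A *ᵥ f v) :
    ∃ e : ((i : Fin N) × Fin (P i).natDegree) ≃ Fin n, Matrix.Similar A
      (Matrix.reindex e e
        (Matrix.blockDiagonal' fun i => companionMatrix (P i).natDegree (P i))) := by
  classical
  let b := (AdjoinRoot.piBasis hP).map f
  let e := b.indexEquiv (Pi.basisFun K (Fin n))
  let b' := b.reindex e
  have hA : LinearMap.toMatrix b' b' A.mulVecLin = Matrix.reindex e e
        (Matrix.blockDiagonal' fun i => companionMatrix (P i).natDegree (P i)) := by
    rw [← AdjoinRoot.toMatrix_piRootMul hP]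
    ext i j
    simp [LinearMap.toMatrix_apply, b', b, ← hf]
  refine ⟨e, (Pi.basisFun K (Fin n)).toMatrix b', ?_, ?_⟩
  · have := (Pi.basisFun K (Fin n)).invertibleToMatrix b'
    exact isUnit_of_invertible _
  · have := (Pi.basisFun K (Fin n)).invertibleToMatrix b'
    rw [Matrix.inv_eq_right_inv ((Pi.basisFun K (Fin n)).toMatrix_mul_toMatrix_flip b'), ← hA,
      basis_toMatrix_mul_linearMap_toMatrix_mul_basis_toMatrix, LinearMap.toMatrix_eq_toMatrix',
      ← Matrix.toLin'_apply']
    exact (LinearMap.toMatrix'_toLin' A).symm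

/-- A matrix which is similar to a block diagonal matrix of companion matrices represents
multiplication by `X` on the corresponding product of quotients of `K[X]`. -/
theorem Matrix.Similar.exists_equiv_adjoinRoot {n : ℕ}
    {A : Matrix (Fin n) (Fin n) K} (hP : ∀ i, (P i).Monic)
    {e : ((i : Fin N) × Fin (P i).natDegree) ≃ Fin n}
    (h : Matrix.Similar A (Matrix.reindex e e
        (Matrix.blockDiagonal' fun i => companionMatrix (P i).natDegree (P i)))) :
    ∃ f : (∀ i, AdjoinRoot (P i)) ≃ₗ[K] (Fin n → K),
      ∀ v, f (AdjoinRoot.piRootMul P v) = A *ᵥ f v := by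
  classical
  obtain ⟨S, hS, hA⟩ := h
  let b := (AdjoinRoot.piBasis hP).reindex e
  have hdet : IsUnit S.det := (Matrix.isUnit_iff_isUnit_det S).1 hS
  have hb : LinearMap.toMatrix b b (AdjoinRoot.piRootMul P) = Matrix.reindex e e
        (Matrix.blockDiagonal' fun i => companionMatrix (P i).natDegree (P i)) := by
    rw [← AdjoinRoot.toMatrix_piRootMul hP]
    ext i j
    simp [LinearMap.toMatrix_apply, b]
  refine ⟨b.equivFun ≪≫ₗ Matrix.toLin'OfInv (Matrix.nonsing_inv_mul S hdet)
    (Matrix.mul_nonsing_inv S hdet), fun v => ?_⟩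
  change S *ᵥ b.repr (AdjoinRoot.piRootMul P v) = A *ᵥ S *ᵥ b.repr v
  rw [← LinearMap.toMatrix_mulVec_repr b b, hb, hA, Matrix.mulVec_mulVec, Matrix.mulVec_mulVec,
    Matrix.mul_assoc, Matrix.nonsing_inv_mul S hdet, Matrix.mul_one]

end RationalCanonicalForm

section JordanCounts

open scoped Matrix

variable {K : Type*} [Field K]

theorem AdjoinRoot.ker_mulLeft_pow_min {P : K[X]} (hP : P ≠ 0) (a : K) (k : ℕ) :
    LinearMap.ker (LinearMap.mulLeft K (mk P (X - C a) ^ k)) =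
      LinearMap.ker (LinearMap.mulLeft K (mk P (X - C a) ^ min k (P.rootMultiplicity a))) := by
  rcases le_total k (P.rootMultiplicity a) with h | h
  · rw [min_eq_left h]
  rw [min_eq_right h]
  obtain ⟨Q, hQ, hndvd⟩ := exists_eq_pow_rootMultiplicity_mul_and_not_dvd P hP a
  obtain ⟨l, rfl⟩ := Nat.exists_eq_add_of_le h
  have hcop : IsCoprime Q ((X - C a) ^ l) :=
    (((prime_X_sub_C a).irreducible.coprime_iff_not_dvd).2 hndvd).symm.pow_right
  ext v
  obtain ⟨v, rfl⟩ := mk_surjective v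
  simp only [LinearMap.mem_ker, LinearMap.mulLeft_apply, ← map_pow, ← map_mul, mk_eq_zero]
  refine ⟨fun hv => ?_, fun hv => hv.trans ⟨(X - C a) ^ l, by ring⟩⟩
  nth_rw 1 [hQ] at hv ⊢
  rw [pow_add, mul_assoc] at hv
  have h0 : (X - C a) ^ P.rootMultiplicity a ≠ 0 := pow_ne_zero _ (X_sub_C_ne_zero a)
  exact mul_dvd_mul_left _ (hcop.dvd_of_dvd_mul_left ((mul_dvd_mul_iff_left h0).1 hv))

theorem AdjoinRoot.finrank_ker_mulLeft_mk {D Q : K[X]} (hD : D ≠ 0) (hQ : Q ≠ 0) :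
    Module.finrank K (LinearMap.ker (LinearMap.mulLeft K (mk (D * Q) D))) = D.natDegree := by
  let g : K[X] →ₗ[K] AdjoinRoot (D * Q) := (mkₐ (D * Q)).toLinearMap ∘ₗ LinearMap.mulLeft K Q
  have hg : LinearMap.ker g = (Ideal.span {D}).restrictScalars K := by
    ext p
    change mk (D * Q) (Q * p) = 0 ↔ p ∈ Ideal.span {D}
    rw [mk_eq_zero, mul_comm D, mul_dvd_mul_iff_left hQ, Ideal.mem_span_singleton]
  have hr : LinearMap.range g = LinearMap.ker (LinearMap.mulLeft K (mk (D * Q) D)) := by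
    ext v
    obtain ⟨v, rfl⟩ := mk_surjective v
    rw [LinearMap.mem_ker, LinearMap.mulLeft_apply, ← map_mul, mk_eq_zero,
      mul_dvd_mul_iff_left hD]
    constructor
    · rintro ⟨p, hp⟩
      exact (dvd_sub_right ⟨p, rfl⟩).1 ((dvd_mul_left Q D).trans (mk_eq_mk.1 hp))
    · rintro ⟨p, rfl⟩
      exact ⟨p, rfl⟩
  rw [← hr, ← g.quotKerEquivRange.finrank_eq, hg]
  exact finrank_quotient_span_eq_natDegree

theorem AdjoinRoot.finrank_ker_mulLeft_pow {P : K[X]} (hP : P ≠ 0) (a : K) (k : ℕ) :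
    Module.finrank K (LinearMap.ker (LinearMap.mulLeft K (mk P (X - C a) ^ k))) =
      min k (P.rootMultiplicity a) := by
  obtain ⟨Q, hQ⟩ := (le_rootMultiplicity_iff hP (a := a)).1 (min_le_right k _)
  rw [ker_mulLeft_pow_min hP]
  generalize min k (P.rootMultiplicity a) = m at *
  subst hQ
  rw [← map_pow, finrank_ker_mulLeft_mk (left_ne_zero_of_mul hP) (right_ne_zero_of_mul hP)]
  simp

variable {N n : ℕ} {P : Fin N → K[X]} {A : Matrix (Fin n) (Fin n) K}

theorem finrank_ker_sub_smul_one_pow (hP : ∀ i, (P i).Monic)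
    (f : (∀ i, AdjoinRoot (P i)) ≃ₗ[K] (Fin n → K))
    (hf : ∀ v, f (AdjoinRoot.piRootMul P v) = A *ᵥ f v) (a : K) (k : ℕ) :
    Module.finrank K (LinearMap.ker ((A - a • 1) ^ k).mulVecLin) =
      ∑ i, min k ((P i).rootMultiplicity a) := by
  have hpow : ∀ v, f (fun i => AdjoinRoot.mk (P i) (X - C a) ^ k * v i) =
      (A - a • 1) ^ k *ᵥ f v := by
    intro v
    induction k with
    | zero => simp
    | succ k ih =>
      rw [pow_succ', ← Matrix.mulVec_mulVec, ← ih, Matrix.sub_mulVec, ← hf, Matrix.smul_mulVec,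
        Matrix.one_mulVec, ← map_smul, ← map_sub]
      congr 1
      ext i
      simp only [AdjoinRoot.piRootMul, Pi.sub_apply, Pi.smul_apply, LinearMap.mulLeft_apply,
        Pi.mul_apply, map_sub, AdjoinRoot.mk_X, AdjoinRoot.mk_C]
      rw [Algebra.smul_def, AdjoinRoot.algebraMap_eq]
      ring
  have := fun i => (hP i).finite_adjoinRoot
  let e₁ : LinearMap.ker ((A - a • 1) ^ k).mulVecLin ≃ₗ[K]
      (∀ i, LinearMap.ker (LinearMap.mulLeft K (AdjoinRoot.mk (P i) (X - C a) ^ k))) :=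
    LinearEquiv.symm
    { toFun := fun v => ⟨f fun i => v i, by
        rw [LinearMap.mem_ker, Matrix.mulVecLin_apply, ← hpow, f.map_eq_zero_iff]
        exact funext fun i => (v i).2⟩
      invFun := fun w i => ⟨f.symm w i, by
        have h := w.2
        rw [LinearMap.mem_ker, Matrix.mulVecLin_apply, ← f.apply_symm_apply w.1, ← hpow,
          f.map_eq_zero_iff] at h
        exact congrFun h i⟩
      map_add' := fun v w => Subtype.ext (f.map_add (fun i => v i) (fun i => w i))
      map_smul' := fun c v => Subtype.ext (f.map_smul c (fun i => v i))
      left_inv := fun v => by ext i; simp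
      right_inv := fun w => by ext i; simp }
  rw [e₁.finrank_eq, Module.finrank_pi_fintype]
  exact Finset.sum_congr rfl fun i _ => AdjoinRoot.finrank_ker_mulLeft_pow (hP i).ne_zero a k

theorem matNk_eq_card (hP : ∀ i, (P i).Monic)
    (f : (∀ i, AdjoinRoot (P i)) ≃ₗ[K] (Fin n → K))
    (hf : ∀ v, f (AdjoinRoot.piRootMul P v) = A *ᵥ f v) (a : K) {k : ℕ} (hk : 1 ≤ k) :
    matNk A a k = (Finset.univ.filter fun i => k ≤ (P i).rootMultiplicity a).card := by
  obtain ⟨k, rfl⟩ := Nat.exists_eq_add_of_le' hk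
  rw [matNk, finrank_ker_sub_smul_one_pow hP f hf, finrank_ker_sub_smul_one_pow hP f hf,
    Nat.add_sub_cancel, Finset.card_filter, tsub_eq_iff_eq_add_of_le
      (Finset.sum_le_sum fun i _ => by lia), ← Finset.sum_add_distrib]
  refine Finset.sum_congr rfl fun i _ => ?_
  split_ifs <;> lia

/-- The number of Jordan blocks of size `k` for the eigenvalue `a` is the number of invariant
factors in which `a` is a root of multiplicity exactly `k`. -/
theorem matJk_eq_card (hP : ∀ i, (P i).Monic)
    (f : (∀ i, AdjoinRoot (P i)) ≃ₗ[K] (Fin n → K))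
    (hf : ∀ v, f (AdjoinRoot.piRootMul P v) = A *ᵥ f v) (a : K) {k : ℕ} (hk : 1 ≤ k) :
    matJk A a k = (Finset.univ.filter fun i => (P i).rootMultiplicity a = k).card := by
  rw [matJk, matNk_eq_card hP f hf a hk, matNk_eq_card hP f hf a (by lia),
    tsub_eq_iff_eq_add_of_le (Finset.card_le_card
      (Finset.monotone_filter_right _ fun i _ h => by lia))]
  simp only [Finset.card_filter, ← Finset.sum_add_distrib]
  refine Finset.sum_congr rfl fun i _ => ?_
  split_ifs <;> lia

end JordanCounts

theorem Monotone.eq_of_card_filter_eq {N : ℕ} {f g : Fin N → ℕ} (hf : Monotone f)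
    (hg : Monotone g)
    (h : ∀ k, 1 ≤ k → (Finset.univ.filter fun i => f i = k).card =
      (Finset.univ.filter fun i => g i = k).card) : f = g := by
  have h0 : (Finset.univ.filter fun i => f i = 0).card =
      (Finset.univ.filter fun i => g i = 0).card := by
    have key (f : Fin N → ℕ) (T : ℕ) (hT : ∀ i, f i ≤ T) :
        (Finset.univ.filter fun i => f i = 0).card +
          ∑ k ∈ Finset.Icc 1 T, (Finset.univ.filter fun i => f i = k).card =
            (Finset.univ : Finset (Fin N)).card := by
      rw [Finset.card_eq_sum_card_fiberwise (s := Finset.univ)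
        (f := f) (t := insert 0 (Finset.Icc 1 T)) (fun i _ => by have := hT i; simp; lia),
        Finset.sum_insert (by simp)]
    have hT (i : Fin N) : f i ≤ ∑ i, f i + ∑ i, g i :=
      (Finset.single_le_sum (fun _ _ => Nat.zero_le _) (Finset.mem_univ i)).trans
        (Nat.le_add_right _ _)
    have hT' (i : Fin N) : g i ≤ ∑ i, f i + ∑ i, g i :=
      (Finset.single_le_sum (fun _ _ => Nat.zero_le _) (Finset.mem_univ i)).trans
        (Nat.le_add_left _ _)
    have h1 := key f _ hT
    have h2 := key g _ hT'
    rw [Finset.sum_congr rfl fun k hk => h k (Finset.mem_Icc.1 hk).1] at h1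
    lia
  have hcount (f : Fin N → ℕ) (k : ℕ) :
      (List.ofFn f).count k = (Finset.univ.filter fun i => f i = k).card := by
    rw [← Multiset.coe_count, ← Fin.univ_val_map, Multiset.count_map]
    simp only [eq_comm (a := k)]
    rfl
  refine List.ofFn_injective (List.Perm.eq_of_sortedLE ?_ ?_ (List.perm_iff_count.2 fun k => ?_))
  · exact List.sortedLE_ofFn_iff.2 hf
  · exact List.sortedLE_ofFn_iff.2 hg
  · rw [hcount, hcount]
    rcases Nat.eq_zero_or_pos k with rfl | hk
    exacts [h0, h k hk]

section Map

variable {K L : Type*} [Field K] [Field L] (φ : K →+* L)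

theorem companionMatrix_map (d : ℕ) (P : K[X]) :
    (companionMatrix d P).map φ = companionMatrix d (P.map φ) := by
  ext i j
  simp only [companionMatrix, Matrix.map_apply, Matrix.of_apply, coeff_map]
  split_ifs <;> simp

theorem Matrix.Similar.map {m : Type*} [Fintype m] [DecidableEq m] {A B : Matrix m m K}
    (h : Matrix.Similar A B) : Matrix.Similar (A.map φ) (B.map φ) := by
  obtain ⟨S, hS, rfl⟩ := h
  refine ⟨S.map φ, hS.map φ.mapMatrix, ?_⟩
  have hinv : (S.map φ)⁻¹ = S⁻¹.map φ := Matrix.inv_eq_right_inv <| by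
    rw [← Matrix.map_mul, Matrix.mul_nonsing_inv S ((Matrix.isUnit_iff_isUnit_det S).1 hS),
      Matrix.map_one φ φ.map_zero φ.map_one]
  rw [Matrix.map_mul, Matrix.map_mul, hinv]

/-- The Jordan block counts of `A` over an extension `L` of `K`, read off from the elementary
factors of `A` over `K`. -/
theorem Matrix.Similar.matJk_map_eq_card {N n : ℕ} {d : Fin N → ℕ} {P : Fin N → K[X]}
    {e : ((i : Fin N) × Fin (d i)) ≃ Fin n} {A : Matrix (Fin n) (Fin n) K}
    (hP : ∀ i, (P i).Monic) (hd : ∀ i, (P i).natDegree = d i)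
    (h : Matrix.Similar A
      (Matrix.reindex e e (Matrix.blockDiagonal' fun i => companionMatrix (d i) (P i))))
    (a : L) {k : ℕ} (hk : 1 ≤ k) :
    matJk (A.map φ) a k =
      (Finset.univ.filter fun i => ((P i).map φ).rootMultiplicity a = k).card := by
  obtain rfl : (fun i => ((P i).map φ).natDegree) = d :=
    funext fun i => (natDegree_map φ).trans (hd i)
  have hPφ : ∀ i, ((P i).map φ).Monic := fun i => (hP i).map φ
  have h' := h.map φ
  rw [Matrix.reindex_apply, ← Matrix.submatrix_map, Matrix.blockDiagonal'_map _ _ φ.map_zero] at h'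
  simp only [companionMatrix_map] at h'
  obtain ⟨f, hf⟩ := Matrix.Similar.exists_equiv_adjoinRoot hPφ h'
  exact matJk_eq_card hPφ f hf a hk

end Map

/-- Elementary factors are polynomials in `X(X−t)` iff the Jordan structure over the algebraic
closure is symmetric under `λ ↦ t − λ`, with only even-sized blocks at the fixed point. -/
theorem elemFactors_comp_mul_iff_jordan_symm
    {K : Type*} [Field K] {n : ℕ} (A : Matrix (Fin n) (Fin n) K) (t : K) :
    Matrix.ElemFactorsSatisfy A
        (fun p => ∃ q : K[X], p = q.comp (Polynomial.X * (Polynomial.X - Polynomial.C t))) ↔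
      ∀ lam : AlgebraicClosure K,
        (lam ≠ algebraMap K (AlgebraicClosure K) t - lam →
          ∀ k : ℕ, 1 ≤ k →
            matJk (A.map (algebraMap K (AlgebraicClosure K))) lam k =
              matJk (A.map (algebraMap K (AlgebraicClosure K)))
                (algebraMap K (AlgebraicClosure K) t - lam) k) ∧
        (lam = algebraMap K (AlgebraicClosure K) t - lam →
          ∀ k : ℕ, matJk (A.map (algebraMap K (AlgebraicClosure K))) lam (2 * k + 1) = 0) := by
  set φ := algebraMap K (AlgebraicClosure K)
  have hg : (X * (X - C t)).map φ = X * (X - C (φ t)) := by simp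
  constructor
  · rintro ⟨N, d, P, e, hP, -, hd, -, hsim, hpred⟩ lam
    have hsymm (i : Fin N) : ((P i).map φ).RootsSymmetric (φ t) := by
      obtain ⟨q, hq⟩ := hpred i
      rw [hq, map_comp, hg]
      exact comp_rootsSymmetric _ _
    refine ⟨fun _ k hk => ?_, fun hlam k => ?_⟩
    · rw [hsim.matJk_map_eq_card φ hP hd _ hk, hsim.matJk_map_eq_card φ hP hd _ hk]
      simp only [← (hsymm _ lam).1]
    · rw [hsim.matJk_map_eq_card φ hP hd _ (by lia), Finset.card_eq_zero,
        Finset.filter_eq_empty_iff]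
      intro i _ hi
      have := (hsymm i lam).2 hlam
      rw [hi] at this
      exact Nat.not_even_two_mul_add_one k this
  · intro hJ
    obtain ⟨N, P, hP, hdeg, hdvd, f, hf⟩ := Module.End.exists_invariantFactors A.mulVecLin
    obtain ⟨e, hsim⟩ := Matrix.similar_blockDiagonal_companionMatrix_of_equiv hP f hf
    refine ⟨N, _, P, e, hP, hdeg, fun _ => rfl, hdvd, hsim, fun i => ?_⟩
    have hcard (lam : AlgebraicClosure K) {k : ℕ} (hk : 1 ≤ k) :=
      hsim.matJk_map_eq_card φ hP (fun _ => rfl) lam hk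
    have hmono (lam : AlgebraicClosure K) :
        Monotone fun i => ((P i).map φ).rootMultiplicity lam := fun i j hij =>
      rootMultiplicity_le_rootMultiplicity_of_dvd ((hP j).map φ).ne_zero
        (Polynomial.map_dvd φ (hdvd i j hij)) lam
    have hsymm : ((P i).map φ).RootsSymmetric (φ t) := by
      refine fun lam => ⟨?_, fun hlam => ?_⟩
      · by_cases hlam : lam = φ t - lam
        · rw [← hlam]
        · refine congrFun ((hmono lam).eq_of_card_filter_eq (hmono (φ t - lam)) fun k hk => ?_) i
          rw [← hcard lam hk, ← hcard _ hk]
          exact (hJ lam).1 hlam k hk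
      · by_contra hodd
        obtain ⟨k, hk⟩ := Nat.not_even_iff_odd.1 hodd
        have h0 := (hJ lam).2 hlam k
        rw [hcard lam (by lia), Finset.card_eq_zero, Finset.filter_eq_empty_iff] at h0
        exact h0 (Finset.mem_univ i) hk
    obtain ⟨q, hq⟩ := hsymm.exists_comp
    exact exists_comp_of_map φ (monic_X.mul (monic_X_sub_C t))
      (by rw [natDegree_mul X_ne_zero (X_sub_C_ne_zero t)]; simp) _ q (by rw [hq, hg])
end

section
/- Let K be a field, α, β ∈ K nonzero, and M ∈ M_n(K) a matrix having no eigenvalue (in an algebraic closure of K) belonging to {0, α, β, α+β}; equivalently, the matrices M, M−αI, M−βI and M−(α+β)I are all invertible. The following are equivalent: (i) every elementary factor of M is a polynomial in (X−α)(X−β); (ii) n is even and there exists N ∈ M_{n/2}(K) such that M is similar to the block matrix [[α·I_{n/2}, N],[I_{n/2}, β·I_{n/2}]]; (iii) M is an (α,β)-composite. -/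
open Polynomial

universe u

/-- The unimodular change of basis that diagonalises `diag (g a, g b)` into its gcd and lcm. -/
theorem nonempty_quotient_prod_equiv_gcd_lcm {R : Type*} [CommRing R] (g a b u v : R)
    (h : u * a + v * b = 1) :
    Nonempty (((R ⧸ Ideal.span {g * a}) × (R ⧸ Ideal.span {g * b})) ≃ₗ[R]
      ((R ⧸ Ideal.span {g * a * b}) × (R ⧸ Ideal.span {g}))) := by
  let row (x y c d : R) : R →ₗ[R] (R ⧸ Ideal.span {x}) × (R ⧸ Ideal.span {y}) :=
    LinearMap.toSpanSingleton R _ (Submodule.Quotient.mk c, Submodule.Quotient.mk d)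
  have hrow (x y c d z : R) (hc : x ∣ z * c) (hd : y ∣ z * d) :
      Ideal.span {z} ≤ LinearMap.ker (row x y c d) := by
    rw [Ideal.span_singleton_le_iff_mem, LinearMap.mem_ker]
    simp only [row, LinearMap.toSpanSingleton_apply, Prod.smul_mk, Prod.mk_eq_zero,
      ← Submodule.Quotient.mk_smul, Submodule.Quotient.mk_eq_zero, smul_eq_mul,
      Ideal.mem_span_singleton]
    exact ⟨hc, hd⟩
  let F : ((R ⧸ Ideal.span {g * a}) × (R ⧸ Ideal.span {g * b})) →ₗ[R]
      ((R ⧸ Ideal.span {g * a * b}) × (R ⧸ Ideal.span {g})) :=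
    (Submodule.liftQ _ (row _ _ (-(v * b)) 1)
        (hrow _ _ _ _ _ ⟨-v, by ring⟩ ⟨a, by ring⟩)).coprod
      (Submodule.liftQ _ (row _ _ (u * a) 1) (hrow _ _ _ _ _ ⟨u, by ring⟩ ⟨b, by ring⟩))
  let G : ((R ⧸ Ideal.span {g * a * b}) × (R ⧸ Ideal.span {g})) →ₗ[R]
      ((R ⧸ Ideal.span {g * a}) × (R ⧸ Ideal.span {g * b})) :=
    (Submodule.liftQ _ (row _ _ (-1) 1)
        (hrow _ _ _ _ _ ⟨-b, by ring⟩ ⟨a, by ring⟩)).coprod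
      (Submodule.liftQ _ (row _ _ (u * a) (v * b))
        (hrow _ _ _ _ _ ⟨u, by ring⟩ ⟨v, by ring⟩))
  have hF (x y : R) : F (Submodule.Quotient.mk x, Submodule.Quotient.mk y) =
      (Submodule.Quotient.mk (x * (-(v * b)) + y * (u * a)), Submodule.Quotient.mk (x + y)) := by
    refine Prod.ext ?_ ?_
    · rfl
    · refine congrArg Submodule.Quotient.mk (show x * 1 + y * 1 = x + y by ring)
  have hG (x y : R) : G (Submodule.Quotient.mk x, Submodule.Quotient.mk y) =
      (Submodule.Quotient.mk (x * (-1) + y * (u * a)),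
        Submodule.Quotient.mk (x * 1 + y * (v * b))) := rfl
  refine ⟨LinearEquiv.ofLinearMap F G (LinearMap.ext ?_) (LinearMap.ext ?_)⟩
  all_goals
    rintro ⟨x, y⟩
    obtain ⟨x, rfl⟩ := Submodule.Quotient.mk_surjective _ x
    obtain ⟨y, rfl⟩ := Submodule.Quotient.mk_surjective _ y
    simp only [LinearMap.comp_apply, hF, hG, LinearMap.id_apply]
    congr 2
  · linear_combination x * h
  · linear_combination y * h
  · linear_combination x * h
  · linear_combination y * h

theorem exists_monic_gcd_factorization {K : Type*} [Field K] {a b : K[X]} (ha : a.Monic)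
    (hb : b.Monic) :
    ∃ g a' b' u v : K[X], g.Monic ∧ a'.Monic ∧ b'.Monic ∧ a = g * a' ∧ b = g * b' ∧
      u * a' + v * b' = 1 := by
  classical
  have hg0 : gcd a b ≠ 0 := fun h => ha.ne_zero ((gcd_eq_zero_iff _ _).1 h).1
  have hg : (gcd a b).Monic := by
    rw [← normalize_gcd]; exact monic_normalize hg0
  obtain ⟨a', ha'⟩ := gcd_dvd_left a b
  obtain ⟨b', hb'⟩ := gcd_dvd_right a b
  obtain ⟨u, v, h⟩ := exists_gcd_eq_mul_add_mul a b
  refine ⟨gcd a b, a', b', u, v, hg, hg.of_mul_monic_left (ha' ▸ ha),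
    hg.of_mul_monic_left (hb' ▸ hb), ha', hb', mul_left_cancel₀ hg0 ?_⟩
  linear_combination -h - u * ha' - v * hb'


/-- The `K[X]`-module `∏ i, K[X] / (P i)`. -/
abbrev PiQuotient {K ι : Type*} [Field K] (P : ι → K[X]) : Type _ :=
  ∀ i, K[X] ⧸ Ideal.span {P i}

/-- A cyclic factor can be merged into a decomposition whose moduli form a divisibility chain. -/
theorem exists_chain_insert {K : Type*} [Field K] : ∀ (k : ℕ) (P : Fin k → K[X]) (a : K[X]),
    (∀ i, (P i).Monic) → (∀ i, 0 < (P i).natDegree) → (∀ i j, i ≤ j → P j ∣ P i) → a.Monic →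
    ∃ (k' : ℕ) (P' : Fin k' → K[X]), (∀ i, (P' i).Monic) ∧ (∀ i, 0 < (P' i).natDegree) ∧
      (∀ i j, i ≤ j → P' j ∣ P' i) ∧
      (∀ c, a ∣ c → (∀ i, P i ∣ c) → ∀ i, P' i ∣ c) ∧
      Nonempty (((K[X] ⧸ Ideal.span {a}) × PiQuotient P) ≃ₗ[K[X]] PiQuotient P') := by
  intro k
  induction k with
  | zero =>
    intro P a hP hP0 hc ha
    by_cases ha0 : a.natDegree = 0
    · have : Subsingleton (K[X] ⧸ Ideal.span {a}) := by
        rw [ha.natDegree_eq_zero.1 ha0, Ideal.span_singleton_one]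
        exact Submodule.Quotient.subsingleton_iff.2 rfl
      exact ⟨0, P, hP, hP0, hc, fun c _ h => h, ⟨LinearEquiv.ofLinearMap (LinearMap.snd _ _ _)
        (LinearMap.inr _ _ _) (LinearMap.ext fun _ => rfl)
        (LinearMap.ext fun x => Subsingleton.elim _ _)⟩⟩
    · refine ⟨1, fun _ => a, fun _ => ha, fun _ => Nat.pos_of_ne_zero ha0, fun _ _ _ => dvd_rfl,
        fun c h _ _ => h, ⟨?_⟩⟩
      exact LinearEquiv.prodUnique.trans
        (LinearEquiv.piUnique K[X] fun _ : Fin 1 => K[X] ⧸ Ideal.span {a}).symm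
  | succ k ih =>
    intro P a hP hP0 hc ha
    obtain ⟨g, a', b', u, v, hg, ha', hb', rfl, hb, h⟩ := exists_monic_gcd_factorization ha (hP 0)
    obtain ⟨k', P', hP', hP0', hc', hle, ⟨e⟩⟩ := ih (fun i => P i.succ) g (fun i => hP _)
      (fun i => hP0 _) (fun i j hij => hc _ _ (Fin.succ_le_succ_iff.2 hij)) hg
    obtain ⟨f⟩ := nonempty_quotient_prod_equiv_gcd_lcm g a' b' u v h
    rw [← hb] at f
    have hl : P 0 ∣ g * a' * b' := ⟨a', by rw [hb]; ring⟩
    have hlm : (g * a' * b').Monic := ha.mul hb'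
    refine ⟨k' + 1, Fin.cons (g * a' * b') P', ?_, ?_, ?_, ?_, ⟨?_⟩⟩
    · exact Fin.cases hlm hP'
    · refine Fin.cases ?_ hP0'
      exact (hP0 0).trans_le (natDegree_le_of_dvd hl hlm.ne_zero)
    · have hd (j) : P' j ∣ g * a' * b' :=
        hle _ ⟨a' * b', by ring⟩ (fun i => (hc 0 _ (Fin.zero_le _)).trans hl) j
      intro i j hij
      induction i using Fin.cases with
      | zero => exact Fin.cases dvd_rfl hd j
      | succ i =>
        induction j using Fin.cases with
        | zero => simp at hij
        | succ j => exact hc' i j (Fin.succ_le_succ_iff.1 hij)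
    · intro c hac hPc
      refine Fin.cases ?_ (hle c ((dvd_mul_right _ _).trans hac) fun i => hPc _)
      have h0 := hPc 0
      obtain ⟨x, hx⟩ := hac
      obtain ⟨y, hy⟩ := h0
      refine ⟨u * y + v * x, ?_⟩
      simp only [Fin.cons_zero]
      rw [hb] at hy
      linear_combination u * a' * hy + v * b' * hx - c * h
    · exact ((LinearEquiv.refl _ _).prodCongr
          (Fin.consLinearEquiv K[X] fun i => K[X] ⧸ Ideal.span {P i}).symm).trans <|
        (LinearEquiv.prodAssoc _ _ _ _).symm.trans <| (f.prodCongr (.refl _ _)).trans <|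
        (LinearEquiv.prodAssoc _ _ _ _).trans <| ((LinearEquiv.refl _ _).prodCongr e).trans <|
        Fin.consLinearEquiv K[X] fun i =>
          K[X] ⧸ Ideal.span {(Fin.cons (g * a' * b') P' : Fin (k' + 1) → K[X]) i}

theorem exists_chain_of_fin {K : Type*} [Field K] : ∀ (k : ℕ) (P : Fin k → K[X]),
    (∀ i, (P i).Monic) →
    ∃ (k' : ℕ) (P' : Fin k' → K[X]), (∀ i, (P' i).Monic) ∧ (∀ i, 0 < (P' i).natDegree) ∧
      (∀ i j, i ≤ j → P' j ∣ P' i) ∧ Nonempty (PiQuotient P ≃ₗ[K[X]] PiQuotient P') := by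
  intro k
  induction k with
  | zero => exact fun P _ => ⟨0, P, (·.elim0), (·.elim0), (·.elim0), ⟨.refl _ _⟩⟩
  | succ k ih =>
    intro P hP
    obtain ⟨k₁, P₁, h₁, h₁', hc₁, ⟨e₁⟩⟩ := ih (fun i => P i.succ) fun i => hP _
    obtain ⟨k₂, P₂, h₂, h₂', hc₂, -, ⟨e₂⟩⟩ := exists_chain_insert k₁ P₁ (P 0) h₁ h₁' hc₁ (hP 0)
    exact ⟨k₂, P₂, h₂, h₂', hc₂,
      ⟨(Fin.consLinearEquiv K[X] fun i => K[X] ⧸ Ideal.span {P i}).symm.trans <|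
        ((LinearEquiv.refl _ _).prodCongr e₁).trans e₂⟩⟩

/-- Existence of the invariant factor decomposition of a finite-dimensional endomorphism. -/
theorem exists_invariant_factors {K V : Type*} [Field K] [AddCommGroup V] [Module K V]
    [Module.Finite K V] (f : Module.End K V) :
    ∃ (k : ℕ) (P : Fin k → K[X]), (∀ i, (P i).Monic) ∧ (∀ i, 0 < (P i).natDegree) ∧
      (∀ i j, i ≤ j → P i ∣ P j) ∧
      ∃ e : V ≃ₗ[K] ∀ i, AdjoinRoot (P i), ∀ v i, e (f v) i = AdjoinRoot.root (P i) * e v i := by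
  classical
  obtain ⟨ι, _, p, hp, m, ⟨e⟩⟩ :=
    Module.equiv_directSum_of_isTorsion (Module.AEval.isTorsion_of_finiteDimensional K V f)
  let q (i : ι) : K[X] := normalize (p i ^ m i)
  let σ := (Fintype.equivFin ι).symm
  have e₁ : Module.AEval' f ≃ₗ[K[X]] PiQuotient fun i => q (σ i) :=
    e.trans <| (DirectSum.linearEquivFunOnFintype K[X] ι _).trans <|
      (LinearEquiv.piCongrRight fun i => Submodule.quotEquivOfEq _ _
        (Ideal.span_singleton_eq_span_singleton.2 (normalize_associated _).symm)).trans <|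
      (LinearEquiv.piCongrLeft K[X] (fun i => K[X] ⧸ Ideal.span {q i}) σ).symm
  obtain ⟨k, P, hP, hP0, hc, ⟨e₂⟩⟩ := exists_chain_of_fin _
    (fun i => q (σ i)) fun i => monic_normalize (pow_ne_zero _ (hp _).ne_zero)
  have e₃ : Module.AEval' f ≃ₗ[K[X]] PiQuotient (fun i : Fin k => P i.rev) :=
    (e₁.trans e₂).trans
      (LinearEquiv.piCongrLeft K[X] (fun i => K[X] ⧸ Ideal.span {P i}) Fin.revPerm).symm
  refine ⟨k, fun i => P i.rev, fun i => hP _, fun i => hP0 _,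
    fun i j hij => hc _ _ (Fin.rev_le_rev.2 hij),
    (Module.AEval'.of f).trans (e₃.restrictScalars K), fun v i => ?_⟩
  have := congrFun (e₃.map_smul X (Module.AEval'.of f v)) i
  rw [Module.AEval'.X_smul_of] at this
  exact this

theorem Matrix.similar_iff_exists_linearEquiv {K m : Type*} [Field K] [Fintype m] [DecidableEq m]
    {A B : Matrix m m K} :
    Matrix.Similar A B ↔
      ∃ φ : (m → K) ≃ₗ[K] (m → K), ∀ v, φ (A.mulVec v) = B.mulVec (φ v) := by
  constructor
  · rintro ⟨S, hS, rfl⟩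
    have hdet := (Matrix.isUnit_iff_isUnit_det S).1 hS
    refine ⟨(Matrix.toLin'OfInv (S.nonsing_inv_mul hdet) (S.mul_nonsing_inv hdet)).symm,
      fun v => ?_⟩
    change S⁻¹.mulVec _ = B.mulVec (S⁻¹.mulVec v)
    simp only [Matrix.mulVec_mulVec, ← Matrix.mul_assoc, S.nonsing_inv_mul hdet, Matrix.one_mul]
  · rintro ⟨φ, hφ⟩
    have h₁ : LinearMap.toMatrix' φ.symm.toLinearMap * LinearMap.toMatrix' φ.toLinearMap = 1 := by
      rw [← LinearMap.toMatrix'_comp]; simp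
    have h₂ : LinearMap.toMatrix' φ.toLinearMap * LinearMap.toMatrix' φ.symm.toLinearMap = 1 := by
      rw [← LinearMap.toMatrix'_comp]; simp
    refine ⟨LinearMap.toMatrix' φ.symm.toLinearMap, ⟨⟨_, _, h₁, h₂⟩, rfl⟩, ?_⟩
    rw [Matrix.inv_eq_right_inv h₁]
    apply Matrix.toLin'.injective
    rw [Matrix.toLin'_mul, Matrix.toLin'_mul, Matrix.toLin'_toMatrix', Matrix.toLin'_toMatrix']
    refine LinearMap.ext fun v => φ.injective ?_
    simp [hφ]

theorem Matrix.similar_reindex_toMatrix_iff {K V κ m : Type*} [Field K] [AddCommGroup V]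
    [Module K V] [Fintype κ] [DecidableEq κ] [Fintype m] [DecidableEq m] {A : Matrix m m K}
    (f : Module.End K V) (b : Module.Basis κ K V) (e : κ ≃ m) :
    Matrix.Similar A (Matrix.reindex e e (LinearMap.toMatrix b b f)) ↔
      ∃ φ : (m → K) ≃ₗ[K] V, ∀ v, φ (A.mulVec v) = f (φ v) := by
  have hB : Matrix.reindex e e (LinearMap.toMatrix b b f) =
      LinearMap.toMatrix (b.reindex e) (b.reindex e) f := by
    ext i j
    simp [LinearMap.toMatrix_apply]
  have hf (v : V) : (LinearMap.toMatrix (b.reindex e) (b.reindex e) f).mulVec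
      ((b.reindex e).equivFun v) = (b.reindex e).equivFun (f v) :=
    LinearMap.toMatrix_mulVec_repr _ _ f v
  rw [hB, Matrix.similar_iff_exists_linearEquiv]
  constructor
  · rintro ⟨φ, hφ⟩
    refine ⟨φ.trans (b.reindex e).equivFun.symm, fun v => (b.reindex e).equivFun.injective ?_⟩
    simp only [← hf, LinearEquiv.trans_apply, LinearEquiv.apply_symm_apply, hφ]
  · rintro ⟨φ, hφ⟩
    refine ⟨φ.trans (b.reindex e).equivFun, fun v => ?_⟩
    simp only [LinearEquiv.trans_apply, hφ, hf]

theorem companionMatrix_natDegree {K : Type*} [Field K] {P : K[X]} (hP : P.Monic) :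
    companionMatrix P.natDegree P =
      Algebra.leftMulMatrix (AdjoinRoot.powerBasisAux' hP) (AdjoinRoot.root P) := by
  have hmin : (AdjoinRoot.powerBasis' hP).minpolyGen = P := by
    rw [PowerBasis.minpolyGen_eq, AdjoinRoot.powerBasis'_gen, AdjoinRoot.minpoly_root hP.ne_zero,
      hP.leadingCoeff]
    simp
  have h := (AdjoinRoot.powerBasis' hP).leftMulMatrix
  rw [AdjoinRoot.powerBasis'_gen, hmin] at h
  refine Eq.trans ?_ h.symm
  ext i j
  have hj : (j : ℕ) < P.natDegree := j.2
  change (if (i : ℕ) = j + 1 then 1 else if (j : ℕ) = P.natDegree - 1 then -P.coeff i else 0) =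
    if (j : ℕ) + 1 = P.natDegree then -P.coeff i else if (i : ℕ) = j + 1 then (1 : K) else 0
  split_ifs <;> first | rfl | omega

theorem toMatrix_pi_mul_root {K : Type*} [Field K] {k : ℕ} {P : Fin k → K[X]}
    (hP : ∀ i, (P i).Monic) :
    LinearMap.toMatrix (Pi.basis fun i => AdjoinRoot.powerBasisAux' (hP i))
        (Pi.basis fun i => AdjoinRoot.powerBasisAux' (hP i))
        (LinearMap.pi fun i =>
          (Algebra.lmul K (AdjoinRoot (P i)) (AdjoinRoot.root (P i))).comp (LinearMap.proj i)) =
      Matrix.blockDiagonal' fun i => companionMatrix (P i).natDegree (P i) := by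
  ext ⟨i, x⟩ ⟨j, y⟩
  simp only [companionMatrix_natDegree (hP _)]
  rw [LinearMap.toMatrix_apply, Pi.basis_repr, Pi.basis_apply]
  by_cases h : i = j
  · subst h
    rw [Matrix.blockDiagonal'_apply_eq, Algebra.leftMulMatrix_eq_repr_mul]
    simp
  · rw [Matrix.blockDiagonal'_apply_ne _ _ _ h]
    simp [Pi.single_eq_of_ne h]

theorem Matrix.elemFactorsSatisfy_iff {K : Type*} [Field K] {n : ℕ} {A : Matrix (Fin n) (Fin n) K}
    {pred : K[X] → Prop} :
    A.ElemFactorsSatisfy pred ↔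
      ∃ (k : ℕ) (P : Fin k → K[X]), (∀ i, (P i).Monic) ∧ (∀ i, 0 < (P i).natDegree) ∧
        (∀ i j, i ≤ j → P i ∣ P j) ∧ (∀ i, pred (P i)) ∧
        ∃ φ : (Fin n → K) ≃ₗ[K] ∀ i, AdjoinRoot (P i),
          ∀ v i, φ (A.mulVec v) i = AdjoinRoot.root (P i) * φ v i := by
  constructor
  · rintro ⟨k, d, P, e, hP, hP0, hd, hc, hs, hpred⟩
    obtain rfl : d = fun i => (P i).natDegree := funext fun i => (hd i).symm
    refine ⟨k, P, hP, hP0, hc, hpred, ?_⟩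
    rw [← toMatrix_pi_mul_root hP] at hs
    obtain ⟨φ, hφ⟩ := (Matrix.similar_reindex_toMatrix_iff _ _ e).1 hs
    exact ⟨φ, fun v i => congrFun (hφ v) i⟩
  · rintro ⟨k, P, hP, hP0, hc, hpred, φ, hφ⟩
    let b := Pi.basis fun i => AdjoinRoot.powerBasisAux' (hP i)
    let e := (b.map φ.symm).indexEquiv (Pi.basisFun K (Fin n))
    refine ⟨k, fun i => (P i).natDegree, P, e, hP, hP0, fun _ => rfl, hc, ?_, hpred⟩
    rw [← toMatrix_pi_mul_root hP]
    exact (Matrix.similar_reindex_toMatrix_iff _ b e).2 ⟨φ, fun v => funext (hφ v)⟩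

/-- `K[X]` is free of rank two over `K[(X - α) (X - β)]`, with basis `1, X - α`. -/
theorem exists_adjoinRoot_comp_equiv {K : Type*} [Field K] (α β : K) {q : K[X]} (hq : q.Monic) :
    ∃ φ : (AdjoinRoot q × AdjoinRoot q) ≃ₗ[K]
        AdjoinRoot (q.comp ((X - C α) * (X - C β))),
      ∀ x y, φ (α • x + AdjoinRoot.root q * y, x + β • y) = AdjoinRoot.root _ * φ (x, y) := by
  set t : K[X] := (X - C α) * (X - C β) with ht
  have htm : t.Monic := (monic_X_sub_C α).mul (monic_X_sub_C β)
  have htd : t.natDegree = 2 := by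
    rw [ht, (monic_X_sub_C α).natDegree_mul (monic_X_sub_C β)]; simp
  have hqt : (q.comp t).Monic := hq.comp htm (by omega)
  let r : AdjoinRoot (q.comp t) := AdjoinRoot.root _
  let κ : AdjoinRoot q →ₐ[K] AdjoinRoot (q.comp t) :=
    AdjoinRoot.liftAlgHom q (Algebra.ofId _ _) (aeval r t) (by
      change aeval (aeval r t) q = 0
      rw [← aeval_comp, AdjoinRoot.aeval_eq, AdjoinRoot.mk_self])
  have hκ : κ (AdjoinRoot.root q) = (r - algebraMap K _ α) * (r - algebraMap K _ β) := by
    simp [κ, ht]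
  let F : (AdjoinRoot q × AdjoinRoot q) →ₗ[K] AdjoinRoot (q.comp t) :=
    κ.toLinearMap.coprod ((LinearMap.mulLeft K (r - algebraMap K _ α)).comp κ.toLinearMap)
  have hF (x y) : F (x, y) = κ x + (r - algebraMap K _ α) * κ y := rfl
  have hFr (x y) : F (α • x + AdjoinRoot.root q * y, x + β • y) = r * F (x, y) := by
    simp only [hF, map_add, map_mul, hκ, Algebra.smul_def, AlgHom.commutes]
    ring
  have hsurj : Function.Surjective F := by
    intro z
    induction z using AdjoinRoot.induction_on with
    | ih p =>
    induction p using Polynomial.induction_on with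
    | C a => exact ⟨(algebraMap K _ a, 0), by
      rw [hF, map_zero, mul_zero, add_zero, AlgHom.commutes]; rfl⟩
    | add p₁ p₂ h₁ h₂ =>
      obtain ⟨a, ha⟩ := h₁
      obtain ⟨b, hb⟩ := h₂
      exact ⟨a + b, by rw [map_add, map_add, ha, hb]⟩
    | monomial n a h =>
      obtain ⟨⟨x, y⟩, h⟩ := h
      refine ⟨_, (hFr x y).trans ?_⟩
      rw [h, pow_succ', mul_left_comm, map_mul _ X, AdjoinRoot.mk_X]
  have := hq.finite_adjoinRoot
  have := hqt.finite_adjoinRoot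
  have hdim : Module.finrank K (AdjoinRoot q × AdjoinRoot q) =
      Module.finrank K (AdjoinRoot (q.comp t)) := by
    rw [Module.finrank_prod, (AdjoinRoot.powerBasis' hq).finrank,
      (AdjoinRoot.powerBasis' hqt).finrank, AdjoinRoot.powerBasis'_dim, AdjoinRoot.powerBasis'_dim,
      natDegree_comp, htd, mul_two]
  exact ⟨LinearEquiv.ofBijective F
    ⟨(LinearMap.injective_iff_surjective_of_finrank_eq_finrank hdim).2 hsurj, hsurj⟩, hFr⟩

/-- The endomorphism `(x, y) ↦ (α x + g y, x + β y)` of `W × W`. -/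
def blockEnd {K W : Type*} [Field K] [AddCommGroup W] [Module K W] (α β : K)
    (g : Module.End K W) : Module.End K (W × W) :=
  (α • LinearMap.fst K W W + g.comp (LinearMap.snd K W W)).prod
    (LinearMap.fst K W W + β • LinearMap.snd K W W)

theorem blockEnd_apply {K W : Type*} [Field K] [AddCommGroup W] [Module K W] (α β : K)
    (g : Module.End K W) (z : W × W) :
    blockEnd α β g z = (α • z.1 + g z.2, z.1 + β • z.2) := rfl

theorem toMatrix_blockEnd {K W κ : Type*} [Field K] [AddCommGroup W] [Module K W] [Fintype κ]
    [DecidableEq κ] (α β : K) (g : Module.End K W) (b : Module.Basis κ K W) :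
    LinearMap.toMatrix (b.prod b) (b.prod b) (blockEnd α β g) =
      Matrix.fromBlocks (α • 1) (LinearMap.toMatrix b b g) 1 (β • 1) := by
  ext (i | i) (j | j) <;>
    simp [LinearMap.toMatrix_apply, blockEnd_apply, Matrix.one_apply, Finsupp.single_apply,
      eq_comm]

theorem exists_similar_fromBlocks_iff {K : Type u} [Field K] {n : ℕ} {α β : K}
    {M : Matrix (Fin n) (Fin n) K} :
    (∃ (m : ℕ) (_ : n = m + m) (N : Matrix (Fin m) (Fin m) K) (e : Fin m ⊕ Fin m ≃ Fin n),
        Matrix.Similar M (Matrix.reindex e e (Matrix.fromBlocks (α • 1) N 1 (β • 1)))) ↔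
      ∃ (W : Type u) (_ : AddCommGroup W) (_ : Module K W) (_ : Module.Finite K W)
        (g : Module.End K W) (φ : (Fin n → K) ≃ₗ[K] W × W),
        ∀ v, φ (M.mulVec v) = blockEnd α β g (φ v) := by
  constructor
  · rintro ⟨m, -, N, e, h⟩
    have hN : N = LinearMap.toMatrix (Pi.basisFun K (Fin m)) (Pi.basisFun K (Fin m))
        (Matrix.toLin' N) := (LinearMap.toMatrix'_toLin' N).symm
    rw [hN, ← toMatrix_blockEnd] at h
    exact ⟨Fin m → K, inferInstance, inferInstance, inferInstance, _,
      (Matrix.similar_reindex_toMatrix_iff _ _ e).1 h⟩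
  · rintro ⟨W, _, _, _, g, φ, hφ⟩
    have hn : n = Module.finrank K W + Module.finrank K W := by
      rw [← Module.finrank_prod, ← φ.finrank_eq, Module.finrank_fin_fun]
    let b := Module.finBasis K W
    refine ⟨_, hn, LinearMap.toMatrix b b g, finSumFinEquiv.trans (finCongr hn.symm), ?_⟩
    rw [← toMatrix_blockEnd]
    exact (Matrix.similar_reindex_toMatrix_iff _ _ _).2 ⟨φ, hφ⟩

/-- The map `∏ i, A i × A i ≃ (∏ i, A i) × (∏ i, A i)`. -/
def piProdEquiv (R : Type*) {ι : Type*} [Semiring R] (A : ι → Type*) [∀ i, AddCommMonoid (A i)]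
    [∀ i, Module R (A i)] : (∀ i, A i × A i) ≃ₗ[R] (∀ i, A i) × (∀ i, A i) where
  toFun f := (fun i => (f i).1, fun i => (f i).2)
  invFun p i := (p.1 i, p.2 i)
  map_add' _ _ := rfl
  map_smul' _ _ := rfl

theorem Matrix.elemFactorsSatisfy_comp_iff {K : Type*} [Field K] {n : ℕ} {α β : K}
    {M : Matrix (Fin n) (Fin n) K} :
    M.ElemFactorsSatisfy (fun p => ∃ q : K[X], p = q.comp ((X - C α) * (X - C β))) ↔
      ∃ (m : ℕ) (_ : n = m + m) (N : Matrix (Fin m) (Fin m) K) (e : Fin m ⊕ Fin m ≃ Fin n),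
        Matrix.Similar M (Matrix.reindex e e (Matrix.fromBlocks (α • 1) N 1 (β • 1))) := by
  have htm : ((X - C α) * (X - C β)).Monic := (monic_X_sub_C α).mul (monic_X_sub_C β)
  have htd : ((X - C α) * (X - C β)).natDegree = 2 := by
    rw [(monic_X_sub_C α).natDegree_mul (monic_X_sub_C β)]; simp
  rw [Matrix.elemFactorsSatisfy_iff, exists_similar_fromBlocks_iff]
  constructor
  · rintro ⟨k, P, hP, -, -, hpred, φ, hφ⟩
    choose q hq using hpred
    obtain rfl := funext hq
    have hqm (i) : (q i).Monic := by
      have := hP i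
      rwa [Monic, leadingCoeff_comp (by omega), htm.leadingCoeff, one_pow, mul_one] at this
    choose ψ hψ using fun i => exists_adjoinRoot_comp_equiv α β (hqm i)
    have hfin i := (hqm i).finite_adjoinRoot
    refine ⟨∀ i, AdjoinRoot (q i), inferInstance, inferInstance, inferInstance,
      LinearMap.pi fun i =>
        (LinearMap.mulLeft K (AdjoinRoot.root (q i))).comp (LinearMap.proj i),
      φ.trans ((LinearEquiv.piCongrRight ψ).symm.trans (piProdEquiv K _)), fun v => ?_⟩
    have key (i) : (ψ i).symm (φ (M.mulVec v) i) =
        (α • ((ψ i).symm (φ v i)).1 + AdjoinRoot.root (q i) * ((ψ i).symm (φ v i)).2,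
          ((ψ i).symm (φ v i)).1 + β • ((ψ i).symm (φ v i)).2) := by
      rw [LinearEquiv.symm_apply_eq, hψ, hφ]
      simp
    exact Prod.ext (funext fun i => congrArg Prod.fst (key i))
      (funext fun i => congrArg Prod.snd (key i))
  · rintro ⟨W, _, _, _, g, φ, hφ⟩
    obtain ⟨k, q, hq, hq0, hc, e, he⟩ := exists_invariant_factors g
    choose ψ hψ using fun i => exists_adjoinRoot_comp_equiv α β (hq i)
    refine ⟨k, fun i => (q i).comp _, fun i => (hq i).comp htm (by omega), fun i => ?_,
      fun i j hij => ?_, fun i => ⟨q i, rfl⟩,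
      φ.trans ((e.prodCongr e).trans
        ((piProdEquiv K _).symm.trans (LinearEquiv.piCongrRight ψ))), fun v i => ?_⟩
    · rw [natDegree_comp, htd]
      exact Nat.mul_pos (hq0 i) two_pos
    · exact map_dvd (compRingHom ((X - C α) * (X - C β))) (hc i j hij)
    · change ψ i (e (φ (M.mulVec v)).1 i, e (φ (M.mulVec v)).2 i) =
        AdjoinRoot.root _ * ψ i (e (φ v).1 i, e (φ v).2 i)
      rw [← hψ, hφ, blockEnd_apply]
      simp [he]

theorem Matrix.Similar.isABComposite {K m : Type*} [Field K] [Fintype m] [DecidableEq m] {a b : K}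
    {A B : Matrix m m K} (h : Matrix.Similar A B) (hB : B.IsABComposite a b) :
    A.IsABComposite a b := by
  obtain ⟨S, hS, rfl⟩ := h
  obtain ⟨P, Q, hP, hQ, rfl⟩ := hB
  have hdet := (Matrix.isUnit_iff_isUnit_det S).1 hS
  have hconj {P : Matrix m m K} (hP : P * P = P) : S * P * S⁻¹ * (S * P * S⁻¹) = S * P * S⁻¹ :=
    calc S * P * S⁻¹ * (S * P * S⁻¹) = S * P * (S⁻¹ * S) * P * S⁻¹ := by
          simp only [Matrix.mul_assoc]
      _ = S * P * S⁻¹ := by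
          rw [S.nonsing_inv_mul hdet, Matrix.mul_one, Matrix.mul_assoc S, hP]
  exact ⟨_, _, hconj hP, hconj hQ, by
    simp only [Matrix.mul_add, Matrix.add_mul, Matrix.mul_smul, Matrix.smul_mul]⟩

theorem Matrix.IsABComposite.reindex {K m n : Type*} [Field K] [Fintype m] [DecidableEq m]
    [Fintype n] [DecidableEq n] {a b : K} {A : Matrix m m K} (hA : A.IsABComposite a b)
    (e : m ≃ n) : (Matrix.reindex e e A).IsABComposite a b := by
  obtain ⟨P, Q, hP, hQ, rfl⟩ := hA
  refine ⟨Matrix.reindex e e P, Matrix.reindex e e Q, ?_, ?_, rfl⟩ <;>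
    simp only [Matrix.reindex_apply, Matrix.submatrix_mul_equiv, hP, hQ]

theorem Matrix.isABComposite_fromBlocks {K m : Type*} [Field K] [Fintype m] [DecidableEq m]
    {α β : K} (hα : α ≠ 0) (hβ : β ≠ 0) (N : Matrix m m K) :
    (Matrix.fromBlocks (α • 1) N 1 (β • 1)).IsABComposite α β := by
  refine ⟨Matrix.fromBlocks 1 (α⁻¹ • N) 0 0, Matrix.fromBlocks 0 0 (β⁻¹ • 1) 1, ?_, ?_, ?_⟩
  · simp [Matrix.fromBlocks_multiply]
  · simp [Matrix.fromBlocks_multiply]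
  · simp [Matrix.fromBlocks_smul, Matrix.fromBlocks_add, smul_smul, hα, hβ]

theorem Matrix.IsABComposite.exists_blockEnd {K : Type u} [Field K] {n : ℕ} {α β : K}
    (hβ : β ≠ 0) {M : Matrix (Fin n) (Fin n) K}
    (h0 : IsUnit M) (hA : IsUnit (M - α • 1)) (hB : IsUnit (M - β • 1))
    (hAB : IsUnit (M - (α + β) • 1)) (hM : M.IsABComposite α β) :
    ∃ (W : Type u) (_ : AddCommGroup W) (_ : Module K W) (_ : Module.Finite K W)
      (g : Module.End K W) (φ : (Fin n → K) ≃ₗ[K] W × W),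
      ∀ v, φ (M.mulVec v) = blockEnd α β g (φ v) := by
  obtain ⟨P, Q, hP, hQ, hPQ⟩ := hM
  have hMv (v : Fin n → K) : M.mulVec v = α • P.mulVec v + β • Q.mulVec v := by
    rw [hPQ, Matrix.add_mulVec, Matrix.smul_mulVec, Matrix.smul_mulVec]
  have hPP (v : Fin n → K) : P.mulVec (P.mulVec v) = P.mulVec v := by
    rw [Matrix.mulVec_mulVec, hP]
  have hQQ (v : Fin n → K) : Q.mulVec (Q.mulVec v) = Q.mulVec v := by
    rw [Matrix.mulVec_mulVec, hQ]
  have noeig {c : K} (hc : IsUnit (M - c • 1)) {v : Fin n → K} (hv : M.mulVec v = c • v) :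
      v = 0 := by
    refine Matrix.mulVec_injective_iff_isUnit.2 hc ?_
    rw [Matrix.sub_mulVec, hv, Matrix.smul_mulVec, Matrix.one_mulVec, sub_self, Matrix.mulVec_zero]
  let p := Matrix.toLin' P
  let q := Matrix.toLin' Q
  have hp (x : p.range) : P.mulVec (x : Fin n → K) = x := by
    obtain ⟨_, x, rfl⟩ := x
    exact hPP x
  have hq (x : q.range) : Q.mulVec (x : Fin n → K) = x := by
    obtain ⟨_, x, rfl⟩ := x
    exact hQQ x
  have hker : Disjoint p.ker q.ker := by
    rw [Submodule.disjoint_def]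
    intro x (hx : P.mulVec x = 0) (hy : Q.mulVec x = 0)
    exact noeig (c := 0) (by simpa using h0) (by rw [hMv, hx, hy]; simp)
  have hker_range : Disjoint p.ker q.range := by
    rw [Submodule.disjoint_def]
    intro x (hx : P.mulVec x = 0) hy
    exact noeig hB (by rw [hMv, hx, hq ⟨x, hy⟩]; simp)
  have hrange_ker : Disjoint p.range q.ker := by
    rw [Submodule.disjoint_def]
    intro x hx (hy : Q.mulVec x = 0)
    exact noeig hA (by rw [hMv, hy, hp ⟨x, hx⟩]; simp)
  have hrange : Disjoint p.range q.range := by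
    rw [Submodule.disjoint_def]
    intro x hx hy
    exact noeig hAB (by rw [hMv, hp ⟨x, hx⟩, hq ⟨x, hy⟩, add_smul])
  have hdim : Module.finrank K (p.range × p.range) = Module.finrank K (Fin n → K) := by
    have h₁ := Submodule.finrank_add_finrank_le_of_disjoint hker
    have h₂ := Submodule.finrank_add_finrank_le_of_disjoint hker_range
    have h₃ := Submodule.finrank_add_finrank_le_of_disjoint hrange_ker
    have h₄ := Submodule.finrank_add_finrank_le_of_disjoint hrange
    have h₅ := p.finrank_range_add_finrank_ker
    have h₆ := q.finrank_range_add_finrank_ker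
    rw [Module.finrank_prod]
    omega
  let F : (p.range × p.range) →ₗ[K] (Fin n → K) :=
    p.range.subtype.coprod (β • q.comp p.range.subtype)
  have hF (x y : p.range) : F (x, y) = x + β • Q.mulVec y := rfl
  have hinj : Function.Injective F := by
    rw [← LinearMap.ker_eq_bot, LinearMap.ker_eq_bot']
    rintro ⟨x, y⟩ hxy
    rw [hF] at hxy
    have hx : (x : Fin n → K) = 0 := by
      refine Submodule.disjoint_def.1 hrange x x.2 ?_
      rw [eq_neg_of_add_eq_zero_left hxy]
      exact neg_mem (Submodule.smul_mem _ _ ⟨_, rfl⟩)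
    have hy : (y : Fin n → K) = 0 := by
      refine Submodule.disjoint_def.1 hrange_ker y y.2 ?_
      rw [hx, zero_add] at hxy
      exact (smul_eq_zero.1 hxy).resolve_left hβ
    exact Prod.ext (Subtype.ext hx) (Subtype.ext hy)
  let φ := LinearEquiv.ofBijective F
    ⟨hinj, (LinearMap.injective_iff_surjective_of_finrank_eq_finrank hdim).1 hinj⟩
  have hφ (z) : φ z = F z := rfl
  refine ⟨p.range, inferInstance, inferInstance, inferInstance,
    (α * β) • p.rangeRestrict.comp (q.comp p.range.subtype), φ.symm, fun v => ?_⟩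
  obtain ⟨⟨x, y⟩, rfl⟩ := φ.surjective v
  rw [LinearEquiv.symm_apply_eq, LinearEquiv.symm_apply_apply, hφ, hφ, blockEnd_apply, hF, hF, hMv]
  change _ = α • (x : Fin n → K) + (α * β) • P.mulVec (Q.mulVec y) +
    β • Q.mulVec (x + β • (y : Fin n → K))
  simp only [Matrix.mulVec_add, Matrix.mulVec_smul, hp, hQQ, smul_add, smul_smul]

/-- For a matrix `M` with no eigenvalue in `{0, α, β, α+β}` (equivalently, `M`, `M−αI`, `M−βI`,
`M−(α+β)I` all invertible), the following are equivalent: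
(i) every elementary factor of `M` is a polynomial in `(X−α)(X−β)`;
(ii) `n` is even and `M` is similar to `[[α·I, N],[I, β·I]]` for some `N`;
(iii) `M` is an `(α,β)`-composite. -/
theorem elemFactors_iff_block_iff_composite
    {K : Type*} [Field K] {n : ℕ} (α β : K) (hα : α ≠ 0) (hβ : β ≠ 0)
    (M : Matrix (Fin n) (Fin n) K)
    (h0 : IsUnit M) (hA : IsUnit (M - α • 1)) (hB : IsUnit (M - β • 1))
    (hAB : IsUnit (M - (α + β) • 1)) :
    (Matrix.ElemFactorsSatisfy M
        (fun p => ∃ q : K[X],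
          p = q.comp ((Polynomial.X - Polynomial.C α) * (Polynomial.X - Polynomial.C β))) ↔
      ∃ (m : ℕ) (hm : n = m + m) (N : Matrix (Fin m) (Fin m) K) (e : Fin m ⊕ Fin m ≃ Fin n),
        Matrix.Similar M
          (Matrix.reindex e e (Matrix.fromBlocks (α • 1) N 1 (β • 1)))) ∧
    ((∃ (m : ℕ) (hm : n = m + m) (N : Matrix (Fin m) (Fin m) K) (e : Fin m ⊕ Fin m ≃ Fin n),
        Matrix.Similar M
          (Matrix.reindex e e (Matrix.fromBlocks (α • 1) N 1 (β • 1)))) ↔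
      Matrix.IsABComposite α β M) := by
  refine ⟨Matrix.elemFactorsSatisfy_comp_iff, ?_, fun h => ?_⟩
  · rintro ⟨m, -, N, e, h⟩
    exact h.isABComposite ((Matrix.isABComposite_fromBlocks hα hβ N).reindex e)
  · exact exists_similar_fromBlocks_iff.2 (h.exists_blockEnd hβ h0 hA hB hAB)
end

section
/- Let K be a field, α, β ∈ K nonzero, and P ∈ K[X] a monic polynomial of degree n ≥ 1. Then the block matrix [[α·I_n, C(P)],[I_n, β·I_n]] ∈ M_{2n}(K) is similar to the companion matrix C(P∘Y), where Y = (X−α)(X−β) and P∘Y denotes the composite polynomial P((X−α)(X−β)). -/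
open Polynomial

/-- On coefficient vectors, `companionMatrix d Q` acts as multiplication by `X` followed by
the cancellation of the coefficient of `X ^ d` against `Q`. -/
theorem companionMatrix_mulVec_coeff {K : Type*} [Field K] {d : ℕ} (hd : 1 ≤ d) (Q p : K[X])
    (i : Fin d) :
    (companionMatrix d Q).mulVec (fun j => p.coeff j) i =
      (X * p - C (p.coeff (d - 1)) * Q).coeff i := by
  obtain ⟨m, rfl⟩ : ∃ m, d = m + 1 := ⟨d - 1, by omega⟩
  have hentry (j : Fin (m + 1)) : companionMatrix (m + 1) Q i j * p.coeff j =
      (if (i : ℕ) = j + 1 then p.coeff j else 0) +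
        if j = Fin.last m then -Q.coeff i * p.coeff m else 0 := by
    have hi := i.isLt
    by_cases hj : j = Fin.last m
    · subst hj
      simp [companionMatrix, hi.ne]
    · have hj' : (j : ℕ) ≠ m := fun h => hj (Fin.ext h)
      simp [companionMatrix, hj, hj']
  simp only [Matrix.mulVec, dotProduct, hentry, Finset.sum_add_distrib, Finset.sum_ite_eq',
    Finset.mem_univ, if_true, Nat.add_sub_cancel, coeff_sub, coeff_C_mul]
  obtain ⟨i, hi⟩ := i
  cases i with
  | zero => simp [mul_comm]
  | succ k =>
    have hk : k < m + 1 := by omega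
    have hsum : ∑ j : Fin (m + 1), (if k + 1 = (j : ℕ) + 1 then p.coeff j else 0) =
        p.coeff k := by
      rw [Finset.sum_eq_single ⟨k, hk⟩]
      · simp
      · intro j _ hj
        exact if_neg fun h => hj (Fin.ext (Nat.succ.inj h).symm)
      · simp
    simp only [hsum, coeff_X_mul]
    ring

/-- A matrix describing multiplication by `X` modulo `Q` in a basis of the polynomials of degree
less than `d` is similar to `companionMatrix d Q`. -/
theorem similar_companionMatrix_of_linearIndependent {K : Type*} [Field K] {d : ℕ} (hd : 1 ≤ d)
    (Q : K[X]) (b : Fin d → K[X]) (hb : LinearIndependent K b) (hdeg : ∀ k, (b k).natDegree < d)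
    (A : Matrix (Fin d) (Fin d) K)
    (hA : ∀ k, ∑ l, C (A l k) * b l = X * b k - C ((b k).coeff (d - 1)) * Q) :
    Matrix.Similar A (companionMatrix d Q) := by
  let T : Matrix (Fin d) (Fin d) K := Matrix.of fun i k => (b k).coeff i
  have hT : IsUnit T := by
    rw [← Matrix.linearIndependent_cols_iff_isUnit, Fintype.linearIndependent_iff]
    intro g hg
    refine Fintype.linearIndependent_iff.1 hb g (Polynomial.ext fun i => ?_)
    simp only [finsetSum_coeff, coeff_smul, smul_eq_mul, coeff_zero]
    by_cases hi : i < d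
    · simpa [T] using congrFun hg ⟨i, hi⟩
    · refine Finset.sum_eq_zero fun k _ => ?_
      rw [coeff_eq_zero_of_natDegree_lt ((hdeg k).trans_le (not_lt.1 hi)), mul_zero]
  have hcomm : T * A = companionMatrix d Q * T := by
    ext i k
    calc (T * A) i k = (∑ l, C (A l k) * b l).coeff i := by
          simp [T, Matrix.mul_apply, finsetSum_coeff, mul_comm]
      _ = (companionMatrix d Q * T) i k := by
          rw [hA, ← companionMatrix_mulVec_coeff hd]
          rfl
  have hdet : IsUnit T.det := (Matrix.isUnit_iff_isUnit_det T).1 hT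
  refine ⟨T⁻¹, (Matrix.isUnit_nonsing_inv_iff).2 hT, ?_⟩
  rw [Matrix.nonsing_inv_nonsing_inv _ hdet, mul_assoc, ← hcomm, ← mul_assoc,
    Matrix.nonsing_inv_mul _ hdet, one_mul]

/-- The columns of `companionMatrix d P`, read as polynomials evaluated at `Y`. -/
theorem sum_companionMatrix_mul_pow {K : Type*} [Field K] {d : ℕ} (hd : 1 ≤ d) {P : K[X]}
    (hP : P.Monic) (hdeg : P.natDegree = d) (Y : K[X]) (j : Fin d) :
    ∑ i, C (companionMatrix d P i j) * Y ^ (i : ℕ) =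
      Y ^ (j + 1 : ℕ) - if (j : ℕ) = d - 1 then P.comp Y else 0 := by
  have hj := j.isLt
  by_cases h : (j : ℕ) = d - 1
  · have hcol (i : Fin d) : companionMatrix d P i j = -P.coeff i := by
      have hi := i.isLt
      simp [companionMatrix, h]
      omega
    have hcomp : P.comp Y = (∑ i : Fin d, C (P.coeff i) * Y ^ (i : ℕ)) + Y ^ d := by
      rw [comp, eval₂_eq_sum_range, hdeg, Finset.sum_range_succ, ← hdeg, hP.coeff_natDegree,
        Finset.sum_range, C_1, one_mul]
    simp only [hcol, C_neg, neg_mul, Finset.sum_neg_distrib, if_pos h, hcomp]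
    rw [show (j : ℕ) + 1 = d by omega]
    ring
  · rw [if_neg h, sub_zero, Finset.sum_eq_single ⟨j + 1, by omega⟩]
    · simp [companionMatrix]
    · intro i _ hi
      have : (i : ℕ) ≠ j + 1 := fun h' => hi (Fin.ext h')
      simp [companionMatrix, h, this]
    · simp

/-- For monic `P` of degree `n ≥ 1`, the block matrix `[[α·I, C(P)],[I, β·I]]` is similar to
the companion matrix of `P((X−α)(X−β))`. -/
theorem block_companion_similar_companion_comp
    {K : Type*} [Field K] (α β : K) (hα : α ≠ 0) (hβ : β ≠ 0)
    (n : ℕ) (hn : 1 ≤ n) (P : K[X]) (hP : P.Monic) (hdeg : P.natDegree = n) :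
    Matrix.Similar
      (Matrix.reindex finSumFinEquiv finSumFinEquiv
        (Matrix.fromBlocks (α • 1) (companionMatrix n P) 1 (β • 1)))
      (companionMatrix (n + n)
        (P.comp ((Polynomial.X - Polynomial.C α) * (Polynomial.X - Polynomial.C β)))) := by
  set Y : K[X] := (X - C α) * (X - C β) with hY
  have hYm : Y.Monic := (monic_X_sub_C α).mul (monic_X_sub_C β)
  have hYd (j : ℕ) : (Y ^ j).natDegree = 2 * j := by
    rw [hYm.natDegree_pow, hY, (monic_X_sub_C α).natDegree_mul (monic_X_sub_C β)]
    simp [mul_comm]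
  have hfm (j : ℕ) : ((X - C α) * Y ^ j).Monic := (monic_X_sub_C α).mul (hYm.pow j)
  have hfd (j : ℕ) : ((X - C α) * Y ^ j).natDegree = 2 * j + 1 := by
    rw [(monic_X_sub_C α).natDegree_mul (hYm.pow j), hYd, natDegree_X_sub_C, add_comm]
  let b : Fin n ⊕ Fin n → K[X] :=
    Sum.elim (fun j => Y ^ (j : ℕ)) (fun j => (X - C α) * Y ^ (j : ℕ))
  let S : Polynomial.Sequence K :=
    { elems' := fun i => if i % 2 = 0 then Y ^ (i / 2) else (X - C α) * Y ^ (i / 2)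
      degree_eq' := fun i => by
        split_ifs with h
        · rw [degree_eq_natDegree (hYm.pow _).ne_zero, hYd, show 2 * (i / 2) = i by omega]
        · rw [degree_eq_natDegree (hfm _).ne_zero, hfd, show 2 * (i / 2) + 1 = i by omega] }
  let e : Fin n ⊕ Fin n → ℕ := Sum.elim (fun j => 2 * j) (fun j => 2 * j + 1)
  have he : Function.Injective e := by
    rintro (i | i) (j | j) h <;> simp only [e, Sum.elim_inl, Sum.elim_inr] at h
    · exact congrArg _ (Fin.ext (by omega))
    · omega
    · omega
    · exact congrArg _ (Fin.ext (by omega))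
  have hbS : b = S ∘ e := by
    funext k
    rcases k with j | j
    · simp [b, S, e]
    · simp [b, S, e, Nat.add_mod, show (2 * (j : ℕ) + 1) / 2 = j by omega]
  have hb : LinearIndependent K b := hbS ▸ S.linearIndependent.comp e he
  refine similar_companionMatrix_of_linearIndependent (by omega) _ (b ∘ finSumFinEquiv.symm)
    (hb.comp _ finSumFinEquiv.symm.injective) (fun k => ?_) _ (fun k => ?_)
  · obtain ⟨j | j, rfl⟩ := finSumFinEquiv.surjective k
    · have := j.isLt
      simp only [Function.comp_apply, Equiv.symm_apply_apply, b, Sum.elim_inl, hYd]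
      omega
    · have := j.isLt
      simp only [Function.comp_apply, Equiv.symm_apply_apply, b, Sum.elim_inr, hfd]
      omega
  · obtain ⟨k, rfl⟩ := finSumFinEquiv.surjective k
    rw [← finSumFinEquiv.sum_comp]
    simp only [Function.comp_apply, Equiv.symm_apply_apply, Matrix.reindex_apply,
      Matrix.submatrix_apply, Fintype.sum_sum_type]
    rcases k with j | j
    · have hcoeff : (Y ^ (j : ℕ)).coeff (n + n - 1) = 0 :=
        coeff_eq_zero_of_natDegree_lt (by rw [hYd]; omega)
      simp [b, hcoeff, Matrix.one_apply, apply_ite C, ite_mul, mul_ite]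
      ring
    · have hcoeff : ((X - C α) * Y ^ (j : ℕ)).coeff (n + n - 1) =
          if (j : ℕ) = n - 1 then 1 else 0 := by
        split_ifs with h
        · rw [show n + n - 1 = 2 * (j : ℕ) + 1 by omega, ← hfd, (hfm _).coeff_natDegree]
        · exact coeff_eq_zero_of_natDegree_lt (by rw [hfd]; omega)
      simp only [b, Sum.elim_inl, Sum.elim_inr, Matrix.fromBlocks_apply₁₂,
        Matrix.fromBlocks_apply₂₂, sum_companionMatrix_mul_pow hn hP hdeg, hcoeff]
      have hdiag : ∑ i : Fin n, C ((β • (1 : Matrix (Fin n) (Fin n) K)) i j) *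
          ((X - C α) * Y ^ (i : ℕ)) = C β * ((X - C α) * Y ^ (j : ℕ)) := by
        simp [Matrix.one_apply, apply_ite C, ite_mul, mul_ite]
      rw [hdiag, pow_succ]
      nth_rewrite 2 [hY]
      split_ifs <;> simp only [C_1, C_0] <;> ring
end

section
/- Let K be a field and α ∈ K nonzero. Every nilpotent matrix N ∈ M_n(K) is an (α,−α)-composite, i.e. there exist idempotent matrices P, Q ∈ M_n(K) with N = α·P − α·Q. -/
theorem exists_disjoint_sup_eq_of_le {L : Type*} [Lattice L] [BoundedOrder L] [IsModularLattice L]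
    [ComplementedLattice L] {a b c : L} (hab : Disjoint a b) (hac : a ≤ c) (hbc : b ≤ c) :
    ∃ d, a ≤ d ∧ d ≤ c ∧ Disjoint d b ∧ d ⊔ b = c := by
  obtain ⟨e, hae, he⟩ := hab.exists_isCompl
  refine ⟨e ⊓ c, le_inf hae hac, inf_le_right, he.disjoint.mono_left inf_le_left, ?_⟩
  rw [sup_comm, ← sup_inf_assoc_of_le e hbc, sup_comm, he.sup_eq_top, top_inf_eq]

section Grading

variable {K V : Type*} [Field K] [AddCommGroup V] [Module K V]

/-- A `ℤ/2`-grading of the image `f(X) ⊆ X` for which `f` is odd extends to such a grading of `X`. -/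
theorem LinearMap.exists_odd_grading_of_map (f : V →ₗ[K] V) {X W₀ W₁ : Submodule K V}
    (hX : X.map f = W₀ ⊔ W₁) (hWX : W₀ ⊔ W₁ ≤ X) (hW : Disjoint W₀ W₁)
    (h₀ : W₀ ≤ W₁.comap f) (h₁ : W₁ ≤ W₀.comap f) :
    ∃ V₀ V₁ : Submodule K V, Disjoint V₀ V₁ ∧ V₀ ⊔ V₁ = X ∧
      V₀ ≤ V₁.comap f ∧ V₁ ≤ V₀.comap f := by
  set A := X ⊓ W₁.comap f
  set B := X ⊓ W₀.comap f
  have hW₀A : W₀ ≤ A := le_inf (le_sup_left.trans hWX) h₀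
  have hW₁B : W₁ ≤ B := le_inf (le_sup_right.trans hWX) h₁
  have hAB : X ≤ A ⊔ B := by
    intro x hx
    have hfx : f x ∈ W₀ ⊔ W₁ := hX ▸ Submodule.mem_map_of_mem hx
    obtain ⟨w₀, hw₀, w₁, hw₁, hw⟩ := Submodule.mem_sup.1 hfx
    obtain ⟨y, hy, rfl⟩ : w₀ ∈ X.map f := hX ▸ Submodule.mem_sup_left hw₀
    refine Submodule.mem_sup.2 ⟨x - y, ⟨X.sub_mem hx hy, ?_⟩, y, ⟨hy, hw₀⟩, sub_add_cancel x y⟩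
    simpa [← hw] using hw₁
  obtain ⟨V₁, hWV₁, hV₁B, hdis₁, hsup₁⟩ :=
    exists_disjoint_sup_eq_of_le (hW.symm.mono_right (inf_le_left : W₀ ⊓ B ≤ W₀)) hW₁B inf_le_right
  have hdis : Disjoint W₀ (V₁ ⊓ A) := by
    rw [disjoint_iff_inf_le] at hdis₁ ⊢
    refine le_trans ?_ hdis₁
    exact le_inf (inf_le_right.trans inf_le_left)
      (le_inf inf_le_left ((inf_le_right.trans inf_le_left).trans hV₁B))
  obtain ⟨V₀, hWV₀, hV₀A, hdis₀, hsup₀⟩ :=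
    exists_disjoint_sup_eq_of_le hdis hW₀A inf_le_right
  refine ⟨V₀, V₁, ?_, le_antisymm ?_ ?_, ?_, ?_⟩
  · rw [disjoint_iff_inf_le] at hdis₀ ⊢
    exact le_trans (le_inf inf_le_left (le_inf inf_le_right (inf_le_left.trans hV₀A))) hdis₀
  · exact sup_le (hV₀A.trans inf_le_left) (hV₁B.trans inf_le_left)
  · have hAle : A ≤ V₀ ⊔ V₁ := hsup₀ ▸ sup_le_sup_left inf_le_left _
    refine hAB.trans (sup_le hAle ?_)
    exact hsup₁ ▸ sup_le le_sup_right ((inf_le_left.trans hW₀A).trans hAle)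
  · exact (hV₀A.trans inf_le_right).trans (Submodule.comap_mono hWV₁)
  · exact (hV₁B.trans inf_le_right).trans (Submodule.comap_mono hWV₀)

theorem IsNilpotent.exists_odd_grading {f : Module.End K V} (hf : IsNilpotent f) :
    ∃ V₀ V₁ : Submodule K V, IsCompl V₀ V₁ ∧ V₀ ≤ V₁.comap f ∧ V₁ ≤ V₀.comap f := by
  obtain ⟨m, hm⟩ := hf
  have key : ∃ V₀ V₁ : Submodule K V, Disjoint V₀ V₁ ∧ V₀ ⊔ V₁ = (f ^ 0).range ∧
      V₀ ≤ V₁.comap f ∧ V₁ ≤ V₀.comap f := by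
    refine Nat.decreasingInduction
      (motive := fun j _ ↦ ∃ V₀ V₁ : Submodule K V, Disjoint V₀ V₁ ∧ V₀ ⊔ V₁ = (f ^ j).range ∧
        V₀ ≤ V₁.comap f ∧ V₁ ≤ V₀.comap f) ?_ ?_ (Nat.zero_le m)
    · rintro j - ⟨W₀, W₁, hdis, hsup, h₀, h₁⟩
      refine f.exists_odd_grading_of_map ?_ ?_ hdis h₀ h₁
      · rw [hsup, pow_succ', Module.End.mul_eq_comp, LinearMap.range_comp]
      · rw [hsup, _root_.pow_succ, Module.End.mul_eq_comp]
        exact LinearMap.range_comp_le_range _ _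
    · exact ⟨⊥, ⊥, disjoint_bot_left, by rw [hm, LinearMap.range_zero, sup_bot_eq], bot_le, bot_le⟩
  obtain ⟨V₀, V₁, hdis, hsup, h⟩ := key
  refine ⟨V₀, V₁, ⟨hdis, codisjoint_iff.2 ?_⟩, h⟩
  rw [hsup, pow_zero, Module.End.one_eq_id, LinearMap.range_id]

theorem IsNilpotent.exists_isIdempotentElem_mul_add_mul_eq {f : Module.End K V}
    (hf : IsNilpotent f) : ∃ e : Module.End K V, IsIdempotentElem e ∧ f * e + e * f = f := by
  obtain ⟨V₀, V₁, hc, h₀, h₁⟩ := hf.exists_odd_grading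
  refine ⟨V₀.projection V₁ hc, V₀.isIdempotentElem_projection hc, LinearMap.ext fun v ↦ ?_⟩
  obtain ⟨a, ha, b, hb, rfl⟩ :=
    Submodule.mem_sup.1 (hc.sup_eq_top ▸ Submodule.mem_top : v ∈ V₀ ⊔ V₁)
  have ha' : V₀.projection V₁ hc a = a := V₀.projection_apply_of_mem_left hc ha
  have hb' : V₀.projection V₁ hc b = 0 := (V₀.projection_apply_eq_zero_iff hc).2 hb
  have hfa : V₀.projection V₁ hc (f a) = 0 := (V₀.projection_apply_eq_zero_iff hc).2 (h₀ ha)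
  have hfb : V₀.projection V₁ hc (f b) = f b := V₀.projection_apply_of_mem_left hc (h₁ hb)
  simp [ha', hb', hfa, hfb]

end Grading

theorem IsIdempotentElem.exists_sub_eq_of_mul_add_mul_eq {R : Type*} [Ring R] {x e : R}
    (he : IsIdempotentElem e) (h : x * e + e * x = x) :
    ∃ p q : R, IsIdempotentElem p ∧ IsIdempotentElem q ∧ x = p - q := by
  have he' : e * e = e := he
  have hz : e * x * e = 0 := by
    have := congrArg (e * ·) h
    simpa [mul_add, ← mul_assoc, he'] using this
  have hz' : e * (x * e) = 0 := by rw [← mul_assoc, hz]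
  have hee (y : R) : e * (e * y) = e * y := by rw [← mul_assoc, he']
  have hzz (y : R) : e * (x * (e * y)) = 0 := by rw [← mul_assoc x, ← mul_assoc e, hz', zero_mul]
  refine ⟨e + e * x, e - x * e, ?_, ?_, ?_⟩
  · simp [IsIdempotentElem, mul_add, add_mul, mul_assoc, he', hee, hz', hzz]
  · simp [IsIdempotentElem, mul_sub, sub_mul, mul_assoc, he', hz']
  · rw [add_sub_sub_cancel, add_comm, h]

/-- Every nilpotent matrix is an `(α,−α)`-composite: it is `α•P − α•Q`
for some idempotent matrices `P` and `Q`. -/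
theorem nilpotent_isABComposite {K : Type*} [Field K] {n : ℕ}
    (α : K) (hα : α ≠ 0) (N : Matrix (Fin n) (Fin n) K) (hN : IsNilpotent N) :
    ∃ P Q : Matrix (Fin n) (Fin n) K,
      P * P = P ∧ Q * Q = Q ∧ N = α • P - α • Q := by
  let φ := Matrix.toLinAlgEquiv' (R := K) (n := Fin n)
  obtain ⟨e, he, h⟩ := ((hN.smul α⁻¹).map φ).exists_isIdempotentElem_mul_add_mul_eq
  obtain ⟨p, q, hp, hq, hpq⟩ := he.exists_sub_eq_of_mul_add_mul_eq h
  refine ⟨φ.symm p, φ.symm q, hp.map φ.symm, hq.map φ.symm, ?_⟩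
  rw [← smul_sub, ← map_sub, ← hpq, AlgEquiv.symm_apply_apply, smul_inv_smul₀ hα]
end
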